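/- For every η > 0 there exists n₀ such that the following holds for all n ≥ n₀ with 3 ∣ n: every 5-uniform hypergraph H on n vertices with minimum 2-degree δ₂(H) ≥ (91/216 + η)·C(n,3) contains a Hamilton 2-cycle. -/

import Mathlib

/-- `H` is a `k`-uniform hypergraph (a `k`-graph) on the vertex set `Fin n`. -/
def IsKGraph (n k : ℕ) (H : Finset (Finset (Fin n))) : Prop :=
  ∀ e ∈ H, e.card = k

/-- The degree `deg_H(S)` of a vertex set `S` in the `k`-graph `H`: the number of
`(k - |S|)`-sets `T` disjoint from `S` with `S ∪ T ∈ H`. -/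
noncomputable def hDeg (n k : ℕ) (H : Finset (Finset (Fin n))) (S : Finset (Fin n)) : ℕ :=
  Nat.card {T : Finset (Fin n) // T.card = k - S.card ∧ Disjoint S T ∧ S ∪ T ∈ H}

/-- The minimum `d`-degree `δ_d(H)` of a `k`-graph `H` on `Fin n`. -/
noncomputable def minDeg (n k d : ℕ) (H : Finset (Finset (Fin n))) : ℕ :=
  sInf { m : ℕ | ∃ S : Finset (Fin n), S.card = d ∧ hDeg n k H S = m }

/-- `H` contains a Hamilton `ℓ`-cycle: there is a cyclic ordering of all the vertices such
that the `n / (k - ℓ)` segments of `k` consecutive vertices starting at the positions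
divisible by `k - ℓ` are all edges of `H` (hence every two consecutive edges share
exactly `ℓ` vertices). -/
def HasHamiltonCycle (n k l : ℕ) (H : Finset (Finset (Fin n))) : Prop :=
  ∃ f : ZMod n → Fin n, Function.Bijective f ∧
    ∀ j < n / (k - l),
      ((Finset.range k).image (fun i => f ((j * (k - l) + i : ℕ) : ZMod n))) ∈ H

/-- `f` enumerates (the vertices, in order, of) an `ℓ`-path with `t` edges in `H`:
the `j`-th edge consists of the `k` consecutive vertices starting at position `j * (k - ℓ)`,
so every two consecutive edges share exactly `ℓ` vertices. -/
def IsLPath (n k l t : ℕ) (H : Finset (Finset (Fin n))) (f : ℕ → Fin n) : Prop :=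
  Set.InjOn f (Set.Iio (t * (k - l) + l)) ∧
  ∀ j < t, ((Finset.range k).image (fun i => f (j * (k - l) + i))) ∈ H

/-- The vertex set of the `ℓ`-path with `t` edges enumerated by `f`. -/
def pathVerts (n k l t : ℕ) (f : ℕ → Fin n) : Finset (Fin n) :=
  (Finset.range (t * (k - l) + l)).image f

/-- The first `ℓ` vertices (as an ordered `ℓ`-set) of the path enumerated by `f`. -/
def pathBeg (n l : ℕ) (f : ℕ → Fin n) : Fin l → Fin n := fun i => f (i : ℕ)

/-- The last `ℓ` vertices (as an ordered `ℓ`-set) of an `ℓ`-path with `t` edges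
enumerated by `f`. -/
def pathEnd (n k l t : ℕ) (f : ℕ → Fin n) : Fin l → Fin n := fun i => f (t * (k - l) + (i : ℕ))

/-- `T` is a reachable set for the pair `{u, v}` (with parameter `i`): there are
vertex-disjoint `ℓ`-paths `P₁, …, Pᵢ` of length two covering exactly `T ∪ {u}` and
vertex-disjoint `ℓ`-paths `P₁', …, Pᵢ'` of length two covering exactly `T ∪ {v}`,
where `P_j` and `P_j'` have the same (ordered) ends for all `j`. -/
def ReachSet (n k l i : ℕ) (H : Finset (Finset (Fin n))) (u v : Fin n)
    (T : Finset (Fin n)) : Prop :=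
  ∃ P P' : Fin i → ℕ → Fin n,
    (∀ j, IsLPath n k l 2 H (P j)) ∧ (∀ j, IsLPath n k l 2 H (P' j)) ∧
    (∀ j j', j ≠ j' → Disjoint (pathVerts n k l 2 (P j)) (pathVerts n k l 2 (P j'))) ∧
    (∀ j j', j ≠ j' → Disjoint (pathVerts n k l 2 (P' j)) (pathVerts n k l 2 (P' j'))) ∧
    (Finset.univ.biUnion (fun j => pathVerts n k l 2 (P j)) = insert u T) ∧
    (Finset.univ.biUnion (fun j => pathVerts n k l 2 (P' j)) = insert v T) ∧
    (∀ j, pathBeg n l (P j) = pathBeg n l (P' j) ∧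
      pathEnd n k l 2 (P j) = pathEnd n k l 2 (P' j))

/-- `u` and `v` are `(β, i)`-reachable in the `k`-graph `H` on `n` vertices: there are at
least `β * n ^ ((2k - ℓ) i - 1)` sets `T` of size `(2k - ℓ) i - 1` that are reachable sets
for `{u, v}`. -/
def Reachable (n k l : ℕ) (H : Finset (Finset (Fin n))) (β : ℝ) (i : ℕ) (u v : Fin n) : Prop :=
  β * (n : ℝ) ^ ((2 * k - l) * i - 1) ≤
    (Nat.card {T : Finset (Fin n) // T.card = (2 * k - l) * i - 1 ∧
      ReachSet n k l i H u v T} : ℝ)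

/-- `H` contains a `Y_{k,2ℓ}`-tiling (vertex-disjoint copies of the `k`-graph consisting of
two edges intersecting in exactly `2ℓ` vertices) covering all but at most `u` vertices. -/
def HasYTilingCover (n l : ℕ) (H : Finset (Finset (Fin n))) (u : ℝ) : Prop :=
  ∃ (m : ℕ) (e₁ e₂ : Fin m → Finset (Fin n)),
    (∀ j, e₁ j ∈ H ∧ e₂ j ∈ H ∧ ((e₁ j) ∩ (e₂ j)).card = 2 * l) ∧
    (∀ j j', j ≠ j' → Disjoint ((e₁ j) ∪ (e₂ j)) ((e₁ j') ∪ (e₂ j'))) ∧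
    (n : ℝ) - ((Finset.univ.biUnion fun j => (e₁ j) ∪ (e₂ j)).card : ℝ) ≤ u

/-- The tiling threshold `t_d^ℓ(k, n, ε)`: the minimum `t` such that every `k`-graph `H`
on `n` vertices with `δ_d(H) ≥ t` contains a `Y_{k,2ℓ}`-tiling covering all but at most
`ε n` vertices. -/
noncomputable def tThreshold (k d l n : ℕ) (ε : ℝ) : ℕ :=
  sInf { t : ℕ | ∀ H : Finset (Finset (Fin n)), IsKGraph n k H →
    t ≤ minDeg n k d H → HasYTilingCover n l H (ε * n) }

/-- `t(k,d,ℓ) := limsup_{ε → 0⁺} limsup_{n → ∞} t_d^ℓ(k,n,ε) / C(n, k-d)`. -/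
noncomputable def tVal (k d l : ℕ) : ℝ :=
  Filter.limsup
    (fun ε : ℝ => Filter.limsup
      (fun n : ℕ => (tThreshold k d l n ε : ℝ) / (n.choose (k - d) : ℝ)) Filter.atTop)
    (nhdsWithin (0 : ℝ) (Set.Ioi (0 : ℝ)))

/-- The Dirac threshold `h_d^ℓ(k, n)`: the smallest `h` such that every `k`-graph `H` on
`n` vertices with `δ_d(H) ≥ h` contains a Hamilton `ℓ`-cycle. -/
noncomputable def hThreshold (k d l n : ℕ) : ℕ :=
  sInf { h : ℕ | ∀ H : Finset (Finset (Fin n)), IsKGraph n k H →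
    h ≤ minDeg n k d H → HasHamiltonCycle n k l H }

/-- `h_d^ℓ(k) := limsup_{n → ∞, (k-ℓ) ∣ n} h_d^ℓ(k,n) / C(n, k-d)`. -/
noncomputable def hVal (k d l : ℕ) : ℝ :=
  Filter.limsup (fun n : ℕ => (hThreshold k d l n : ℝ) / (n.choose (k - d) : ℝ))
    (Filter.atTop ⊓ Filter.principal { m : ℕ | (k - l) ∣ m })

/-- The generalized binomial coefficient `C(x, r)` for a real `x`. -/
noncomputable def genChoose (x : ℝ) (r : ℕ) : ℝ :=
  (∏ i ∈ Finset.range r, (x - (i : ℝ))) / (r.factorial : ℝ)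

/-- The number of sets in the `ε`-robust `r`-shadow `∂_ε^r(G)` of the `K`-graph `G` on
`Fin n`: the number of `(K - r)`-sets lying in more than `ε * n ^ r` edges of `G`. -/
noncomputable def shadowCard (n K r : ℕ) (G : Finset (Finset (Fin n))) (ε : ℝ) : ℕ :=
  Nat.card {F : Finset (Fin n) // F.card = K - r ∧ ε * (n : ℝ) ^ r < (hDeg n K G F : ℝ)}

/-- `g` is an `S`-absorber, given as a `b`-tuple of distinct vertices avoiding `S`: the
tuple spans a family of `2k - 2ℓ + 1` vertex-disjoint `ℓ`-paths, and there is another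
family of `2k - 2ℓ + 1` vertex-disjoint `ℓ`-paths, with the same ordered ends, spanning
the tuple together with `S`. -/
def IsAbsorberTuple (n k l b : ℕ) (H : Finset (Finset (Fin n))) (S : Finset (Fin n))
    (g : Fin b → Fin n) : Prop :=
  Function.Injective g ∧ (∀ i, g i ∉ S) ∧
  ∃ (t t' : Fin (2 * k - 2 * l + 1) → ℕ) (Q Q' : Fin (2 * k - 2 * l + 1) → ℕ → Fin n),
    (∀ j, IsLPath n k l (t j) H (Q j)) ∧ (∀ j, IsLPath n k l (t' j) H (Q' j)) ∧
    (∀ j j', j ≠ j' → Disjoint (pathVerts n k l (t j) (Q j)) (pathVerts n k l (t j') (Q j'))) ∧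
    (∀ j j', j ≠ j' →
      Disjoint (pathVerts n k l (t' j) (Q' j)) (pathVerts n k l (t' j') (Q' j'))) ∧
    (∀ j, pathBeg n l (Q j) = pathBeg n l (Q' j) ∧
      pathEnd n k l (t j) (Q j) = pathEnd n k l (t' j) (Q' j)) ∧
    Finset.univ.biUnion (fun j => pathVerts n k l (t' j) (Q' j)) = Finset.image g Finset.univ ∧
    Finset.univ.biUnion (fun j => pathVerts n k l (t j) (Q j)) = Finset.image g Finset.univ ∪ S

namespace TwoCycle

open Finset

open Classical in
/-- The number of elements of a finite type satisfying `P`, as a real number. -/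
noncomputable def cnt {α : Type*} [Fintype α] (P : α → Prop) : ℝ :=
  ∑ a, if P a then 1 else 0

section Counting

variable {α β γ : Type*} [Fintype α] [Fintype β] [Fintype γ]

theorem cnt_eq_card (P : α → Prop) [DecidablePred P] :
    cnt P = ((univ.filter P).card : ℝ) := by
  classical
  rw [Finset.card_filter]
  push_cast
  simp only [cnt]
  exact Finset.sum_congr rfl fun a _ => by split_ifs <;> rfl

theorem cnt_nonneg (P : α → Prop) : 0 ≤ cnt P := by
  classical
  rw [cnt_eq_card]; positivity

theorem cnt_mono {P Q : α → Prop} (h : ∀ a, P a → Q a) : cnt P ≤ cnt Q := by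
  classical
  rw [cnt_eq_card, cnt_eq_card]
  exact_mod_cast card_le_card (fun a => by simpa using h a)

theorem cnt_le_card (P : α → Prop) : cnt P ≤ Fintype.card α := by
  classical
  rw [cnt_eq_card]
  exact_mod_cast card_le_univ _

theorem cnt_true : cnt (fun _ : α => True) = Fintype.card α := by
  simp [cnt]

theorem cnt_le_add {P Q R : α → Prop} (h : ∀ a, P a → Q a ∨ R a) : cnt P ≤ cnt Q + cnt R := by
  classical
  simp only [cnt]
  rw [← Finset.sum_add_distrib]
  refine Finset.sum_le_sum fun a _ => ?_
  have := h a
  split_ifs <;> first | (exfalso; tauto) | norm_num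

theorem cnt_prod (P : α × β → Prop) : cnt P = ∑ a, cnt (fun b => P (a, b)) := by
  classical
  simp only [cnt]
  rw [Fintype.sum_prod_type]

theorem cnt_prod_right (P : α × β → Prop) : cnt P = ∑ b, cnt (fun a => P (a, b)) := by
  classical
  simp only [cnt]
  rw [Fintype.sum_prod_type_right]

theorem cnt_equiv (e : α ≃ β) (P : β → Prop) : cnt (fun a => P (e a)) = cnt P := by
  classical
  simp only [cnt]
  exact Fintype.sum_equiv e _ _ (fun _ => rfl)

theorem cnt_le_of_injOn {P : α → Prop} {Q : β → Prop} (f : α → β) (hf : ∀ a, P a → Q (f a))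
    (hi : ∀ a b, P a → P b → f a = f b → a = b) : cnt P ≤ cnt Q := by
  classical
  rw [cnt_eq_card, cnt_eq_card]
  exact_mod_cast card_le_card_of_injOn f (fun a => by simpa using hf a)
    (fun a ha b hb => by simpa using hi a b (by simpa using ha) (by simpa using hb))

theorem exists_of_cnt_pos {P : α → Prop} (h : 0 < cnt P) : ∃ a, P a := by
  classical
  by_contra hc
  push Not at hc
  simp [cnt, hc] at h

/-- A lower bound for a count over a product, one factor after the other. -/
theorem mul_le_cnt_prod {A : α → Prop} {P : α × β → Prop} {p q : ℝ} (hq : 0 ≤ q)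
    (hA : p ≤ cnt A) (hB : ∀ a, A a → q ≤ cnt (fun b => P (a, b))) : p * q ≤ cnt P := by
  classical
  rw [cnt_prod]
  calc p * q ≤ cnt A * q := by gcongr
    _ = ∑ a, if A a then q else 0 := by
        rw [cnt, Finset.sum_mul]; congr 1; ext a; split_ifs <;> simp
    _ ≤ _ := by
        refine Finset.sum_le_sum fun a _ => ?_
        split_ifs with h
        · exact hB a h
        · exact cnt_nonneg _

theorem cnt_prod_le {P : α × β → Prop} {A : α → Prop} {q : ℝ}
    (hA : ∀ x, P x → A x.1) (hB : ∀ a, A a → cnt (fun b => P (a, b)) ≤ q) :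
    cnt P ≤ cnt A * q := by
  classical
  rw [cnt_prod, cnt, Finset.sum_mul]
  refine Finset.sum_le_sum fun a _ => ?_
  split_ifs with h
  · simpa using hB a h
  · simp only [zero_mul]
    refine le_of_eq ?_
    simp only [cnt]
    exact Finset.sum_eq_zero fun b _ => if_neg fun hb => h (hA _ hb)

/-- Cauchy-Schwarz: doubling the first coordinate. -/
theorem sq_cnt_le_double (P : α → β → Prop) :
    cnt (fun x : α × β => P x.1 x.2) ^ 2 ≤
      Fintype.card β * cnt (fun x : α × α × β => P x.1 x.2.2 ∧ P x.2.1 x.2.2) := by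
  classical
  have h1 : cnt (fun x : α × β => P x.1 x.2) = ∑ b, cnt (fun a => P a b) := cnt_prod_right _
  have h2 : cnt (fun x : α × α × β => P x.1 x.2.2 ∧ P x.2.1 x.2.2)
      = ∑ b, (cnt (fun a => P a b)) ^ 2 := by
    rw [← cnt_equiv (Equiv.prodAssoc α α β), cnt_prod_right]
    refine Finset.sum_congr rfl fun b _ => ?_
    rw [sq, cnt_prod]
    simp only [Equiv.prodAssoc_apply, cnt]
    rw [Finset.sum_mul_sum]
    refine Finset.sum_congr rfl fun a _ => Finset.sum_congr rfl fun a' _ => ?_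
    split_ifs <;> simp_all
  rw [h1, h2]
  simpa using sq_sum_le_card_mul_sum_sq (s := (univ : Finset β))
    (f := fun b => cnt (fun a => P a b))

/-- Inclusion-exclusion: two large sets have a large intersection. -/
theorem cnt_and_ge (P Q : α → Prop) :
    cnt P + cnt Q - Fintype.card α ≤ cnt (fun a => P a ∧ Q a) := by
  classical
  have : ((Fintype.card α : ℝ)) = ∑ _a : α, (1 : ℝ) := by simp
  rw [this]
  simp only [cnt]
  rw [← Finset.sum_add_distrib, ← Finset.sum_sub_distrib]
  refine Finset.sum_le_sum fun a _ => ?_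
  split_ifs <;> first | (exfalso; tauto) | norm_num

end Counting

section Functions

variable {K V : Type*} [Fintype K] [Fintype V] [DecidableEq K]

theorem cnt_apply_eq_le (i : K) (x : V) :
    cnt (fun f : K → V => f i = x) * Fintype.card V ≤ (Fintype.card V : ℝ) ^ Fintype.card K := by
  classical
  have h : cnt (fun y : (K → V) × V => y.1 i = x) ≤ cnt (fun _ : K → V => True) := by
    refine cnt_le_of_injOn (fun y => Function.update y.1 i y.2) (fun _ _ => trivial) ?_
    rintro ⟨f, v⟩ ⟨g, w⟩ hf hg hfg
    simp only at hf hg hfg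
    have h1 : v = w := by simpa using congrFun hfg i
    refine Prod.ext (funext fun j => ?_) h1
    by_cases hj : j = i
    · subst hj; simp [hf, hg]
    · simpa [hj] using congrFun hfg j
  rw [cnt_true, cnt_prod_right] at h
  simpa [mul_comm] using h

theorem cnt_apply_eq_apply_le {i j : K} (hij : i ≠ j) :
    cnt (fun f : K → V => f i = f j) * Fintype.card V ≤
      (Fintype.card V : ℝ) ^ Fintype.card K := by
  classical
  have h : cnt (fun y : (K → V) × V => y.1 i = y.1 j) ≤ cnt (fun _ : K → V => True) := by
    refine cnt_le_of_injOn (fun y => Function.update y.1 i y.2) (fun _ _ => trivial) ?_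
    rintro ⟨f, v⟩ ⟨g, w⟩ hf hg hfg
    simp only at hf hg hfg
    have h1 : v = w := by simpa using congrFun hfg i
    have key : ∀ k, k ≠ i → f k = g k := fun k hk => by simpa [hk] using congrFun hfg k
    refine Prod.ext (funext fun k => ?_) h1
    by_cases hk : k = i
    · rw [hk]; change f i = g i; rw [hf, hg]; exact key j hij.symm
    · exact key k hk
  rw [cnt_true, cnt_prod_right] at h
  simpa [mul_comm] using h

theorem cnt_exists_le {α ι : Type*} [Fintype α] [Fintype ι] (P : ι → α → Prop) :
    cnt (fun a => ∃ i, P i a) ≤ ∑ i, cnt (P i) := by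
  classical
  simp only [cnt]
  rw [Finset.sum_comm]
  refine Finset.sum_le_sum fun a _ => ?_
  split_ifs with h
  · obtain ⟨i, hi⟩ := h
    have := Finset.single_le_sum (f := fun i => if P i a then (1 : ℝ) else 0)
      (fun i _ => by positivity) (Finset.mem_univ i)
    simpa [hi] using this
  · positivity

theorem cnt_not_injective_le :
    cnt (fun f : K → V => ¬ Function.Injective f) * Fintype.card V ≤
      (Fintype.card K : ℝ) ^ 2 * (Fintype.card V : ℝ) ^ Fintype.card K := by
  classical
  have h1 : cnt (fun f : K → V => ¬ Function.Injective f) ≤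
      ∑ p : K × K, cnt (fun f : K → V => f p.1 = f p.2 ∧ p.1 ≠ p.2) := by
    refine le_trans (cnt_mono fun f hf => ?_) (cnt_exists_le _)
    simp only [Function.Injective, not_forall] at hf
    obtain ⟨a, b, h, hab⟩ := hf
    exact ⟨(a, b), h, hab⟩
  calc _ ≤ (∑ p : K × K, cnt (fun f : K → V => f p.1 = f p.2 ∧ p.1 ≠ p.2)) * Fintype.card V := by
        gcongr
    _ ≤ ∑ _p : K × K, (Fintype.card V : ℝ) ^ Fintype.card K := by
        rw [Finset.sum_mul]
        refine Finset.sum_le_sum fun p _ => ?_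
        by_cases hp : p.1 = p.2
        · simp [hp, cnt]
        · exact le_trans (by gcongr; exact cnt_mono fun f hf => hf.1) (cnt_apply_eq_apply_le hp)
    _ = _ := by simp [sq]

theorem cnt_exists_mem_le [DecidableEq V] (X : Finset V) :
    cnt (fun f : K → V => ∃ i, f i ∈ X) * Fintype.card V ≤
      (Fintype.card K * X.card : ℝ) * (Fintype.card V : ℝ) ^ Fintype.card K := by
  classical
  have h1 : cnt (fun f : K → V => ∃ i, f i ∈ X) ≤
      ∑ p : K × X, cnt (fun f : K → V => f p.1 = p.2) := by
    refine le_trans (cnt_mono fun f hf => ?_) (cnt_exists_le _)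
    obtain ⟨i, hi⟩ := hf
    exact ⟨(i, ⟨_, hi⟩), rfl⟩
  calc _ ≤ (∑ p : K × X, cnt (fun f : K → V => f p.1 = p.2)) * Fintype.card V := by gcongr
    _ ≤ ∑ _p : K × X, (Fintype.card V : ℝ) ^ Fintype.card K := by
        rw [Finset.sum_mul]
        exact Finset.sum_le_sum fun p _ => cnt_apply_eq_le _ _
    _ = _ := by simp

end Functions

section Samuels

variable {W : Type*} [Fintype W]

/-- A set of `k` elements on which `f` takes its largest values. -/
theorem exists_top_set (f : W → ℝ) {k : ℕ} (hk : k ≤ Fintype.card W) :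
    ∃ A : Finset W, A.card = k ∧ ∀ a ∈ A, ∀ b ∉ A, f b ≤ f a := by
  classical
  induction k with
  | zero => exact ⟨∅, by simp, by simp⟩
  | succ k ih =>
    obtain ⟨A, hA, hf⟩ := ih (by omega)
    have hne : (Aᶜ : Finset W).Nonempty := by
      rw [← Finset.card_pos, Finset.card_compl]; omega
    obtain ⟨b, hb, hmax⟩ := Finset.exists_max_image _ f hne
    have hbA : b ∉ A := by simpa using hb
    refine ⟨insert b A, by rw [card_insert_of_notMem hbA, hA], ?_⟩
    intro a ha c hc
    simp only [mem_insert, not_or] at ha hc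
    rcases ha with rfl | ha
    · exact hmax c (by simpa using hc.2)
    · exact hf a ha c hc.2

theorem samuels_core {U : Type*} {A B : Finset U} {f : U → ℝ} {k b z₀ : ℝ} (hf : ∀ x, 0 ≤ f x)
    (hkA : (A.card : ℝ) = k) (hbB : (B.card : ℝ) = b) (hk : 0 < k) (hkb : 5 * k ≤ b)
    (hsum : ∑ x ∈ A, f x + ∑ x ∈ B, f x ≤ k) (hA : ∀ x ∈ A, z₀ ≤ f x) (hB : ∀ x ∈ B, f x ≤ z₀) :
    (∑ x ∈ B, ∑ y ∈ B, ∑ z ∈ B, if 1 ≤ f x + f y + f z then (1 : ℝ) else 0) +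
      3 * (∑ x ∈ A, ∑ y ∈ B, ∑ z ∈ B, if 1 ≤ f x + f y + f z then (1 : ℝ) else 0) ≤
      3 * (k * b ^ 2) := by
  classical
  set σ := ∑ x ∈ B, f x with hσ
  set Z := ∑ x ∈ A, f x with hZ
  set Q := ∑ x ∈ B, ∑ y ∈ B, ∑ z ∈ B, if 1 ≤ f x + f y + f z then (1 : ℝ) else 0 with hQ
  set R := ∑ x ∈ A, ∑ y ∈ B, ∑ z ∈ B, if 1 ≤ f x + f y + f z then (0 : ℝ) else 1 with hR
  have hb : 0 < b := by linarith
  have hσ0 : 0 ≤ σ := Finset.sum_nonneg fun x _ => hf x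
  have hZz : k * z₀ ≤ Z := by
    rw [← hkA, ← nsmul_eq_mul]; exact Finset.card_nsmul_le_sum _ _ _ hA
  have hR0 : 0 ≤ R := by
    refine Finset.sum_nonneg fun x _ => Finset.sum_nonneg fun y _ => Finset.sum_nonneg fun z _ => ?_
    split_ifs <;> norm_num
  have hRc : (∑ x ∈ A, ∑ y ∈ B, ∑ z ∈ B, if 1 ≤ f x + f y + f z then (1 : ℝ) else 0)
      = k * b ^ 2 - R := by
    rw [eq_sub_iff_add_eq, hR]
    simp only [← Finset.sum_add_distrib]
    calc _ = ∑ x ∈ A, ∑ y ∈ B, ∑ z ∈ B, (1 : ℝ) := by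
          refine Finset.sum_congr rfl fun x _ => Finset.sum_congr rfl fun y _ =>
            Finset.sum_congr rfl fun z _ => ?_
          split_ifs <;> norm_num
      _ = _ := by
          simp only [Finset.sum_const, nsmul_eq_mul, hkA, hbB]
          ring
  have key : b ^ 2 * (k - Z) - 2 * k * b * σ ≤ R * (1 - z₀) := by
    have h1 : ∑ x ∈ A, ∑ y ∈ B, ∑ z ∈ B, (1 - f x - f y - f z) ≤ R * (1 - z₀) := by
      rw [hR]
      simp only [Finset.sum_mul]
      refine Finset.sum_le_sum fun x hx => Finset.sum_le_sum fun y _ =>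
        Finset.sum_le_sum fun z _ => ?_
      split_ifs with h
      · linarith
      · linarith [hA x hx, hf y, hf z]
    refine le_trans (le_of_eq ?_) h1
    simp only [Finset.sum_sub_distrib, Finset.sum_const, ← Finset.mul_sum, ← hσ, ← hZ,
      nsmul_eq_mul, hkA, hbB]
    ring
  have key2 : 3 / 5 * b ^ 2 * σ ≤ R * (1 - z₀) := by
    have h1 : b ^ 2 * σ ≤ b ^ 2 * (k - Z) := by gcongr; linarith
    have h2 : 2 * k * b * σ ≤ 2 / 5 * b ^ 2 * σ := by
      have : 2 * k * b ≤ 2 / 5 * b ^ 2 := by nlinarith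
      gcongr
    linarith
  rw [hRc]
  suffices h : Q ≤ 3 * R by linarith
  have hb2σ : 0 ≤ b ^ 2 * σ := by positivity
  by_cases hz : z₀ < 1 / 3
  · have : Q = 0 := by
      rw [hQ]
      refine Finset.sum_eq_zero fun x hx => Finset.sum_eq_zero fun y hy =>
        Finset.sum_eq_zero fun z hz => if_neg ?_
      linarith [hB x hx, hB y hy, hB z hz]
    linarith
  push Not at hz
  by_cases hz' : 2 / 5 ≤ z₀
  · have h1 : Q ≤ ∑ x ∈ B, ∑ y ∈ B, ∑ z ∈ B, (f x + f y + f z) := by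
      refine Finset.sum_le_sum fun x _ => Finset.sum_le_sum fun y _ =>
        Finset.sum_le_sum fun z _ => ?_
      split_ifs with h
      · exact h
      · linarith [hf x, hf y, hf z]
    have h2 : ∑ x ∈ B, ∑ y ∈ B, ∑ z ∈ B, (f x + f y + f z) = 3 * b ^ 2 * σ := by
      simp only [Finset.sum_add_distrib, Finset.sum_const, ← Finset.mul_sum, ← hσ,
        nsmul_eq_mul, hbB]
      ring
    have h3 : R * (1 - z₀) ≤ R * (3 / 5) := by gcongr; linarith
    nlinarith
  push Not at hz'
  set C := B.filter fun x => 1 / 5 ≤ f x with hC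
  have hCσ : ∑ x ∈ C, f x ≤ σ :=
    Finset.sum_le_sum_of_subset_of_nonneg (filter_subset _ _) fun x _ _ => hf x
  have hCc : (C.card : ℝ) ≤ 2 / 3 * b := by
    have h1 : (C.card : ℝ) * (1 / 5) ≤ ∑ x ∈ C, f x := by
      rw [← nsmul_eq_mul]
      exact Finset.card_nsmul_le_sum _ _ _ fun x hx => (mem_filter.1 hx).2
    have h2 : σ ≤ k * (1 - z₀) := by linarith
    have h3 : k * (1 - z₀) ≤ k * (2 / 3) := by gcongr; linarith
    linarith
  have hQC : Q ≤ ∑ x ∈ C, ∑ y ∈ C, ∑ z ∈ C, (f x + f y + f z) := by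
    rw [hQ, hC]
    simp only [Finset.sum_filter]
    refine Finset.sum_le_sum fun x hx => ?_
    split_ifs with hx5
    · refine Finset.sum_le_sum fun y hy => ?_
      split_ifs with hy5
      · refine Finset.sum_le_sum fun z hz => ?_
        split_ifs with h hz5 hz5
        · exact h
        · linarith [hB x hx, hB y hy]
        · linarith [hf x, hf y, hf z]
        · exact le_rfl
      · refine Finset.sum_nonpos fun z hz => ?_
        rw [if_neg]
        linarith [hB x hx, hB z hz]
    · refine Finset.sum_nonpos fun y hy => Finset.sum_nonpos fun z hz => ?_
      rw [if_neg]
      linarith [hB y hy, hB z hz]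
  have h2 : ∑ x ∈ C, ∑ y ∈ C, ∑ z ∈ C, (f x + f y + f z)
      = 3 * (C.card : ℝ) ^ 2 * ∑ x ∈ C, f x := by
    simp only [Finset.sum_add_distrib, Finset.sum_const, ← Finset.mul_sum, nsmul_eq_mul]
    ring
  have h3 : 3 * (C.card : ℝ) ^ 2 * ∑ x ∈ C, f x ≤ 3 * (2 / 3 * b) ^ 2 * σ := by
    have h0 : 0 ≤ ∑ x ∈ C, f x := Finset.sum_nonneg fun x _ => hf x
    gcongr
  have h4 : R * (1 - z₀) ≤ R * (2 / 3) := by gcongr; linarith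
  nlinarith

/-- A three-variable case of Samuels' inequality: among nonnegative functions with total weight
at most `k ≤ |W| / 6`, the number of triples of weight at least one is maximised by the indicator
function of a `k`-set. -/
theorem samuels {f : W → ℝ} {k : ℕ} (hf : ∀ x, 0 ≤ f x) (hk : 0 < k)
    (hkn : 6 * k ≤ Fintype.card W) (hsum : ∑ x, f x ≤ k) :
    cnt (fun t : W × W × W => 1 ≤ f t.1 + f t.2.1 + f t.2.2) ≤
      (Fintype.card W : ℝ) ^ 3 - ((Fintype.card W : ℝ) - k) ^ 3 := by
  classical
  obtain ⟨A, hAk, hA⟩ := exists_top_set f (k := k) (by omega)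
  have hAne : A.Nonempty := by rw [← card_pos]; omega
  obtain ⟨a₀, ha₀, hmin⟩ := Finset.exists_min_image A f hAne
  have hkA : (A.card : ℝ) = k := by exact_mod_cast hAk
  have hn : (Fintype.card W : ℝ) = k + (Aᶜ.card : ℝ) := by
    rw [← hkA]; exact_mod_cast (Finset.card_add_card_compl A).symm
  set b : ℝ := (Aᶜ.card : ℝ) with hb
  have hkb : 5 * (k : ℝ) ≤ b := by
    have : 6 * (k : ℝ) ≤ Fintype.card W := by exact_mod_cast hkn
    linarith
  have hsum' : ∑ x ∈ A, f x + ∑ x ∈ Aᶜ, f x ≤ k := by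
    rw [Finset.sum_add_sum_compl]; exact hsum
  have core := samuels_core (b := b) hf hkA rfl (by exact_mod_cast hk) hkb hsum' hmin
    (fun x hx => hA a₀ ha₀ x (by simpa using hx))
  have hφ : ∀ x y z, (if 1 ≤ f x + f y + f z then (1 : ℝ) else 0) ≤ 1 := by
    intro x y z; split_ifs <;> norm_num
  have hbound : ∀ X Y Z : Finset W,
      (∑ x ∈ X, ∑ y ∈ Y, ∑ z ∈ Z, if 1 ≤ f x + f y + f z then (1 : ℝ) else 0) ≤
        X.card * Y.card * Z.card := by
    intro X Y Z
    calc _ ≤ ∑ x ∈ X, ∑ y ∈ Y, ∑ z ∈ Z, (1 : ℝ) :=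
          Finset.sum_le_sum fun x _ => Finset.sum_le_sum fun y _ =>
            Finset.sum_le_sum fun z _ => hφ x y z
      _ = _ := by simp; ring
  have hc : cnt (fun t : W × W × W => 1 ≤ f t.1 + f t.2.1 + f t.2.2) =
      ∑ x, ∑ y, ∑ z, if 1 ≤ f x + f y + f z then (1 : ℝ) else 0 := by
    rw [cnt_prod]
    refine Finset.sum_congr rfl fun x _ => ?_
    rw [cnt_prod]
    refine Finset.sum_congr rfl fun y _ => ?_
    simp only [cnt]
  have hBAB : (∑ x ∈ Aᶜ, ∑ y ∈ A, ∑ z ∈ Aᶜ, if 1 ≤ f x + f y + f z then (1 : ℝ) else 0) =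
      ∑ x ∈ A, ∑ y ∈ Aᶜ, ∑ z ∈ Aᶜ, if 1 ≤ f x + f y + f z then (1 : ℝ) else 0 := by
    rw [Finset.sum_comm]
    refine Finset.sum_congr rfl fun x _ => Finset.sum_congr rfl fun y _ =>
      Finset.sum_congr rfl fun z _ => by rw [add_comm (f y) (f x)]
  have hBBA : (∑ x ∈ Aᶜ, ∑ y ∈ Aᶜ, ∑ z ∈ A, if 1 ≤ f x + f y + f z then (1 : ℝ) else 0) =
      ∑ x ∈ A, ∑ y ∈ Aᶜ, ∑ z ∈ Aᶜ, if 1 ≤ f x + f y + f z then (1 : ℝ) else 0 := by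
    rw [← hBAB]
    refine Finset.sum_congr rfl fun x _ => ?_
    rw [Finset.sum_comm]
    refine Finset.sum_congr rfl fun y _ =>
      Finset.sum_congr rfl fun z _ => by rw [add_right_comm]
  have hAAA := hbound A A A
  have hAAB := hbound A A Aᶜ
  have hABA := hbound A Aᶜ A
  have hBAA := hbound Aᶜ A A
  rw [hkA] at hAAA hAAB hABA hBAA
  rw [← hb] at hAAB hABA hBAA
  rw [hc]
  have split : ∀ g : W → ℝ, ∑ x, g x = ∑ x ∈ A, g x + ∑ x ∈ Aᶜ, g x := fun g =>
    (Finset.sum_add_sum_compl A g).symm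
  simp only [split, Finset.sum_add_distrib]
  rw [hBAB, hBBA, hn]
  nlinarith

end Samuels

section Duality

/-- If every nonnegative weighting of `I` has a light tuple, then there is a convex combination
of the loads of few tuples all of whose coordinates are small. -/
theorem exists_fractional_tiling {I T : Type} [Fintype I] [Fintype T] {D : T → Prop}
    {load : T → I → ℝ} {c : ℝ}
    (h : ∀ y : I → ℝ, (∀ i, 0 ≤ y i) → ∃ t, D t ∧ ∑ i, y i * load t i ≤ c * ∑ i, y i) :
    ∃ (ι : Type) (_ : Fintype ι) (τ : ι → T) (w : ι → ℝ), (∀ x, D (τ x)) ∧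
      Fintype.card ι ≤ Fintype.card I + 1 ∧ (∀ x, 0 ≤ w x) ∧ ∑ x, w x = 1 ∧
      ∀ i, ∑ x, w x * load (τ x) i ≤ c := by
  classical
  set s : Set (I → ℝ) := load '' {t | D t} with hs
  have hfin : s.Finite := Set.toFinite _
  have hK : IsCompact (convexHull ℝ s) := hfin.isCompact_convexHull ℝ
  set C : Set (I → ℝ) := {x | ∀ i, x i ≤ c} with hC
  have hCconv : Convex ℝ C := by
    intro x hx y hy a b ha hb hab i
    simp only [Pi.add_apply, Pi.smul_apply, smul_eq_mul]
    have h1 : a * x i ≤ a * c := mul_le_mul_of_nonneg_left (hx i) ha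
    have h2 : b * y i ≤ b * c := mul_le_mul_of_nonneg_left (hy i) hb
    calc _ ≤ a * c + b * c := add_le_add h1 h2
      _ = c := by rw [← add_mul, hab, one_mul]
  have hCclosed : IsClosed C := by
    rw [hC, Set.ofPred_forall]
    exact isClosed_iInter fun i => isClosed_le (continuous_apply i) continuous_const
  have hinter : ∃ x ∈ convexHull ℝ s, x ∈ C := by
    by_contra hcon
    push Not at hcon
    obtain ⟨f, u, v, hu, huv, hv⟩ := geometric_hahn_banach_compact_closed
      (convex_convexHull ℝ s) hK hCconv hCclosed (Set.disjoint_left.2 hcon)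
    set a : I → ℝ := fun i => f (Pi.single i 1) with ha
    have hfa : ∀ x, f x = ∑ i, x i * a i := by
      intro x
      conv_lhs => rw [pi_eq_sum_univ' x, map_sum]
      refine Finset.sum_congr rfl fun i _ => ?_
      rw [map_smul, smul_eq_mul]
    have hneg : ∀ i, a i ≤ 0 := by
      intro i
      by_contra hi
      push Not at hi
      set t := max 0 ((c * ∑ j, a j - v) / a i) with ht
      have h1 : v < f ((fun _ => c) - t • Pi.single i 1) := by
        apply hv
        intro j
        have : 0 ≤ t * (Pi.single i (1 : ℝ) : I → ℝ) j := by
          apply mul_nonneg (le_max_left _ _)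
          by_cases hj : j = i
          · subst hj; simp
          · simp [hj]
        simpa using this
      rw [map_sub, map_smul, hfa, smul_eq_mul, ← Finset.mul_sum] at h1
      have h2 : (c * ∑ j, a j - v) / a i ≤ t := le_max_right _ _
      rw [div_le_iff₀ hi] at h2
      change v < _ - t * a i at h1
      linarith
    obtain ⟨t, ht, hle⟩ := h (fun i => - a i) fun i => by linarith [hneg i]
    have h1 := hu _ (subset_convexHull ℝ s ⟨t, ht, rfl⟩)
    have h2 := hv (fun _ => c) fun i => le_rfl
    rw [hfa] at h1 h2
    rw [← Finset.mul_sum] at h2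
    have h3 : ∑ i, -a i * load t i = - ∑ i, load t i * a i := by
      rw [← Finset.sum_neg_distrib]
      exact Finset.sum_congr rfl fun i _ => by ring
    rw [h3, Finset.sum_neg_distrib] at hle
    linarith
  obtain ⟨x, hx, hxC⟩ := hinter
  obtain ⟨ι, hι, z, w, hz, haff, hw, hw1, hwz⟩ := eq_pos_convex_span_of_mem_convexHull hx
  have hch : ∀ i, ∃ t, D t ∧ load t = z i := fun i => hz ⟨i, rfl⟩
  choose τ hτ hτz using hch
  refine ⟨ι, hι, τ, w, hτ, ?_, fun i => (hw i).le, hw1, fun i => ?_⟩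
  · have := haff.card_le_finrank_succ
    refine this.trans (Nat.succ_le_succ ((Submodule.finrank_le _).trans (by simp)))
  · have := hxC i
    rw [← hwz] at this
    simpa [hτz] using this

set_option maxHeartbeats 1000000 in
/-- If all but few edges of a dense 5-graph are heavy for the weighting `Y`, where the fifth vertex
is counted twice, then the total weight contradicts Samuels' inequality. -/
theorem exists_light_edge {W : Type*} [Fintype W] {ε η : ℝ} (hε : 0 < ε) (hε1 : ε ≤ 1)
    (hη : 0 < η) (hM : 64 / ε ≤ Fintype.card W) {Y : W → ℝ} (hY : ∀ x, 0 ≤ Y x)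
    {E G : W → W → W → W → W → Prop}
    (hdeg : ∀ u v, u ≠ v → (91 / 216 + η) * (Fintype.card W : ℝ) ^ 3 ≤
      cnt (fun t : W × W × W => E t.1 t.2.1 t.2.2 u v))
    (hbad : cnt (fun z : (W × W) × (W × W × W) => E z.2.1 z.2.2.1 z.2.2.2 z.1.1 z.1.2 ∧
      ¬ G z.2.1 z.2.2.1 z.2.2.2 z.1.1 z.1.2) ≤ η * ε ^ 2 / 1024 * (Fintype.card W : ℝ) ^ 5) :
    ∃ a b c u v, E a b c u v ∧ G a b c u v ∧
      Y a + Y b + Y c + Y u + 2 * Y v ≤ 6 * (1 + ε) * (∑ x, Y x) / Fintype.card W := by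
  classical
  by_contra hcon
  push Not at hcon
  set M : ℝ := (Fintype.card W : ℝ) with hMdef
  have hM64 : 64 ≤ ε * M := by rw [div_le_iff₀ hε] at hM; linarith
  have hMpos : 0 < M := by nlinarith
  set h := ⌊ε * M / 8⌋₊ with hh
  have hh1 : (h : ℝ) ≤ ε * M / 8 := Nat.floor_le (by positivity)
  have hh2 : ε * M / 8 - 1 < h := Nat.sub_one_lt_floor _
  have hhM : h ≤ Fintype.card W := by
    have : (h : ℝ) ≤ (Fintype.card W : ℝ) := by rw [← hMdef]; nlinarith
    exact_mod_cast this
  obtain ⟨X, hXc, hX⟩ := exists_top_set (fun x => - Y x) hhM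
  have hXc' : (X.card : ℝ) = h := by exact_mod_cast hXc
  have hXne : X.Nonempty := by
    rw [← card_pos, hXc]
    have : (0 : ℝ) < h := by linarith
    exact_mod_cast this
  obtain ⟨x₀, hx₀, hmax⟩ := Finset.exists_max_image X Y hXne
  set lam := Y x₀ with hlam
  have hlam0 : 0 ≤ lam := hY _
  have hout : ∀ b ∉ X, lam ≤ Y b := fun b hb => by have := hX x₀ hx₀ b hb; linarith
  -- a pair in `X` with few bad triples
  obtain ⟨u, v, hu, hv, huv, hfew⟩ : ∃ u v, u ∈ X ∧ v ∈ X ∧ u ≠ v ∧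
      cnt (fun t : W × W × W => E t.1 t.2.1 t.2.2 u v ∧ ¬ G t.1 t.2.1 t.2.2 u v) ≤
        η / 2 * M ^ 3 := by
    by_contra hc
    push Not at hc
    have h1 := mul_le_cnt_prod (A := fun p : W × W => p.1 ∈ X ∧ p.2 ∈ X ∧ p.1 ≠ p.2)
      (P := fun z : (W × W) × (W × W × W) => E z.2.1 z.2.2.1 z.2.2.2 z.1.1 z.1.2 ∧
        ¬ G z.2.1 z.2.2.1 z.2.2.2 z.1.1 z.1.2) (p := (h : ℝ) * h - h) (q := η / 2 * M ^ 3)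
      (by positivity) ?_ (fun p hp => (hc p.1 p.2 hp.1 hp.2.1 hp.2.2).le)
    · have h2 : ε ^ 2 * M ^ 2 / 512 < (h : ℝ) * h - h := by
        have : ε * M / 16 ≤ (h : ℝ) - 1 := by linarith
        have h3 : ε * M / 16 * (ε * M / 16) ≤ ((h : ℝ) - 1) * h :=
          mul_le_mul this (by linarith) (by positivity) (by linarith)
        have : 0 < ε ^ 2 * M ^ 2 := by positivity
        nlinarith
      have h3 : ε ^ 2 * M ^ 2 / 512 * (η / 2 * M ^ 3) < ((h : ℝ) * h - h) * (η / 2 * M ^ 3) := by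
        have : 0 < η / 2 * M ^ 3 := by positivity
        gcongr
      have h4 : ε ^ 2 * M ^ 2 / 512 * (η / 2 * M ^ 3) = η * ε ^ 2 / 1024 * M ^ 5 := by ring
      linarith
    · rw [cnt_eq_card]
      have : (univ.filter fun p : W × W => p.1 ∈ X ∧ p.2 ∈ X ∧ p.1 ≠ p.2) = X.offDiag := by
        ext p; simp [mem_offDiag]
      rw [this, offDiag_card, hXc, Nat.cast_sub (Nat.le_mul_self h)]
      push_cast
      exact le_rfl
  have hgood : (91 / 216 + η / 2) * M ^ 3 ≤
      cnt (fun t : W × W × W => E t.1 t.2.1 t.2.2 u v ∧ G t.1 t.2.1 t.2.2 u v) := by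
    have h1 := cnt_le_add (P := fun t : W × W × W => E t.1 t.2.1 t.2.2 u v)
      (Q := fun t : W × W × W => E t.1 t.2.1 t.2.2 u v ∧ G t.1 t.2.1 t.2.2 u v)
      (R := fun t : W × W × W => E t.1 t.2.1 t.2.2 u v ∧ ¬ G t.1 t.2.1 t.2.2 u v)
      (fun t ht => by tauto)
    have h2 := hdeg u v huv
    linarith
  set S := ∑ x, Y x with hS
  have hS0 : 0 ≤ S := Finset.sum_nonneg fun x _ => hY x
  set s := 6 * (1 + ε) * S / M with hs
  have hsM : s * M = 6 * (1 + ε) * S := by rw [hs]; field_simp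
  have hcardc : ((Xᶜ).card : ℝ) = M - h := by
    rw [← hXc', hMdef, eq_sub_iff_add_eq]
    exact_mod_cast (by rw [add_comm]; exact Finset.card_add_card_compl X)
  have hSout : lam * (M - h) ≤ ∑ x ∈ Xᶜ, Y x := by
    rw [← hcardc, mul_comm, ← nsmul_eq_mul]
    exact Finset.card_nsmul_le_sum _ _ _ fun x hx => hout x (by simpa using hx)
  have hSX : ∑ x ∈ X, Y x + ∑ x ∈ Xᶜ, Y x = S := Finset.sum_add_sum_compl X Y
  have hSX0 : 0 ≤ ∑ x ∈ X, Y x := Finset.sum_nonneg fun x _ => hY x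
  have hMh : M * (1 - ε / 8) ≤ M - h := by linarith
  have hSlam : lam * (M * (1 - ε / 8)) ≤ S :=
    le_trans (mul_le_mul_of_nonneg_left hMh hlam0) (by linarith)
  have hheavy : ∀ t : W × W × W, (E t.1 t.2.1 t.2.2 u v ∧ G t.1 t.2.1 t.2.2 u v) →
      s - 3 * lam < Y t.1 + Y t.2.1 + Y t.2.2 := by
    intro t ht
    have h1 := hcon _ _ _ _ _ ht.1 ht.2
    linarith [hmax u hu, hmax v hv]
  have hexp : 1 + ε / 2 ≤ (1 + ε) * (1 - ε / 8) := by nlinarith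
  have hspos : 6 * lam < s := by
    by_contra hle
    push Not at hle
    have h1 : 6 * (1 + ε) * S ≤ 6 * lam * M := by rw [← hsM]; gcongr
    have h2 : (1 + ε) * (lam * (M * (1 - ε / 8))) ≤ (1 + ε) * S := by gcongr
    have h3 : (1 + ε / 2) * (lam * M) ≤ (1 + ε) * (1 - ε / 8) * (lam * M) := by gcongr
    have h4 : ε / 2 * (lam * M) ≤ 0 := by nlinarith
    have hl : lam = 0 := by
      by_contra hne
      have : 0 < lam := lt_of_le_of_ne hlam0 (Ne.symm hne)
      have : 0 < ε / 2 * (lam * M) := by positivity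
      linarith
    have hSz : S = 0 := by
      rw [hl] at h1
      have : 0 < 6 * (1 + ε) := by positivity
      nlinarith
    have hYz : ∀ x, Y x = 0 := fun x =>
      (Finset.sum_eq_zero_iff_of_nonneg fun x _ => hY x).1 hSz x (mem_univ x)
    obtain ⟨t, ht⟩ := exists_of_cnt_pos (lt_of_lt_of_le (by positivity) hgood)
    have h5 := hheavy t ht
    rw [hYz, hYz, hYz, hs, hSz, hl] at h5
    simp at h5
  set F : W → ℝ := fun x => max (Y x - lam) 0 / (s - 6 * lam) with hF
  have hden : 0 < s - 6 * lam := by linarith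
  have hF0 : ∀ x, 0 ≤ F x := fun x => div_nonneg (le_max_right _ _) hden.le
  set k := Fintype.card W / 6 with hk
  have hk6 : 6 * k ≤ Fintype.card W := Nat.mul_div_le _ _
  have hk6' : M - 5 ≤ 6 * (k : ℝ) := by
    have : Fintype.card W ≤ 6 * k + 5 := by omega
    have : M ≤ 6 * (k : ℝ) + 5 := by rw [hMdef]; exact_mod_cast this
    linarith
  have hk6r : 6 * (k : ℝ) ≤ M := by rw [hMdef]; exact_mod_cast hk6
  have hkε : M * (1 - ε / 8) ≤ 6 * (k : ℝ) := by linarith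
  have hM64' : 64 ≤ M := by nlinarith
  have hkpos : 0 < k := by
    have : (0 : ℝ) < k := by linarith
    exact_mod_cast this
  have hFsum : ∑ x, F x ≤ k := by
    rw [hF, ← Finset.sum_div, div_le_iff₀ hden]
    have h1 : ∑ x, max (Y x - lam) 0 = ∑ x ∈ Xᶜ, (Y x - lam) := by
      rw [← Finset.sum_add_sum_compl X]
      rw [Finset.sum_eq_zero (s := X) fun x hx => max_eq_right (by linarith [hmax x hx]), zero_add]
      exact Finset.sum_congr rfl fun x hx =>
        max_eq_left (by linarith [hout x (by simpa using hx)])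
    rw [h1, Finset.sum_sub_distrib, Finset.sum_const, nsmul_eq_mul, hcardc]
    have h2 : ∑ x ∈ Xᶜ, Y x - (M - h) * lam ≤ S - M * (1 - ε / 8) * lam := by
      have := mul_le_mul_of_nonneg_right hMh hlam0
      linarith
    refine h2.trans ?_
    have h3 : M * (1 - ε / 8) * (s - 6 * lam) ≤ 6 * k * (s - 6 * lam) := by gcongr
    have h4 : (1 + ε / 2) * S ≤ (1 + ε) * (1 - ε / 8) * S := by gcongr
    have h5 : M * (1 - ε / 8) * (s - 6 * lam) =
        (1 - ε / 8) * (s * M) - 6 * (M * (1 - ε / 8) * lam) := by ring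
    rw [hsM] at h5
    nlinarith
  have hsam := samuels hF0 hkpos hk6 hFsum
  have hle : cnt (fun t : W × W × W => E t.1 t.2.1 t.2.2 u v ∧ G t.1 t.2.1 t.2.2 u v) ≤
      cnt (fun t : W × W × W => 1 ≤ F t.1 + F t.2.1 + F t.2.2) := by
    refine cnt_mono fun t ht => ?_
    have h1 := hheavy t ht
    simp only [hF]
    rw [← add_div, ← add_div, le_div_iff₀ hden, one_mul]
    linarith [le_max_left (Y t.1 - lam) 0, le_max_left (Y t.2.1 - lam) 0,
      le_max_left (Y t.2.2 - lam) 0]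
  have h6 : (5 / 6 * M) ^ 3 ≤ (M - k) ^ 3 := by
    have : 5 / 6 * M ≤ M - k := by linarith
    gcongr
  have h7 : 0 < η * M ^ 3 := by positivity
  rw [← hMdef] at hsam
  nlinarith

/-- The load of a tuple of parts: the last part is used twice. -/
def load {I : Type} [DecidableEq I] (t : I × I × I × I × I) (i : I) : ℝ :=
  (if t.1 = i then 1 else 0) + (if t.2.1 = i then 1 else 0) + (if t.2.2.1 = i then 1 else 0) +
    (if t.2.2.2.1 = i then 1 else 0) + 2 * (if t.2.2.2.2 = i then 1 else 0)

/-- The number of edges between the parts of a tuple. -/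
noncomputable def partEdges {I F : Type} [Fintype F]
    (E : I × F → I × F → I × F → I × F → I × F → Prop)
    (t : I × I × I × I × I) : ℝ :=
  cnt fun j : F × F × F × F × F => E (t.1, j.1) (t.2.1, j.2.1) (t.2.2.1, j.2.2.1)
    (t.2.2.2.1, j.2.2.2.1) (t.2.2.2.2, j.2.2.2.2)

/-- A dense 5-graph whose vertex set is partitioned into equal parts has an almost perfect
fractional tiling by dense tuples of parts, with few tuples. -/
theorem exists_fractional_tiling_of_dense {I F : Type} [Fintype I] [Fintype F] [DecidableEq I]
    {ε η : ℝ} (hε : 0 < ε) (hε1 : ε ≤ 1) (hη : 0 < η) {M : ℝ}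
    (hMc : M = Fintype.card I * Fintype.card F) (hM : 64 / ε ≤ M)
    {E : I × F → I × F → I × F → I × F → I × F → Prop}
    (hdeg : ∀ u v, u ≠ v → (91 / 216 + η) * M ^ 3 ≤
      cnt (fun t : (I × F) × (I × F) × (I × F) => E t.1 t.2.1 t.2.2 u v)) :
    ∃ (ι : Type) (_ : Fintype ι) (τ : ι → I × I × I × I × I) (w : ι → ℝ),
      (∀ x, η * ε ^ 2 / 1024 * (Fintype.card F : ℝ) ^ 5 ≤ partEdges E (τ x)) ∧
      Fintype.card ι ≤ Fintype.card I + 1 ∧ (∀ x, 0 ≤ w x) ∧ ∑ x, w x = 1 ∧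
      ∀ i, ∑ x, w x * load (τ x) i ≤ 6 * (1 + ε) / Fintype.card I := by
  classical
  refine exists_fractional_tiling (I := I) (T := I × I × I × I × I)
    (D := fun t => η * ε ^ 2 / 1024 * (Fintype.card F : ℝ) ^ 5 ≤ partEdges E t) fun y hy => ?_
  have hMpos : 0 < M := lt_of_lt_of_le (by positivity) hM
  set N : ℝ := (Fintype.card I : ℝ) with hN
  set m : ℝ := (Fintype.card F : ℝ) with hm
  have hNm : (Fintype.card (I × F) : ℝ) = M := by rw [hMc]; simp [hN, hm]
  have hN0 : 0 < N := by
    have : 0 ≤ N := by positivity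
    rcases this.eq_or_lt with h | h
    · rw [hMc, ← h] at hMpos; simp at hMpos
    · exact h
  have hm0 : 0 < m := by
    have : 0 ≤ m := by positivity
    rcases this.eq_or_lt with h | h
    · rw [hMc, ← h] at hMpos; simp at hMpos
    · exact h
  have hbad : cnt (fun z : ((I × F) × (I × F)) × ((I × F) × (I × F) × (I × F)) =>
      E z.2.1 z.2.2.1 z.2.2.2 z.1.1 z.1.2 ∧ ¬ η * ε ^ 2 / 1024 * m ^ 5 ≤
        partEdges E (z.2.1.1, z.2.2.1.1, z.2.2.2.1, z.1.1.1, z.1.2.1)) ≤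
      η * ε ^ 2 / 1024 * (Fintype.card (I × F) : ℝ) ^ 5 := by
    set d := η * ε ^ 2 / 1024 with hd
    have hd0 : 0 ≤ d := by positivity
    rw [hNm]
    have h1 : cnt (fun z : ((I × F) × (I × F)) × ((I × F) × (I × F) × (I × F)) =>
        E z.2.1 z.2.2.1 z.2.2.2 z.1.1 z.1.2 ∧
        ¬ d * m ^ 5 ≤ partEdges E (z.2.1.1, z.2.2.1.1, z.2.2.2.1, z.1.1.1, z.1.2.1)) ≤
      cnt (fun z : (I × I × I × I × I) × (F × F × F × F × F) =>
        E (z.1.1, z.2.1) (z.1.2.1, z.2.2.1) (z.1.2.2.1, z.2.2.2.1) (z.1.2.2.2.1, z.2.2.2.2.1)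
          (z.1.2.2.2.2, z.2.2.2.2.2) ∧ ¬ d * m ^ 5 ≤ partEdges E z.1) := by
      refine cnt_le_of_injOn (fun z => ((z.2.1.1, z.2.2.1.1, z.2.2.2.1, z.1.1.1, z.1.2.1),
        (z.2.1.2, z.2.2.1.2, z.2.2.2.2, z.1.1.2, z.1.2.2))) (fun z hz => hz) ?_
      rintro ⟨⟨⟨a1, a2⟩, ⟨b1, b2⟩⟩, ⟨c1, c2⟩, ⟨d1, d2⟩, ⟨e1, e2⟩⟩
        ⟨⟨⟨a1', a2'⟩, ⟨b1', b2'⟩⟩, ⟨c1', c2'⟩, ⟨d1', d2'⟩, ⟨e1', e2'⟩⟩ _ _ h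
      simp only [Prod.mk.injEq] at h ⊢
      tauto
    refine h1.trans ?_
    have h2 := cnt_prod_le (P := fun z : (I × I × I × I × I) × (F × F × F × F × F) =>
        E (z.1.1, z.2.1) (z.1.2.1, z.2.2.1) (z.1.2.2.1, z.2.2.2.1) (z.1.2.2.2.1, z.2.2.2.2.1)
          (z.1.2.2.2.2, z.2.2.2.2.2) ∧ ¬ d * m ^ 5 ≤ partEdges E z.1)
      (A := fun t => ¬ d * m ^ 5 ≤ partEdges E t) (q := d * m ^ 5) (fun x hx => hx.2) ?_
    · refine h2.trans ?_
      have h3 := cnt_le_card (fun t : I × I × I × I × I => ¬ d * m ^ 5 ≤ partEdges E t)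
      have h4 : (Fintype.card (I × I × I × I × I) : ℝ) = N ^ 5 := by
        simp only [Fintype.card_prod, Nat.cast_mul]; ring
      rw [h4] at h3
      calc _ ≤ N ^ 5 * (d * m ^ 5) := by gcongr
        _ = _ := by rw [hMc]; ring
    · intro t ht
      push Not at ht
      exact (cnt_mono fun j hj => hj.1).trans ht.le
  obtain ⟨a, b, c, u, v, hE, hG, hY⟩ := exists_light_edge (W := I × F) (E := E)
    (G := fun a b c u v => η * ε ^ 2 / 1024 * m ^ 5 ≤ partEdges E (a.1, b.1, c.1, u.1, v.1))
    (Y := fun x => y x.1) hε hε1 hη (by rw [hNm]; exact hM) (fun x => hy _)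
    (by rw [hNm]; exact hdeg) hbad
  refine ⟨(a.1, b.1, c.1, u.1, v.1), hG, ?_⟩
  have h1 : ∑ i, y i * load (a.1, b.1, c.1, u.1, v.1) i =
      y a.1 + y b.1 + y c.1 + y u.1 + 2 * y v.1 := by
    simp only [load, mul_add, Finset.sum_add_distrib, mul_ite, mul_one, mul_zero,
      Finset.sum_ite_eq, mem_univ, if_true]
    ring
  rw [h1]
  refine hY.trans (le_of_eq ?_)
  rw [hNm, hMc, Fintype.sum_prod_type]
  simp only [Finset.sum_const, nsmul_eq_mul, card_univ, ← Finset.mul_sum]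
  field_simp
  ring

end Duality

section CompletePartite

theorem cnt_forall_pow {α β : Type*} [Fintype α] [Fintype β] (P : α → β → Prop) (t : ℕ) :
    ∑ f : Fin t → α, cnt (fun b => ∀ i, P (f i) b) = ∑ b, cnt (fun a => P a b) ^ t := by
  classical
  simp only [cnt]
  rw [Finset.sum_comm]
  refine Finset.sum_congr rfl fun b _ => ?_
  rw [Fintype.sum_pow]
  refine Finset.sum_congr rfl fun f _ => ?_
  by_cases h : ∀ i, P (f i) b
  · simp [h]
  · rw [if_neg h]
    push Not at h
    obtain ⟨i, hi⟩ := h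
    exact (Finset.prod_eq_zero (mem_univ i) (by simp [hi])).symm

/-- In a dense bipartite graph some `t` vertices on one side have many common neighbours. -/
theorem exists_common_neighbours (t : ℕ) {d : ℝ} (hd : 0 < d) :
    ∃ m₀ : ℕ, ∀ (α β : Type) [Fintype α] [Fintype β] (P : α → β → Prop), m₀ ≤ Fintype.card α →
      d * (Fintype.card α * Fintype.card β) ≤ cnt (fun x : α × β => P x.1 x.2) →
      ∃ f : Fin t → α, Function.Injective f ∧
        d ^ t / 2 * Fintype.card β ≤ cnt (fun b => ∀ i, P (f i) b) := by
  classical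
  refine ⟨t + 1 + ⌈2 * (t : ℝ) ^ 2 / d ^ t⌉₊, fun α β _ _ P hα hP => ?_⟩
  have hαt : t ≤ Fintype.card α := by omega
  have hα0 : 0 < (Fintype.card α : ℝ) := by
    have : 0 < Fintype.card α := by omega
    exact_mod_cast this
  obtain ⟨f₀⟩ : Nonempty (Fin t ↪ α) := Function.Embedding.nonempty_of_card_le (by simpa using hαt)
  rcases (Nat.cast_nonneg (α := ℝ) (Fintype.card β)).eq_or_lt with hβ | hβ
  · exact ⟨f₀, f₀.injective, by rw [← hβ]; simpa using cnt_nonneg _⟩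
  by_contra hcon
  push Not at hcon
  set A : ℝ := (Fintype.card α : ℝ) with hA
  set B : ℝ := (Fintype.card β : ℝ) with hB
  have hlow : B * (d * A) ^ t ≤ ∑ f : Fin t → α, cnt (fun b => ∀ i, P (f i) b) := by
    rw [cnt_forall_pow]
    cases t with
    | zero => simp [hB]
    | succ s =>
      have h1 := pow_sum_div_card_le_sum_pow (s := (univ : Finset β))
        (f := fun b => cnt (fun a => P a b)) (fun b _ => cnt_nonneg _) s
      refine le_trans ?_ h1
      rw [le_div_iff₀ (by rw [card_univ]; positivity), card_univ, ← hB]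
      rw [cnt_prod_right] at hP
      calc B * (d * A) ^ (s + 1) * B ^ s = (d * (A * B)) ^ (s + 1) := by ring
        _ ≤ _ := by gcongr
  have hup : ∑ f : Fin t → α, cnt (fun b => ∀ i, P (f i) b) <
      ∑ f : Fin t → α, (d ^ t / 2 * B + if ¬ Function.Injective f then B else 0) := by
    refine Finset.sum_lt_sum (fun f _ => ?_) ⟨f₀, mem_univ _, ?_⟩
    · split_ifs with h
      · rw [add_zero]; exact (hcon f h).le
      · have := cnt_le_card (fun b => ∀ i, P (f i) b)
        have : 0 ≤ d ^ t / 2 * B := by positivity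
        linarith
    · have := hcon f₀ f₀.injective
      rw [if_neg (not_not.2 f₀.injective), add_zero]
      exact this
  have hni := cnt_not_injective_le (K := Fin t) (V := α)
  rw [← hA, Fintype.card_fin] at hni
  have hcount : ∑ f : Fin t → α, (d ^ t / 2 * B + if ¬ Function.Injective f then B else 0) =
      A ^ t * (d ^ t / 2 * B) + cnt (fun f : Fin t → α => ¬ Function.Injective f) * B := by
    rw [Finset.sum_add_distrib, cnt, Finset.sum_mul]
    congr 1
    · simp [hA]
    · exact Finset.sum_congr rfl fun f _ => by split_ifs <;> simp
  rw [hcount] at hup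
  have hAbig : 2 * (t : ℝ) ^ 2 / d ^ t ≤ A := by
    refine (Nat.le_ceil _).trans ?_
    rw [hA, Nat.cast_le]
    omega
  rw [div_le_iff₀ (by positivity)] at hAbig
  have h5 : cnt (fun f : Fin t → α => ¬ Function.Injective f) ≤ A ^ t * (d ^ t / 2) := by
    have h6 : cnt (fun f : Fin t → α => ¬ Function.Injective f) * A ≤ A ^ t * (d ^ t / 2) * A := by
      refine hni.trans ?_
      have : (t : ℝ) ^ 2 * A ^ t ≤ A * d ^ t / 2 * A ^ t := by gcongr; linarith
      linarith
    exact le_of_mul_le_mul_right h6 hα0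
  have h7 := mul_le_mul_of_nonneg_right h5 hβ.le
  rw [mul_pow] at hlow
  nlinarith

/-- Erdős: a dense 5-partite 5-graph contains a large complete 5-partite 5-graph. -/
theorem exists_complete_partite (t : ℕ) {d : ℝ} (hd : 0 < d) :
    ∃ m₀ : ℕ, ∀ (F : Type) [Fintype F] (P : F × F × F × F × F → Prop), m₀ ≤ Fintype.card F →
      d * (Fintype.card F : ℝ) ^ 5 ≤ cnt P →
      ∃ f₁ f₂ f₃ f₄ f₅ : Fin t → F, Function.Injective f₁ ∧ Function.Injective f₂ ∧
        Function.Injective f₃ ∧ Function.Injective f₄ ∧ Function.Injective f₅ ∧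
        ∀ a b c d e, P (f₁ a, f₂ b, f₃ c, f₄ d, f₅ e) := by
  obtain ⟨m₁, h₁⟩ := exists_common_neighbours t hd
  have hd₁ : 0 < d ^ t / 2 := by positivity
  generalize d ^ t / 2 = d₁ at h₁ hd₁
  obtain ⟨m₂, h₂⟩ := exists_common_neighbours t hd₁
  have hd₂ : 0 < d₁ ^ t / 2 := by positivity
  generalize d₁ ^ t / 2 = d₂ at h₂ hd₂
  obtain ⟨m₃, h₃⟩ := exists_common_neighbours t hd₂
  have hd₃ : 0 < d₂ ^ t / 2 := by positivity
  generalize d₂ ^ t / 2 = d₃ at h₃ hd₃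
  obtain ⟨m₄, h₄⟩ := exists_common_neighbours t hd₃
  have hd₄ : 0 < d₃ ^ t / 2 := by positivity
  generalize d₃ ^ t / 2 = d₄ at h₄ hd₄
  obtain ⟨m₅, h₅⟩ := exists_common_neighbours t hd₄
  have hd₅ : 0 < d₄ ^ t / 2 := by positivity
  generalize d₄ ^ t / 2 = d₅ at h₅ hd₅
  refine ⟨m₁ + m₂ + m₃ + m₄ + m₅, fun F _ P hF hP => ?_⟩
  obtain ⟨f₁, i₁, c₁⟩ := h₁ F (F × F × F × F) (fun x y => P (x, y)) (by omega)
    (le_trans (le_of_eq (by simp only [Fintype.card_prod, Nat.cast_mul]; ring)) hP)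
  obtain ⟨f₂, i₂, c₂⟩ := h₂ F (F × F × F) (fun x y => ∀ a, P (f₁ a, x, y)) (by omega)
    (le_trans (le_of_eq (by simp only [Fintype.card_prod, Nat.cast_mul])) c₁)
  obtain ⟨f₃, i₃, c₃⟩ := h₃ F (F × F) (fun x y => ∀ b a, P (f₁ a, f₂ b, x, y)) (by omega)
    (le_trans (le_of_eq (by simp only [Fintype.card_prod, Nat.cast_mul])) c₂)
  obtain ⟨f₄, i₄, c₄⟩ := h₄ F F (fun x y => ∀ c b a, P (f₁ a, f₂ b, f₃ c, x, y)) (by omega)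
    (le_trans (le_of_eq (by simp only [Fintype.card_prod, Nat.cast_mul])) c₃)
  obtain ⟨f₅, i₅, c₅⟩ := h₅ F Unit (fun x _ => ∀ d c b a, P (f₁ a, f₂ b, f₃ c, f₄ d, x)) (by omega)
    (by
      rw [cnt_prod_right]
      simpa using c₄)
  obtain ⟨_, hu⟩ := exists_of_cnt_pos (lt_of_lt_of_le (by simpa using hd₅) c₅)
  exact ⟨f₁, f₂, f₃, f₄, f₅, i₁, i₂, i₃, i₄, i₅, fun a b c d e => hu e d c b a⟩

end CompletePartite

section Greedy

/-- A greedy choice of pairwise compatible objects. -/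
theorem exists_greedy {κ X : Type*} [Fintype κ] [Nonempty X] {Good : κ → X → Prop}
    {Compat : X → X → Prop} (hsymm : ∀ x y, Compat x y → Compat y x)
    (step : ∀ (S : Finset κ) (g : κ → X) (y : κ), y ∉ S → (∀ z ∈ S, Good z (g z)) →
      ∃ x, Good y x ∧ ∀ z ∈ S, Compat (g z) x) :
    ∃ g : κ → X, (∀ y, Good y (g y)) ∧ ∀ y z, y ≠ z → Compat (g y) (g z) := by
  classical
  suffices h : ∀ S : Finset κ, ∃ g : κ → X, (∀ y ∈ S, Good y (g y)) ∧
      ∀ y ∈ S, ∀ z ∈ S, y ≠ z → Compat (g y) (g z) by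
    obtain ⟨g, h1, h2⟩ := h univ
    exact ⟨g, fun y => h1 y (mem_univ y), fun y z => h2 y (mem_univ y) z (mem_univ z)⟩
  intro S
  induction S using Finset.induction_on with
  | empty => exact ⟨fun _ => Classical.arbitrary X, by simp, by simp⟩
  | insert y S hy ih =>
    obtain ⟨g, h1, h2⟩ := ih
    obtain ⟨x, hx, hc⟩ := step S g y hy h1
    have hne : ∀ z ∈ S, z ≠ y := fun z hz h => hy (h ▸ hz)
    refine ⟨Function.update g y x, ?_, ?_⟩
    · intro z hz
      rcases mem_insert.1 hz with rfl | hz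
      · simpa using hx
      · rw [Function.update_of_ne (hne z hz)]; exact h1 z hz
    · intro a ha b hb hab
      rcases mem_insert.1 ha with rfl | ha' <;> rcases mem_insert.1 hb with rfl | hb'
      · exact absurd rfl hab
      · rw [Function.update_self, Function.update_of_ne (hne b hb')]
        exact hsymm _ _ (hc b hb')
      · rw [Function.update_self, Function.update_of_ne (hne a ha')]
        exact hc a ha'
      · rw [Function.update_of_ne (hne a ha'), Function.update_of_ne (hne b hb')]
        exact h2 a ha' b hb' hab

end Greedy

section Tiles

/-- `g` is a complete 5-partite 5-graph with parts of sizes `m, m, m, m, 2m`, where the last part is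
split into two halves. -/
def IsTile {V : Type} (E : V → V → V → V → V → Prop) {m : ℕ} (g : Fin 6 → Fin m → V) : Prop :=
  ∀ a b c d e, E (g 0 a) (g 1 b) (g 2 c) (g 3 d) (g 4 e) ∧ E (g 0 a) (g 1 b) (g 2 c) (g 3 d) (g 5 e)

/-- There is a tiling covering at least `α |V|` vertices. -/
def HasTiling {V : Type} [Fintype V] (E : V → V → V → V → V → Prop) (m : ℕ) (α : ℝ) : Prop :=
  ∃ (κ : Type) (_ : Fintype κ) (g : κ → Fin 6 → Fin m → V), (∀ x, IsTile E (g x)) ∧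
    Function.Injective (fun p : κ × Fin 6 × Fin m => g p.1 p.2.1 p.2.2) ∧
    α * Fintype.card V ≤ Fintype.card κ * (6 * m)

/-- The parts of a tuple, with the last one repeated. -/
def part {I : Type} (t : I × I × I × I × I) : Fin 6 → I :=
  ![t.1, t.2.1, t.2.2.1, t.2.2.2.1, t.2.2.2.2, t.2.2.2.2]

theorem sum_part {I : Type} [DecidableEq I] (t : I × I × I × I × I) (i : I) :
    ∑ s, (if part t s = i then (1 : ℝ) else 0) = load t i := by
  rw [Fin.sum_univ_six, load, two_mul, ← add_assoc]
  rfl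

theorem load_nonneg {I : Type} [DecidableEq I] (t : I × I × I × I × I) (i : I) : 0 ≤ load t i := by
  rw [← sum_part]
  exact Finset.sum_nonneg fun s _ => by split_ifs <;> norm_num

/-- `E` only holds for tuples of distinct vertices. -/
def Distinct {V : Type} (E : V → V → V → V → V → Prop) : Prop :=
  ∀ a b c d e, E a b c d e → [a, b, c, d, e].Nodup

theorem cnt_fst {α β : Type*} [Fintype α] [Fintype β] (P : α → Prop) :
    cnt (fun x : α × β => P x.1) = cnt P * Fintype.card β := by
  classical
  rw [cnt_prod, cnt, Finset.sum_mul]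
  refine Finset.sum_congr rfl fun a _ => ?_
  split_ifs with h <;> simp [cnt, h]

theorem cnt_snd {α β : Type*} [Fintype α] [Fintype β] (P : β → Prop) :
    cnt (fun x : α × β => P x.2) = Fintype.card α * cnt P := by
  rw [cnt_prod]
  simp

theorem cnt_and_not_ge {α : Type*} [Fintype α] {P R : α → Prop} {p r : ℝ} (hP : p ≤ cnt P)
    (hR : cnt R ≤ r) : p - r ≤ cnt (fun a => P a ∧ ¬ R a) := by
  have := cnt_le_add (P := P) (Q := R) (R := fun a => P a ∧ ¬ R a) fun a ha => by tauto
  linarith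

/-- A dense tuple of parts contains a tile avoiding a small set. -/
theorem exists_tile_avoiding (k : ℕ) {d : ℝ} (hd : 0 < d) :
    ∃ m₀ : ℕ, ∀ (I F : Type) [Fintype I] [Fintype F] [DecidableEq I] [DecidableEq F]
      (E : I × F → I × F → I × F → I × F → I × F → Prop) (t : I × I × I × I × I)
      (U : Finset (I × F)), m₀ ≤ Fintype.card F → Distinct E →
      d * (Fintype.card F : ℝ) ^ 5 ≤ partEdges E t →
      (∀ i, cnt (fun a : F => (i, a) ∈ U) ≤ d / 20 * Fintype.card F) →
      ∃ g : Fin 6 → Fin k → I × F, IsTile E g ∧ (∀ s a, (g s a).1 = part t s) ∧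
        (∀ s a, g s a ∉ U) ∧ Function.Injective fun p : Fin 6 × Fin k => g p.1 p.2 := by
  classical
  obtain ⟨m₀, hm₀⟩ := exists_complete_partite (k + k) (half_pos hd)
  refine ⟨m₀, fun I F _ _ _ _ E t U hm hE ht hU => ?_⟩
  set m : ℝ := (Fintype.card F : ℝ) with hmdef
  have hm0 : 0 ≤ m := by positivity
  have hm5 : 0 ≤ d * m ^ 5 := by positivity
  have h1 : cnt (fun j : F × F × F × F × F => (t.1, j.1) ∈ U) ≤ d / 20 * m ^ 5 := by
    rw [cnt_fst (fun a : F => (t.1, a) ∈ U)]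
    simp only [Fintype.card_prod, Nat.cast_mul]
    calc _ ≤ (d / 20 * m) * (m * (m * (m * m))) := by gcongr; exact hU _
      _ = _ := by ring
  have h2 : cnt (fun j : F × F × F × F × F => (t.2.1, j.2.1) ∈ U) ≤ d / 20 * m ^ 5 := by
    rw [cnt_snd (fun x : F × F × F × F => (t.2.1, x.1) ∈ U), cnt_fst (fun a => (t.2.1, a) ∈ U)]
    simp only [Fintype.card_prod, Nat.cast_mul]
    calc _ ≤ m * ((d / 20 * m) * (m * (m * m))) := by gcongr; exact hU _
      _ = _ := by ring
  have h3 : cnt (fun j : F × F × F × F × F => (t.2.2.1, j.2.2.1) ∈ U) ≤ d / 20 * m ^ 5 := by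
    rw [cnt_snd (fun x : F × F × F × F => (t.2.2.1, x.2.1) ∈ U),
      cnt_snd (fun x : F × F × F => (t.2.2.1, x.1) ∈ U), cnt_fst (fun a => (t.2.2.1, a) ∈ U)]
    simp only [Fintype.card_prod, Nat.cast_mul]
    calc _ ≤ m * (m * ((d / 20 * m) * (m * m))) := by gcongr; exact hU _
      _ = _ := by ring
  have h4 : cnt (fun j : F × F × F × F × F => (t.2.2.2.1, j.2.2.2.1) ∈ U) ≤ d / 20 * m ^ 5 := by
    rw [cnt_snd (fun x : F × F × F × F => (t.2.2.2.1, x.2.2.1) ∈ U),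
      cnt_snd (fun x : F × F × F => (t.2.2.2.1, x.2.1) ∈ U),
      cnt_snd (fun x : F × F => (t.2.2.2.1, x.1) ∈ U), cnt_fst (fun a => (t.2.2.2.1, a) ∈ U)]
    calc _ ≤ m * (m * (m * ((d / 20 * m) * m))) := by gcongr; exact hU _
      _ = _ := by ring
  have h5 : cnt (fun j : F × F × F × F × F => (t.2.2.2.2, j.2.2.2.2) ∈ U) ≤ d / 20 * m ^ 5 := by
    rw [cnt_snd (fun x : F × F × F × F => (t.2.2.2.2, x.2.2.2) ∈ U),
      cnt_snd (fun x : F × F × F => (t.2.2.2.2, x.2.2) ∈ U),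
      cnt_snd (fun x : F × F => (t.2.2.2.2, x.2) ∈ U), cnt_snd (fun a => (t.2.2.2.2, a) ∈ U)]
    calc _ ≤ m * (m * (m * (m * (d / 20 * m)))) := by gcongr; exact hU _
      _ = _ := by ring
  have key := cnt_and_not_ge (cnt_and_not_ge (cnt_and_not_ge (cnt_and_not_ge
    (cnt_and_not_ge ht h1) h2) h3) h4) h5
  obtain ⟨f₁, f₂, f₃, f₄, f₅, i₁, i₂, i₃, i₄, i₅, hf⟩ := hm₀ F _ hm (le_trans (by
    rw [← hmdef]; linarith) key)
  simp only at hf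
  have hd : ∀ a b c d e, [(t.1, f₁ a), (t.2.1, f₂ b), (t.2.2.1, f₃ c), (t.2.2.2.1, f₄ d),
      (t.2.2.2.2, f₅ e)].Nodup := fun a b c d e => hE _ _ _ _ _ (hf a b c d e).1.1.1.1.1
  simp only [List.nodup_cons, List.mem_cons, List.not_mem_nil, not_or] at hd
  set p₁ : Fin (k + k) → I × F := fun a => (t.1, f₁ a) with hp₁
  set p₂ : Fin (k + k) → I × F := fun a => (t.2.1, f₂ a) with hp₂
  set p₃ : Fin (k + k) → I × F := fun a => (t.2.2.1, f₃ a) with hp₃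
  set p₄ : Fin (k + k) → I × F := fun a => (t.2.2.2.1, f₄ a) with hp₄
  set p₅ : Fin (k + k) → I × F := fun a => (t.2.2.2.2, f₅ a) with hp₅
  have d₁₂ : ∀ a b, p₁ a ≠ p₂ b := fun a b => (hd a b b b b).1.1
  have d₁₃ : ∀ a b, p₁ a ≠ p₃ b := fun a b => (hd a b b b b).1.2.1
  have d₁₄ : ∀ a b, p₁ a ≠ p₄ b := fun a b => (hd a b b b b).1.2.2.1
  have d₁₅ : ∀ a b, p₁ a ≠ p₅ b := fun a b => (hd a b b b b).1.2.2.2.1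
  have d₂₃ : ∀ a b, p₂ a ≠ p₃ b := fun a b => (hd a a b b b).2.1.1
  have d₂₄ : ∀ a b, p₂ a ≠ p₄ b := fun a b => (hd a a b b b).2.1.2.1
  have d₂₅ : ∀ a b, p₂ a ≠ p₅ b := fun a b => (hd a a b b b).2.1.2.2.1
  have d₃₄ : ∀ a b, p₃ a ≠ p₄ b := fun a b => (hd a a a b b).2.2.1.1
  have d₃₅ : ∀ a b, p₃ a ≠ p₅ b := fun a b => (hd a a a b b).2.2.1.2.1
  have d₄₅ : ∀ a b, p₄ a ≠ p₅ b := fun a b => (hd a a a a b).2.2.2.1.1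
  refine ⟨![fun a => p₁ (Fin.castAdd k a), fun a => p₂ (Fin.castAdd k a),
    fun a => p₃ (Fin.castAdd k a), fun a => p₄ (Fin.castAdd k a), fun a => p₅ (Fin.castAdd k a),
    fun a => p₅ (Fin.natAdd k a)], ?_, ?_, ?_, ?_⟩
  · intro a b c d e
    exact ⟨(hf _ _ _ _ _).1.1.1.1.1, (hf _ _ _ _ _).1.1.1.1.1⟩
  · intro s a
    fin_cases s <;> rfl
  · intro s a
    have h := fun b => hf b b b b b
    fin_cases s
    · exact (h _).1.1.1.1.2
    · exact (h _).1.1.1.2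
    · exact (h _).1.1.2
    · exact (h _).1.2
    · exact (h _).2
    · exact (h _).2
  · have h₁ : Function.Injective p₁ := fun a b h => i₁ (Prod.mk.inj h).2
    have h₂ : Function.Injective p₂ := fun a b h => i₂ (Prod.mk.inj h).2
    have h₃ : Function.Injective p₃ := fun a b h => i₃ (Prod.mk.inj h).2
    have h₄ : Function.Injective p₄ := fun a b h => i₄ (Prod.mk.inj h).2
    have h₅ : Function.Injective p₅ := fun a b h => i₅ (Prod.mk.inj h).2
    have hcn : ∀ a b : Fin k, Fin.castAdd k a ≠ Fin.natAdd k b := fun a b h => by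
      have := congrArg Fin.val h
      simp only [Fin.val_castAdd, Fin.val_natAdd] at this
      omega
    have cc : Function.Injective (Fin.castAdd k : Fin k → Fin (k + k)) :=
      Fin.castAdd_injective k k
    have nn : Function.Injective (Fin.natAdd k : Fin k → Fin (k + k)) :=
      Fin.natAdd_injective k k
    clear_value p₁ p₂ p₃ p₄ p₅
    rintro ⟨s, a⟩ ⟨s', b⟩ h
    dsimp only at h
    fin_cases s <;> fin_cases s' <;> first
      | exact absurd h (d₁₂ _ _) | exact absurd h (d₁₃ _ _) | exact absurd h (d₁₄ _ _)
      | exact absurd h (d₁₅ _ _) | exact absurd h (d₂₃ _ _) | exact absurd h (d₂₄ _ _)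
      | exact absurd h (d₂₅ _ _) | exact absurd h (d₃₄ _ _) | exact absurd h (d₃₅ _ _)
      | exact absurd h (d₄₅ _ _) | exact absurd h.symm (d₁₂ _ _) | exact absurd h.symm (d₁₃ _ _)
      | exact absurd h.symm (d₁₄ _ _) | exact absurd h.symm (d₁₅ _ _)
      | exact absurd h.symm (d₂₃ _ _) | exact absurd h.symm (d₂₄ _ _)
      | exact absurd h.symm (d₂₅ _ _) | exact absurd h.symm (d₃₄ _ _)
      | exact absurd h.symm (d₃₅ _ _) | exact absurd h.symm (d₄₅ _ _)
      | exact congrArg _ (cc (h₁ h)) | exact congrArg _ (cc (h₂ h)) | exact congrArg _ (cc (h₃ h))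
      | exact congrArg _ (cc (h₄ h)) | exact congrArg _ (cc (h₅ h)) | exact congrArg _ (nn (h₅ h))
      | exact absurd (h₅ h) (hcn _ _) | exact absurd (h₅ h).symm (hcn _ _)

end Tiles

section TilesInParts

/-- Disjoint tiles realising a prescribed family of dense tuples, if no part is overloaded. -/
theorem exists_disjoint_tiles (k : ℕ) {d : ℝ} (hd : 0 < d) :
    ∃ m₀ : ℕ, ∀ (I F κ : Type) [Fintype I] [Fintype F] [Fintype κ] [DecidableEq I]
      [Nonempty (I × F)] (E : I × F → I × F → I × F → I × F → I × F → Prop)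
      (T : κ → I × I × I × I × I), m₀ ≤ Fintype.card F → Distinct E →
      (∀ y, d * (Fintype.card F : ℝ) ^ 5 ≤ partEdges E (T y)) →
      (∀ i, ∑ y, k * load (T y) i ≤ d / 20 * Fintype.card F) →
      ∃ g : κ → Fin 6 → Fin k → I × F, (∀ y, IsTile E (g y)) ∧
        Function.Injective (fun p : κ × Fin 6 × Fin k => g p.1 p.2.1 p.2.2) ∧
        ∀ i, cnt (fun a : F => ∃ y s b, g y s b = (i, a)) ≤ d / 20 * Fintype.card F := by
  classical
  obtain ⟨m₀, hm₀⟩ := exists_tile_avoiding k hd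
  refine ⟨m₀, fun I F κ _ _ _ _ _ E T hm hE hT hload => ?_⟩
  set Good : κ → (Fin 6 → Fin k → I × F) → Prop := fun y g => IsTile E g ∧
    (∀ s a, (g s a).1 = part (T y) s) ∧ Function.Injective fun p : Fin 6 × Fin k => g p.1 p.2
    with hGood
  have hcount : ∀ (S : Finset κ) (g : κ → Fin 6 → Fin k → I × F), (∀ z ∈ S, Good z (g z)) →
      ∀ i, cnt (fun a : F => ∃ z ∈ S, ∃ s b, g z s b = (i, a)) ≤ d / 20 * Fintype.card F := by
    intro S g hg i
    refine le_trans ?_ (hload i)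
    have h1 : cnt (fun a : F => ∃ z ∈ S, ∃ s b, g z s b = (i, a)) ≤
        cnt (fun a : F => ∃ p : κ × Fin 6 × Fin k, p.1 ∈ S ∧ g p.1 p.2.1 p.2.2 = (i, a)) :=
      cnt_mono fun a ⟨z, hz, s, b, h⟩ => ⟨(z, s, b), hz, h⟩
    refine h1.trans ((cnt_exists_le _).trans ?_)
    rw [Fintype.sum_prod_type]
    refine Finset.sum_le_sum fun z _ => ?_
    rw [Fintype.sum_prod_type, ← sum_part, Finset.mul_sum]
    refine Finset.sum_le_sum fun s _ => ?_
    calc _ ≤ ∑ _b : Fin k, (if part (T z) s = i then (1 : ℝ) else 0) := by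
          refine Finset.sum_le_sum fun b _ => ?_
          by_cases hz : z ∈ S
          · split_ifs with hp
            · rw [cnt_eq_card]
              have : (univ.filter fun a : F => z ∈ S ∧ g z s b = (i, a)) ⊆ {(g z s b).2} := by
                intro a ha
                simp only [mem_filter, mem_univ, true_and, mem_singleton] at ha ⊢
                rw [ha.2]
              have := card_le_card this
              rw [card_singleton] at this
              exact_mod_cast this
            · refine le_of_eq ?_
              simp only [cnt]
              refine Finset.sum_eq_zero fun a _ => if_neg fun h => hp ?_
              rw [← (hg z hz).2.1 s b, h.2]
          · simp only [cnt, hz, false_and, if_false, Finset.sum_const_zero]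
            split_ifs <;> norm_num
      _ = _ := by simp
  have hne : Nonempty (Fin 6 → Fin k → I × F) := inferInstance
  obtain ⟨g, hg, hdis⟩ := exists_greedy (κ := κ) (X := Fin 6 → Fin k → I × F) (Good := Good)
    (Compat := fun x y => ∀ s a s' a', x s a ≠ y s' a')
    (fun x y h s a s' a' => (h s' a' s a).symm) (by
      intro S g y hy hg
      obtain ⟨x, h1, h2, h3, h4⟩ := hm₀ I F E (T y)
        (univ.filter fun v => ∃ z ∈ S, ∃ s b, g z s b = v) hm hE (hT y) (fun i => by
          refine le_trans (cnt_mono fun a ha => ?_) (hcount S g hg i)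
          simpa using ha)
      refine ⟨x, ⟨h1, h2, h4⟩, fun z hz s a s' a' h => h3 s' a' ?_⟩
      simp only [mem_filter, mem_univ, true_and]
      exact ⟨z, hz, s, a, h⟩)
  refine ⟨g, fun y => (hg y).1, ?_, fun i => ?_⟩
  · rintro ⟨y, p⟩ ⟨z, p'⟩ h
    by_cases hyz : y = z
    · subst hyz
      exact congrArg (Prod.mk y) ((hg y).2.2 h)
    · exact absurd h (hdis y z hyz _ _ _ _)
  · refine le_trans (cnt_mono fun a ha => ?_) (hcount univ g (fun z _ => hg z) i)
    simpa using ha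

/-- Cutting tiles into smaller tiles that avoid a small set. -/
theorem exists_subtiles {V I old : Type} [Fintype old] {m k q : ℕ} {c : I × Fin m → V}
    {E : V → V → V → V → V → Prop} {ix : old × Fin 6 → I} (hix : Function.Injective ix)
    (htile : ∀ x, IsTile E fun s a => c (ix (x, s), a)) {U : I × Fin m → Prop} {r : ℝ}
    (hU : ∀ i, cnt (fun a : Fin m => U (i, a)) ≤ r) (hq : (q * k : ℝ) ≤ m - r) :
    ∃ h : old × Fin q → Fin 6 → Fin k → I × Fin m,
      (∀ x, IsTile (fun a b c' d e => E (c a) (c b) (c c') (c d) (c e)) (h x)) ∧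
      Function.Injective (fun p : (old × Fin q) × Fin 6 × Fin k => h p.1 p.2.1 p.2.2) ∧
      ∀ x s a, ¬ U (h x s a) := by
  classical
  have hemb : ∀ i : I, Nonempty (Fin q × Fin k ↪ {a : Fin m // ¬ U (i, a)}) := by
    intro i
    refine Function.Embedding.nonempty_of_card_le ?_
    have h1 := cnt_and_not_ge (P := fun _ : Fin m => True) (p := m) (by rw [cnt_true]; simp) (hU i)
    have h2 : (q * k : ℝ) ≤ Fintype.card {a : Fin m // ¬ U (i, a)} := by
      rw [Fintype.card_subtype, ← cnt_eq_card]
      refine hq.trans (h1.trans (cnt_mono fun a ha => ha.2))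
    rw [Fintype.card_prod, Fintype.card_fin, Fintype.card_fin]
    exact_mod_cast h2
  have e : ∀ i : I, Fin q × Fin k ↪ {a : Fin m // ¬ U (i, a)} := fun i => (hemb i).some
  refine ⟨fun x s b => (ix (x.1, s), (e (ix (x.1, s)) (x.2, b)).1), fun x => ?_, ?_,
    fun x s b => (e (ix (x.1, s)) (x.2, b)).2⟩
  · intro a b c' d e'
    exact ⟨(htile x.1 _ _ _ _ _).1, (htile x.1 _ _ _ _ _).2⟩
  · rintro ⟨⟨x, j⟩, s, b⟩ ⟨⟨x', j'⟩, s', b'⟩ h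
    simp only [Prod.mk.injEq] at h
    have h1 := hix h.1
    simp only [Prod.mk.injEq] at h1
    obtain ⟨rfl, rfl⟩ := h1
    have h2 := (e (ix (x, s))).injective (Subtype.ext h.2)
    simp only [Prod.mk.injEq] at h2
    obtain ⟨rfl, rfl⟩ := h2
    rfl

end TilesInParts

section Tiling

theorem cnt_not_mem_range {V W : Type} [Fintype V] [Fintype W] {c : W → V}
    (hc : Function.Injective c) :
    cnt (fun v : V => ¬ ∃ w, c w = v) = Fintype.card V - Fintype.card W := by
  classical
  have h1 : cnt (fun v : V => ∃ w, c w = v) = Fintype.card W := by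
    rw [cnt_eq_card, ← Finset.card_univ, ← Finset.card_image_of_injective univ hc]
    congr 2
    ext v
    simp
  have h2 : cnt (fun v : V => ¬ ∃ w, c w = v) + cnt (fun v : V => ∃ w, c w = v) =
      Fintype.card V := by
    rw [← cnt_true]
    simp only [cnt]
    rw [← Finset.sum_add_distrib]
    refine Finset.sum_congr rfl fun v _ => ?_
    split_ifs <;> norm_num
  linarith

/-- Restricting triples to a subset. -/
theorem cnt_triples_le_comp {V W : Type} [Fintype V] [Fintype W] {c : W → V}
    (hc : Function.Injective c) (P : V × V × V → Prop) :
    cnt P ≤ cnt (fun t : W × W × W => P (c t.1, c t.2.1, c t.2.2)) +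
      3 * (Fintype.card V - Fintype.card W) * (Fintype.card V : ℝ) ^ 2 := by
  classical
  set Q : V → Prop := fun v => ¬ ∃ w, c w = v with hQ
  have h1 : cnt P ≤ cnt (fun t : V × V × V => P t ∧ ¬ Q t.1 ∧ ¬ Q t.2.1 ∧ ¬ Q t.2.2) +
      (cnt (fun t : V × V × V => Q t.1) + (cnt (fun t : V × V × V => Q t.2.1) +
        cnt (fun t : V × V × V => Q t.2.2))) := by
    refine (cnt_le_add (Q := fun t => P t ∧ ¬ Q t.1 ∧ ¬ Q t.2.1 ∧ ¬ Q t.2.2)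
      (R := fun t => Q t.1 ∨ (Q t.2.1 ∨ Q t.2.2)) fun t ht => ?_).trans ?_
    · tauto
    · gcongr
      refine (cnt_le_add (Q := fun t : V × V × V => Q t.1)
        (R := fun t => (Q t.2.1 ∨ Q t.2.2)) fun t ht => ht).trans ?_
      gcongr
      exact cnt_le_add fun t ht => ht
  rw [cnt_fst Q, cnt_snd (fun x : V × V => Q x.1), cnt_snd (fun x : V × V => Q x.2), cnt_fst Q,
    cnt_snd Q, cnt_not_mem_range hc] at h1
  have h2 : cnt (fun t : V × V × V => P t ∧ ¬ Q t.1 ∧ ¬ Q t.2.1 ∧ ¬ Q t.2.2) ≤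
      cnt (fun t : W × W × W => P (c t.1, c t.2.1, c t.2.2)) := by
    rcases isEmpty_or_nonempty W with hW | hW
    · refine (cnt_mono (Q := fun _ => False) ?_).trans ?_
      · rintro t ⟨-, h, -⟩
        exact h fun ⟨w, _⟩ => hW.elim w
      · simp [cnt]
    · have hinv : ∀ v, ¬ Q v → c (Function.invFun c v) = v := fun v hv =>
        Function.invFun_eq (not_not.1 hv)
      refine cnt_le_of_injOn (fun t => (Function.invFun c t.1, Function.invFun c t.2.1,
        Function.invFun c t.2.2)) ?_ ?_
      · rintro ⟨x, y, z⟩ ⟨h, hx, hy, hz⟩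
        simp only at hx hy hz ⊢
        rwa [hinv x hx, hinv y hy, hinv z hz]
      · rintro ⟨x, y, z⟩ ⟨x', y', z'⟩ ⟨-, hx, hy, hz⟩ ⟨-, hx', hy', hz'⟩ h
        simp only [Prod.mk.injEq] at h hx hy hz hx' hy' hz' ⊢
        refine ⟨?_, ?_, ?_⟩
        · rw [← hinv x hx, h.1, hinv x' hx']
        · rw [← hinv y hy, h.2.1, hinv y' hy']
        · rw [← hinv z hz, h.2.2, hinv z' hz']
  simp only [Fintype.card_prod, Nat.cast_mul] at h1
  nlinarith [h1, h2]

/-- Every pair of distinct vertices has at least `κ |V|^3` ordered triples in its link. -/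
def PairDeg {V : Type} [Fintype V] (E : V → V → V → V → V → Prop) (κ : ℝ) : Prop :=
  ∀ u v, u ≠ v → κ * (Fintype.card V : ℝ) ^ 3 ≤ cnt (fun t : V × V × V => E t.1 t.2.1 t.2.2 u v)

/-- The tiling induced by a partition into parts: dense tuples give new tiles, and old tiles
are cut into smaller ones. -/
theorem exists_partition {V old : Type} [Fintype V] [Fintype old] {m : ℕ} (hm : 0 < m)
    {g : old → Fin 6 → Fin m → V}
    (hg : Function.Injective (fun p : old × Fin 6 × Fin m => g p.1 p.2.1 p.2.2)) :
    ∃ (I : Type) (_ : Fintype I) (ix : old × Fin 6 → I) (c : I × Fin m → V),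
      Function.Injective ix ∧ Function.Injective c ∧ (∀ x s a, c (ix (x, s), a) = g x s a) ∧
      (6 * Fintype.card old : ℝ) ≤ Fintype.card I ∧
      (Fintype.card V : ℝ) - m ≤ Fintype.card I * m := by
  classical
  set gg : old × Fin 6 × Fin m → V := fun p => g p.1 p.2.1 p.2.2 with hgg
  set U := {v : V // ¬ ∃ w, gg w = v} with hU
  set u := Fintype.card U / m with hu
  have hcard : (Fintype.card U : ℝ) = Fintype.card V - 6 * Fintype.card old * m := by
    simp only [U]
    rw [Fintype.card_subtype, ← cnt_eq_card, cnt_not_mem_range hg]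
    simp only [Fintype.card_prod, Fintype.card_fin]
    push_cast
    ring
  obtain ⟨f⟩ : Nonempty (Fin u × Fin m ↪ U) := by
    refine Function.Embedding.nonempty_of_card_le ?_
    rw [Fintype.card_prod, Fintype.card_fin, Fintype.card_fin]
    exact Nat.div_mul_le_self _ _
  have hN : (Fintype.card ((old × Fin 6) ⊕ Fin u) : ℝ) = 6 * Fintype.card old + u := by
    simp only [Fintype.card_sum, Fintype.card_prod, Fintype.card_fin]
    push_cast
    ring
  refine ⟨(old × Fin 6) ⊕ Fin u, inferInstance, Sum.inl,
    fun p => Sum.elim (fun y : old × Fin 6 => g y.1 y.2 p.2) (fun j => (f (j, p.2)).1) p.1,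
    Sum.inl_injective, ?_, fun _ _ _ => rfl, ?_, ?_⟩
  · rintro ⟨y | j, a⟩ ⟨y' | j', a'⟩ h
    · have := @hg (y.1, y.2, a) (y'.1, y'.2, a') h
      simp only [Prod.mk.injEq] at this
      rw [Prod.ext this.1 this.2.1, this.2.2]
    · exact absurd ⟨(y.1, y.2, a), h⟩ (f (j', a')).2
    · exact absurd ⟨(y'.1, y'.2, a'), h.symm⟩ (f (j, a)).2
    · have := f.injective (Subtype.ext h)
      simp only [Prod.mk.injEq] at this
      rw [this.1, this.2]
  · rw [hN]; linarith [show (0 : ℝ) ≤ u by positivity]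
  · have h1 : Fintype.card U < (u + 1) * m := by
      rw [hu]
      have := Nat.lt_div_mul_add hm (a := Fintype.card U)
      linarith
    have h2 : (Fintype.card U : ℝ) ≤ (u + 1) * m := by exact_mod_cast h1.le
    rw [hcard] at h2
    rw [hN]
    nlinarith

theorem hasTiling_mono {V : Type} [Fintype V] {E : V → V → V → V → V → Prop} {m : ℕ} {α β : ℝ}
    (h : β ≤ α) (hT : HasTiling E m α) : HasTiling E m β := by
  obtain ⟨κ, i, g, h1, h2, h3⟩ := hT
  exact ⟨κ, i, g, h1, h2, le_trans (by gcongr) h3⟩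

/-- All large graphs of large minimum pair degree have tilings covering an `α` fraction. -/
def TilingBound (η α : ℝ) : Prop :=
  ∀ m : ℕ, 0 < m → ∃ n₀ : ℕ, ∀ (V : Type) [Fintype V] (E : V → V → V → V → V → Prop),
    n₀ ≤ Fintype.card V → Distinct E → PairDeg E (91 / 216 + η) → HasTiling E m α

theorem tilingBound_zero (η : ℝ) : TilingBound η 0 := by
  intro m hm
  refine ⟨0, fun V _ E _ _ _ => ⟨Empty, inferInstance, fun x => x.elim, fun x => x.elim,
    fun x => x.1.elim, by simp⟩⟩

theorem tilingBound_mono {η α β : ℝ} (h : β ≤ α) (hT : TilingBound η α) : TilingBound η β := by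
  intro m hm
  obtain ⟨n₀, h₀⟩ := hT m hm
  exact ⟨n₀, fun V _ E h1 h2 h3 => hasTiling_mono h (h₀ V E h1 h2 h3)⟩

/-- The numerical estimate behind the growth of a tiling. -/
theorem coverage_ineq {n m N r k K q δ ε α : ℝ} (hδ0 : 0 < δ) (hδ1 : δ ≤ 1) (hε : 0 < ε)
    (hε1 : ε ≤ 1) (hm : 0 < m) (hn : 0 < n) (hN : 0 ≤ N) (hM1 : n - m ≤ N * m)
    (hMn : N * m ≤ n) (hK : N * δ * m / (6 * (1 + ε / 2) * k) - (N + 1) ≤ K)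
    (hq : (1 - δ) * m - k ≤ q * k) (hrN : 6 * r ≤ N) (hr : α * n ≤ r * (6 * m))
    (hαε : α ≤ 1 - ε) (q1 : 8 * (m + 6 * k) ≤ n * (δ * ε)) (hkm : 7 * k ≤ δ * ε / 8 * m)
    (hk0 : 0 < k) (hr0 : 0 ≤ r) : (α + δ * ε / 4) * n ≤ (K + r * q) * (6 * k) := by
  set B : ℝ := N * δ * m / (6 * (1 + ε / 2) * k) with hB
  have hBk : B * (6 * k) = N * m * δ / (1 + ε / 2) := by
    rw [hB]; field_simp
  have hd1 : 0 ≤ 1 - δ := by linarith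
  have hd2 : 0 ≤ 1 - ε / 2 := by linarith
  have e1 : (B - (N + 1)) * (6 * k) ≤ K * (6 * k) := by gcongr
  have e2 : 6 * r * ((1 - δ) * m - k) ≤ 6 * r * (q * k) := by gcongr
  have e3 : δ * (1 - ε / 2) * (N * m) ≤ N * m * δ / (1 + ε / 2) := by
    rw [le_div_iff₀ (by positivity)]
    have : 0 ≤ N * m * δ := by positivity
    nlinarith [mul_nonneg this (sq_nonneg (ε / 2))]
  have e4 : δ * (1 - ε / 2) * (n - m) ≤ δ * (1 - ε / 2) * (N * m) := by gcongr
  have e5 : N * k * 7 ≤ δ * ε / 8 * n := by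
    calc N * k * 7 = N * (7 * k) := by ring
      _ ≤ N * (δ * ε / 8 * m) := by gcongr
      _ = δ * ε / 8 * (N * m) := by ring
      _ ≤ _ := by gcongr
  have e6 : 6 * r * k ≤ N * k := by gcongr
  have e7 : (1 - δ) * (α * n) ≤ (1 - δ) * (r * (6 * m)) := by gcongr
  have e8 : δ * (1 - ε / 2) * m ≤ m := by
    have h1 : δ * (1 - ε / 2) ≤ 1 * 1 := by gcongr; linarith
    nlinarith
  have e9 : δ * α * n ≤ δ * (1 - ε) * n := by gcongr
  linarith

set_option maxHeartbeats 400000 in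
theorem tilingBound_step {η ε : ℝ} (hη : 0 < η) (hη1 : η ≤ 1) (hε : 0 < ε) (hε1 : ε ≤ 1) :
    ∃ γ > 0, ∀ α, 0 ≤ α → α ≤ 1 - ε → TilingBound η α → TilingBound η (α + γ) := by
  classical
  set d : ℝ := η / 2 * (ε / 2) ^ 2 / 1024 with hd
  set δ : ℝ := d / 20 with hδ
  have hd0 : 0 < d := by positivity
  have hδ0 : 0 < δ := by positivity
  have hd1 : d ≤ 1 := by
    have : η / 2 * (ε / 2) ^ 2 ≤ 1 := by
      have h1 : (ε / 2) ^ 2 ≤ 1 := by nlinarith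
      nlinarith [sq_nonneg (ε / 2)]
    rw [hd]; linarith
  have hδ1 : δ ≤ 1 := by rw [hδ]; linarith
  refine ⟨δ * ε / 4, by positivity, fun α hα hαε hT k hk => ?_⟩
  obtain ⟨m₀, hm₀⟩ := exists_disjoint_tiles k hd0
  obtain ⟨m₁, hm₁⟩ := exists_nat_ge (56 * k / (δ * ε))
  set m := m₀ + m₁ + 1 with hm
  have hmpos : 0 < m := by omega
  have hkm : 7 * (k : ℝ) ≤ δ * ε / 8 * m := by
    have h1 : 56 * k / (δ * ε) ≤ (m : ℝ) := hm₁.trans (by exact_mod_cast (by omega))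
    rw [div_le_iff₀ (by positivity)] at h1
    linarith
  obtain ⟨n₀, hn₀⟩ := hT m hmpos
  obtain ⟨n₁, hn₁⟩ := exists_nat_ge (8 * (m + 6 * k) / (δ * ε) + 6 * m / η + 128 / ε + m + 1)
  refine ⟨n₀ + n₁, fun V _ E hV hE hdeg => ?_⟩
  obtain ⟨old, _, g, hgt, hgi, hgc⟩ := hn₀ V E (by omega) hE hdeg
  obtain ⟨I, _, ix, c, hix, hc, hcg, hrN, hcov⟩ := exists_partition hmpos hgi
  set n : ℝ := (Fintype.card V : ℝ) with hn
  have hnn : (n₁ : ℝ) ≤ n := by rw [hn]; exact_mod_cast (by omega)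
  have hmR : (0 : ℝ) < m := by exact_mod_cast hmpos
  have p1 : 0 ≤ 8 * (m + 6 * k) / (δ * ε) := by positivity
  have p2 : 0 ≤ 6 * m / η := by positivity
  have p3 : 0 ≤ 128 / ε := by positivity
  have q1 : 8 * (m + 6 * k) ≤ n * (δ * ε) := by
    rw [← div_le_iff₀ (by positivity)]; linarith
  have q2 : 6 * m ≤ n * η := by
    rw [← div_le_iff₀ (by positivity)]; linarith
  set r : ℝ := (Fintype.card old : ℝ) with hr
  set N : ℝ := (Fintype.card I : ℝ) with hNdef
  set M : ℝ := N * m with hM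
  have hcW : Fintype.card (I × Fin m) = M := by
    rw [Fintype.card_prod, Fintype.card_fin, hM, hNdef]; push_cast; rfl
  have hMn : M ≤ n := by
    rw [← hcW, hn]; exact_mod_cast Fintype.card_le_of_injective c hc
  have hM1 : n - m ≤ M := hcov
  have hMpos : 0 < M := by linarith
  have hM64 : 64 / (ε / 2) ≤ M := by
    have : 64 / (ε / 2) = 128 / ε := by field_simp; norm_num
    rw [this]; linarith
  have hn0 : 0 < n := by linarith
  have : Nonempty (I × Fin m) := by
    rw [← Fintype.card_pos_iff]
    have : (0 : ℝ) < Fintype.card (I × Fin m) := by rw [hcW]; exact hMpos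
    exact_mod_cast this
  have hdeg' : ∀ x y : I × Fin m, x ≠ y → (91 / 216 + η / 2) * M ^ 3 ≤
      cnt (fun t : (I × Fin m) × (I × Fin m) × (I × Fin m) =>
        E (c t.1) (c t.2.1) (c t.2.2) (c x) (c y)) := by
    intro x y hxy
    have h1 := hdeg (c x) (c y) (hc.ne hxy)
    have h2 := cnt_triples_le_comp hc (fun t => E t.1 t.2.1 t.2.2 (c x) (c y))
    rw [hcW, ← hn] at h2
    rw [← hn] at h1
    have h3 : M ^ 3 ≤ n ^ 3 := by gcongr
    have h4 : 3 * (n - M) * n ^ 2 ≤ 3 * m * n ^ 2 := by gcongr; linarith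
    have h5 : 6 * m * n ^ 2 ≤ n * η * n ^ 2 := by gcongr
    have h6 : (91 / 216 + η / 2) * M ^ 3 ≤ (91 / 216 + η / 2) * n ^ 3 := by gcongr
    nlinarith
  obtain ⟨ι, _, τ, w, hτ, hι, hw0, hw1, hwl⟩ := exists_fractional_tiling_of_dense
    (I := I) (F := Fin m) (ε := ε / 2) (η := η / 2) (by positivity) (by linarith) (by positivity)
    (M := M) (by rw [hM, Fintype.card_fin]) hM64
    (E := fun a b c' d' e => E (c a) (c b) (c c') (c d') (c e)) hdeg'
  have hkR : (0 : ℝ) < k := by exact_mod_cast hk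
  have hNpos : 0 < N := by
    by_contra h
    have : M ≤ 0 := mul_nonpos_of_nonpos_of_nonneg (not_lt.1 h) hmR.le
    linarith
  set B : ℝ := N * δ * m / (6 * (1 + ε / 2) * k) with hB
  have hB0 : 0 < B := by positivity
  set kx : ι → ℕ := fun x => ⌊w x * B⌋₊ with hkx
  have hkx1 : ∀ x, (kx x : ℝ) ≤ w x * B := fun x => Nat.floor_le (mul_nonneg (hw0 x) hB0.le)
  have hkx2 : ∀ x, w x * B - 1 ≤ kx x := fun x => by
    have := Nat.lt_floor_add_one (w x * B)
    simp only [hkx]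
    linarith
  set κ := (x : ι) × Fin (kx x) with hκ
  obtain ⟨gn, hgn1, hgn2, hgn3⟩ := hm₀ I (Fin m) κ
    (fun a b c' d' e => E (c a) (c b) (c c') (c d') (c e)) (fun y => τ y.1)
    (by rw [Fintype.card_fin]; omega)
    (fun a b c' d' e h => List.Nodup.of_map c (by simpa using hE _ _ _ _ _ h))
    (fun y => hτ y.1) (fun i => by
      rw [Fintype.sum_sigma, Fintype.card_fin]
      simp only [Finset.sum_const, Finset.card_univ, Fintype.card_fin, nsmul_eq_mul]
      calc ∑ x, (kx x : ℝ) * (k * load (τ x) i) ≤ ∑ x, (w x * B) * (k * load (τ x) i) :=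
            Finset.sum_le_sum fun x _ => mul_le_mul_of_nonneg_right (hkx1 x)
              (mul_nonneg hkR.le (load_nonneg _ _))
        _ = B * k * ∑ x, w x * load (τ x) i := by
            rw [Finset.mul_sum]; exact Finset.sum_congr rfl fun x _ => by ring
        _ ≤ B * k * (6 * (1 + ε / 2) / N) := by gcongr; exact hwl i
        _ = d / 20 * m := by rw [hB]; field_simp; rw [hδ]; ring)
  rw [Fintype.card_fin] at hgn3
  set q := ⌊(1 - δ) * m / k⌋₊ with hq
  have hq1 : (q * k : ℝ) ≤ m - δ * m := by
    have : (q : ℝ) ≤ (1 - δ) * m / k := Nat.floor_le (by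
      have : 0 ≤ 1 - δ := by linarith
      positivity)
    rw [le_div_iff₀ hkR] at this
    linarith
  have hq2 : (1 - δ) * m - k ≤ q * k := by
    have := Nat.lt_floor_add_one ((1 - δ) * m / k)
    rw [div_lt_iff₀ hkR] at this
    rw [hq]
    linarith
  obtain ⟨h, hh1, hh2, hh3⟩ := exists_subtiles (V := V) (I := I) (old := old) (m := m) (k := k)
    (q := q) (c := c) (E := E) (ix := ix) hix
    (fun x => by simpa only [hcg] using hgt x)
    (U := fun p => ∃ y s b, gn y s b = p) (r := δ * m) hgn3 hq1
  refine ⟨κ ⊕ (old × Fin q), inferInstance, fun z s a => c (Sum.elim gn h z s a), ?_, ?_, ?_⟩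
  · rintro (y | y)
    · exact hgn1 y
    · exact hh1 y
  · rintro ⟨y | y, s, a⟩ ⟨y' | y', s', a'⟩ he
    · have := @hgn2 (y, s, a) (y', s', a') (hc he)
      simp only [Prod.mk.injEq] at this
      obtain ⟨rfl, rfl, rfl⟩ := this
      rfl
    · exact absurd ⟨y, s, a, hc he⟩ (hh3 y' s' a')
    · exact absurd ⟨y', s', a', (hc he).symm⟩ (hh3 y s a)
    · have := @hh2 (y, s, a) (y', s', a') (hc he)
      simp only [Prod.mk.injEq] at this
      obtain ⟨rfl, rfl, rfl⟩ := this
      rfl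
  · rw [← hn, Fintype.card_sum, Fintype.card_prod, Fintype.card_fin]
    have hκc : B - (N + 1) ≤ (Fintype.card κ : ℝ) := by
      simp only [κ, Fintype.card_sigma, Fintype.card_fin]
      push_cast
      calc B - (N + 1) ≤ B - Fintype.card ι := by
            have : (Fintype.card ι : ℝ) ≤ N + 1 := by rw [hNdef]; exact_mod_cast hι
            linarith
        _ = ∑ x, (w x * B - 1) := by
            rw [Finset.sum_sub_distrib, ← Finset.sum_mul, hw1]; simp
        _ ≤ _ := Finset.sum_le_sum fun x _ => hkx2 x
    push_cast
    rw [← hr]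
    exact coverage_ineq hδ0 hδ1 hε hε1 hmR hn0 hNpos.le hM1 hMn hκc hq2 hrN hgc
      hαε q1 hkm hkR (by positivity)

theorem tilingBound {η ε : ℝ} (hη : 0 < η) (hη1 : η ≤ 1) (hε : 0 < ε) (hε1 : ε ≤ 1) :
    TilingBound η (1 - ε) := by
  obtain ⟨γ, hγ, hstep⟩ := tilingBound_step hη hη1 hε hε1
  have key : ∀ j : ℕ, TilingBound η (min (j * γ) (1 - ε)) := by
    intro j
    induction j with
    | zero =>
      refine tilingBound_mono ?_ (tilingBound_zero η)
      simp
    | succ j ih =>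
      refine tilingBound_mono ?_ (hstep _ ?_ (min_le_right _ _) ih)
      · push_cast
        rcases le_total (j * γ : ℝ) (1 - ε) with h | h
        · rw [min_eq_left h]; exact (min_le_left _ _).trans (by linarith)
        · rw [min_eq_right h]; exact (min_le_right _ _).trans (by linarith)
      · exact le_min (by positivity) (by linarith)
  obtain ⟨j, hj⟩ := exists_nat_ge ((1 - ε) / γ)
  have := key j
  rwa [min_eq_right ((div_le_iff₀ hγ).1 hj)] at this

end Tiling

section Walks

variable {V : Type}

/-- A walk from the ordered pair `p`: every step consumes a vertex and moves to a new pair. -/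
def Wk (E : V → V → V → V → V → Prop) : V × V → List (V × V × V) → Prop
  | _, [] => True
  | p, t :: l => E p.1 p.2 t.1 t.2.1 t.2.2 ∧ Wk E t.2 l

/-- The pair at which a walk ends. -/
def fin : V × V → List (V × V × V) → V × V
  | p, [] => p
  | _, t :: l => fin t.2 l

/-- The vertices of a walk other than those of its starting pair. -/
def verts : List (V × V × V) → Multiset V
  | [] => 0
  | t :: l => {t.1, t.2.1, t.2.2} + verts l

/-- The vertices of a pair. -/
def pv (p : V × V) : Multiset V := {p.1, p.2}

variable {E : V → V → V → V → V → Prop}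

theorem wk_append {p : V × V} {l l' : List (V × V × V)} (h : Wk E p l) (h' : Wk E (fin p l) l') :
    Wk E p (l ++ l') := by
  induction l generalizing p with
  | nil => exact h'
  | cons t l ih => exact ⟨h.1, ih h.2 h'⟩

theorem fin_append (p : V × V) (l l' : List (V × V × V)) : fin p (l ++ l') = fin (fin p l) l' := by
  induction l generalizing p with
  | nil => rfl
  | cons t l ih => exact ih _

theorem verts_append (l l' : List (V × V × V)) : verts (l ++ l') = verts l + verts l' := by
  induction l with
  | nil => simp [verts]
  | cons t l ih => simp only [List.cons_append, verts, ih, add_assoc]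

theorem card_verts (l : List (V × V × V)) : (verts l).card = 3 * l.length := by
  induction l with
  | nil => rfl
  | cons t l ih =>
    simp only [verts, Multiset.card_add, ih, List.length_cons, Multiset.insert_eq_cons,
      Multiset.card_cons, Multiset.card_singleton]
    ring

/-- The walk through a connector `(x, y, z, w)` from `q` to `p` exists. -/
def Conn (E : V → V → V → V → V → Prop) (q p : V × V) (t : V × V × V × V) : Prop :=
  E q.1 q.2 t.1 t.2.1 t.2.2.1 ∧ E t.2.1 t.2.2.1 t.2.2.2 p.1 p.2

theorem exists_link [DecidableEq V] {ι : Type} {R : Finset V} {cap : ℕ} {p : V × V}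
    (hp : p.1 ≠ p.2) {st en : ι → V × V} (hst : ∀ i, (st i).1 ≠ (st i).2)
    (hen : ∀ i, (en i).1 ≠ (en i).2)
    (avail : ∀ (q p : V × V) (X : Finset V), q.1 ≠ q.2 → p.1 ≠ p.2 → X.card ≤ cap →
      ∃ x y z w, Conn E q p (x, y, z, w) ∧ [x, y, z, w].Nodup ∧
        ∀ v ∈ ({x, y, z, w} : Finset V), v ∈ R ∧ v ∉ X)
    (L : List ι) {q : V × V} (hq : q.1 ≠ q.2) {X : Finset V}
    (hX : X.card + 4 * L.length ≤ cap) :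
    ∃ Y : Finset V, (∀ v ∈ Y, v ∈ R ∧ v ∉ X) ∧ Y.card = 4 * (L.length + 1) ∧
      ∀ alt : ι → List (V × V × V), (∀ i ∈ L, Wk E (st i) (alt i) ∧ fin (st i) (alt i) = en i) →
        ∃ l, Wk E q l ∧ fin q l = p ∧
          verts l = Y.val + pv p + (L.map fun i => pv (st i) + verts (alt i)).sum := by
  induction L generalizing q X with
  | nil =>
    obtain ⟨x, y, z, w, hc, hn, hR⟩ := avail q p X hq hp (by simpa using hX)
    refine ⟨⟨↑[x, y, z, w], hn⟩, fun v hv => hR v (by simpa using show v ∈ [x, y, z, w] from hv), rfl,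
      fun alt _ => ?_⟩
    refine ⟨[(x, y, z), (w, p.1, p.2)], ⟨hc.1, hc.2, trivial⟩, rfl, ?_⟩
    simp only [verts, pv, List.map_nil, List.sum_nil, add_zero]
    rfl
  | cons i L ih =>
    simp only [List.length_cons] at hX
    obtain ⟨x, y, z, w, hc, hn, hR⟩ := avail q (st i) X hq (hst i) (by omega)
    set Z : Finset V := ⟨↑[x, y, z, w], hn⟩ with hZ
    have hZR : ∀ v ∈ Z, v ∈ R ∧ v ∉ X := fun v hv =>
      hR v (by simpa using show v ∈ [x, y, z, w] from hv)
    have hXZ : (X ∪ Z).card + 4 * L.length ≤ cap := by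
      have := card_union_le X Z
      have h4 : Z.card = 4 := rfl
      omega
    obtain ⟨Y, hY1, hY2, hY3⟩ := ih (hen i) hXZ
    have hdis : Disjoint Z Y := Finset.disjoint_left.2 fun v hv hv' =>
      (hY1 v hv').2 (mem_union_right _ hv)
    refine ⟨Z.disjUnion Y hdis, ?_, ?_, ?_⟩
    · intro v hv
      rcases mem_disjUnion.1 hv with h | h
      · exact hZR v h
      · exact ⟨(hY1 v h).1, fun h' => (hY1 v h).2 (mem_union_left _ h')⟩
    · rw [card_disjUnion, hY2, List.length_cons]
      have h4 : Z.card = 4 := rfl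
      omega
    · intro alt halt
      obtain ⟨l, hl1, hl2, hl3⟩ := hY3 alt fun j hj => halt j (List.mem_cons_of_mem _ hj)
      obtain ⟨ha1, ha2⟩ := halt i List.mem_cons_self
      refine ⟨[(x, y, z), (w, (st i).1, (st i).2)] ++ (alt i ++ l), ?_, ?_, ?_⟩
      · refine ⟨hc.1, hc.2, ?_⟩
        change Wk E (st i) (alt i ++ l)
        exact wk_append ha1 (by rwa [ha2])
      · simp only [fin_append]
        change fin (fin (st i) (alt i)) l = p
        rw [ha2, hl2]
      · simp only [verts_append, hl3, List.map_cons, List.sum_cons]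
        have : verts [(x, y, z), (w, (st i).1, (st i).2)] = Z.val + pv (st i) := by
          simp only [verts, pv, add_zero]
          rfl
        rw [this]
        change _ = Z.val + Y.val + _ + _
        abel

/-- Tiles contain walks missing only four vertices. -/
theorem exists_walk_of_tile (hsym : ∀ a b c d e, E a b c d e → E a b e c d)
    (hsym' : ∀ a b c d e, E a b c d e → E c d e a b) (m : ℕ) (g : Fin 6 → Fin (m + 1) → V)
    (hg : IsTile E g) :
    ∃ (l : List (V × V × V)) (Z : Multiset V) (a b : Fin (m + 1)), Wk E (g 0 0, g 1 0) l ∧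
      fin (g 0 0, g 1 0) l = (g 0 a, g 1 b) ∧ Z.card = 4 ∧
      pv (g 0 0, g 1 0) + verts l + Z = ∑ a, ∑ s, {g s a} := by
  induction m with
  | zero =>
    refine ⟨[], {g 2 0, g 3 0, g 4 0, g 5 0}, 0, 0, trivial, rfl, rfl, ?_⟩
    simp only [Fin.sum_univ_six, pv, verts]
    rfl
  | succ m ih =>
    obtain ⟨l, Z, a, b, h1, h2, h3, h4⟩ := ih (fun s a => g s a.succ) fun a b c d e => hg _ _ _ _ _
    refine ⟨(g 4 0, g 2 0, g 3 0) :: (g 5 0, g 0 1, g 1 1) :: l, Z, a.succ, b.succ,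
      ⟨hsym _ _ _ _ _ (hg _ _ _ _ _).1, hsym' _ _ _ _ _ (hg _ _ _ _ _).2, h1⟩, h2, h3, ?_⟩
    rw [Fin.sum_univ_succ, ← h4, Fin.sum_univ_six]
    simp only [verts, pv, Multiset.insert_eq_cons, ← Multiset.singleton_add]
    simp only [Fin.succ_zero_eq_one]
    abel

theorem wk_chain {p : V × V} {l : List (V × V × V)} (h : Wk E p l) (t : ℕ → V × V × V)
    (ht : ∀ j, ∀ hj : j < l.length, t j = l[j]) :
    (0 < l.length → E p.1 p.2 (t 0).1 (t 0).2.1 (t 0).2.2) ∧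
    (∀ j, j + 1 < l.length → E (t j).2.1 (t j).2.2 (t (j + 1)).1 (t (j + 1)).2.1 (t (j + 1)).2.2) ∧
    (∀ j, j + 1 = l.length → (t j).2 = fin p l) := by
  induction l generalizing p t with
  | nil => simp
  | cons a l ih =>
    obtain ⟨h1, h2, h3⟩ := ih h.2 (fun j => t (j + 1)) fun j hj => by
      rw [ht (j + 1) (by simpa using hj)]; rfl
    have h0 : t 0 = a := ht 0 (by simp)
    refine ⟨fun _ => h0 ▸ h.1, fun j hj => ?_, fun j hj => ?_⟩
    · rcases j with _ | j
      · have := h1 (by simpa using hj)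
        rw [h0]; exact this
      · exact h2 j (by simpa using hj)
    · rcases j with _ | j
      · have : l = [] := List.length_eq_zero_iff.1 (by simpa using hj.symm)
        subst this
        rw [h0]; rfl
      · exact h3 j (by simpa using hj)

theorem mem_verts {l : List (V × V × V)} {v : V} (h : v ∈ verts l) :
    ∃ j, ∃ hj : j < l.length, v = l[j].1 ∨ v = l[j].2.1 ∨ v = l[j].2.2 := by
  induction l with
  | nil => simp [verts] at h
  | cons a l ih =>
    simp only [verts, Multiset.mem_add, Multiset.insert_eq_cons, Multiset.mem_cons,
      Multiset.mem_singleton] at h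
    rcases h with h | h
    · exact ⟨0, by simp, h⟩
    · obtain ⟨j, hj, h⟩ := ih h
      exact ⟨j + 1, by simpa using hj, h⟩

end Walks

section Hamilton

/-- The edge relation of a 5-graph. -/
def Ed {V : Type} [DecidableEq V] (H : Finset (Finset V)) (a b c d e : V) : Prop :=
  ({a, b, c, d, e} : Finset V) ∈ H

/-- A spanning closed walk is a Hamilton cycle. -/
theorem hasHamiltonCycle_of_wk {n : ℕ} (hn : 0 < n) {H : Finset (Finset (Fin n))}
    {p : Fin n × Fin n}
    {l : List (Fin n × Fin n × Fin n)} (hl : Wk (Ed H) p l) (hfin : fin p l = p)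
    (hv : verts l = (univ : Finset (Fin n)).val) : HasHamiltonCycle n 5 2 H := by
  have hlen : 3 * l.length = n := by
    rw [← card_verts, hv]; simp
  set N := l.length with hN
  have hN0 : 0 < N := by omega
  have : NeZero n := ⟨hn.ne'⟩
  set t : ℕ → Fin n × Fin n × Fin n := fun j => l[j % N]'(Nat.mod_lt _ hN0) with ht
  have htj : ∀ j, ∀ hj : j < N, t j = l[j] := fun j hj => by
    simp only [ht, Nat.mod_eq_of_lt hj]
  obtain ⟨h1, h2, h3⟩ := wk_chain hl t htj
  have hper : ∀ j, t (j + N) = t j := fun j => by simp only [ht, Nat.add_mod_right]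
  have hE : ∀ j, Ed H (t j).2.1 (t j).2.2 (t (j + 1)).1 (t (j + 1)).2.1 (t (j + 1)).2.2 := by
    intro j
    have hmod : t j = t (j % N) := by simp only [ht, Nat.mod_mod]
    have hmod' : t (j + 1) = t (j % N + 1) := by simp only [ht, Nat.mod_add_mod]
    rw [hmod, hmod']
    have hlt := Nat.mod_lt j hN0
    by_cases hj : j % N + 1 < N
    · exact h2 _ hj
    · have he : j % N + 1 = N := by omega
      rw [h3 _ he, hfin, he]
      have : t N = t 0 := by simpa using hper 0
      rw [this]
      exact h1 hN0
  set g : ℕ → Fin n := fun i => if i % 3 = 0 then (t (i / 3)).1 else if i % 3 = 1 then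
    (t (i / 3)).2.1 else (t (i / 3)).2.2 with hg
  have g0 : ∀ j, g (3 * j) = (t j).1 := fun j => by
    have e1 : 3 * j % 3 = 0 := by omega
    have e2 : 3 * j / 3 = j := by omega
    simp only [hg, e1, e2, if_true]
  have g1 : ∀ j, g (3 * j + 1) = (t j).2.1 := fun j => by
    have e1 : (3 * j + 1) % 3 = 1 := by omega
    have e2 : (3 * j + 1) / 3 = j := by omega
    simp only [hg, e1, e2, one_ne_zero, if_true, if_false]
  have g2 : ∀ j, g (3 * j + 2) = (t j).2.2 := fun j => by
    have e1 : (3 * j + 2) % 3 = 2 := by omega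
    have e2 : (3 * j + 2) / 3 = j := by omega
    simp only [hg, e1, e2]
    simp
  have gper : ∀ i, g (i + n) = g i := fun i => by
    have e1 : (i + n) % 3 = i % 3 := by omega
    have e2 : (i + n) / 3 = i / 3 + N := by omega
    simp only [hg, e1, e2, hper]
  have gmod : ∀ i, g (i % n + 1) = g (i + 1) := fun i => by
    conv_rhs => rw [← Nat.mod_add_div i n]
    generalize i / n = k
    induction k with
    | zero => simp
    | succ k ih =>
      rw [ih, Nat.mul_succ, show i % n + (n * k + n) + 1 = i % n + n * k + 1 + n by ring, gper]
  have hfv : ∀ i : ℕ, g ((i : ZMod n).val + 1) = g (i + 1) := fun i => by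
    rw [ZMod.val_natCast, gmod]
  refine ⟨fun x => g (x.val + 1), ?_, ?_⟩
  · have hsurj : Function.Surjective fun x : ZMod n => g (x.val + 1) := by
      have key : ∀ i, ∃ x : ZMod n, g (x.val + 1) = g i := fun i => by
        refine ⟨((i + n - 1 : ℕ) : ZMod n), ?_⟩
        rw [hfv, ← gper i]
        congr 1
        omega
      intro v
      have hvm : v ∈ verts l := by rw [hv]; simp
      obtain ⟨j, hj, h⟩ := mem_verts hvm
      rw [← htj j hj] at h
      rcases h with h | h | h
      · rw [h, ← g0]; exact key _
      · rw [h, ← g1]; exact key _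
      · rw [h, ← g2]; exact key _
    exact (Fintype.bijective_iff_surjective_and_card _).2 ⟨hsurj, by simp [ZMod.card]⟩
  · intro j _
    have h := hE j
    rw [Ed] at h
    convert h using 1
    simp only [Nat.reduceSub, hfv]
    rw [← g1 j, ← g2 j, ← g0 (j + 1), ← g1 (j + 1), ← g2 (j + 1)]
    simp only [Finset.range_add_one, Finset.range_zero, image_insert, image_empty]
    ext v
    simp only [mem_insert, mem_singleton, notMem_empty, or_false]
    ring_nf
    tauto

end Hamilton

section Symmetry

variable {V : Type} [DecidableEq V] {H : Finset (Finset V)} {a b c d e : V}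

theorem Ed.congr {a' b' c' d' e' : V} (h : Ed H a b c d e)
    (hs : ({a', b', c', d', e'} : Finset V) = {a, b, c, d, e}) : Ed H a' b' c' d' e' := by
  rw [Ed, hs]; exact h

theorem Ed.swap₁₂ (h : Ed H a b c d e) : Ed H b a c d e := h.congr (by ext; simp; tauto)
theorem Ed.swap₂₃ (h : Ed H a b c d e) : Ed H a c b d e := h.congr (by ext; simp; tauto)
theorem Ed.swap₃₄ (h : Ed H a b c d e) : Ed H a b d c e := h.congr (by ext; simp; tauto)
theorem Ed.swap₄₅ (h : Ed H a b c d e) : Ed H a b c e d := h.congr (by ext; simp; tauto)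
theorem Ed.rotate (h : Ed H a b c d e) : Ed H b c d e a := h.congr (by ext; simp; tauto)

theorem distinct_ed (hH : ∀ e ∈ H, e.card = 5) : Distinct (Ed H) := by
  intro a b c d e h
  have h5 := hH _ h
  have : [a, b, c, d, e].toFinset = {a, b, c, d, e} := by
    ext; simp
  rw [← this] at h5
  rw [← Multiset.coe_nodup, ← Multiset.toFinset_card_eq_card_iff_nodup]
  simpa using h5

end Symmetry

section Triples

variable {V : Type} [Fintype V]

/-- A relation on triples that does not depend on the order. -/
def Symm₃ (Q : V → V → V → Prop) : Prop :=
  (∀ x y z, Q x y z → Q y x z) ∧ ∀ x y z, Q x y z → Q x z y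

theorem cnt_triangle_sq_le (A B C : V → V → Prop) :
    cnt (fun t : (V × V) × V => A t.1.1 t.1.2 ∧ B t.1.1 t.2 ∧ C t.1.2 t.2) ^ 2 ≤
      cnt (fun t : V × V => A t.1 t.2) * (cnt (fun t : V × V => B t.1 t.2) *
        cnt (fun t : V × V => C t.1 t.2)) := by
  classical
  rw [cnt_prod]
  have h1 : ∀ p : V × V, cnt (fun z => A p.1 p.2 ∧ B p.1 z ∧ C p.2 z) =
      (if A p.1 p.2 then (1 : ℝ) else 0) * cnt (fun z => B p.1 z ∧ C p.2 z) := by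
    intro p
    split_ifs with h
    · rw [one_mul]
      exact le_antisymm (cnt_mono fun _ hz => hz.2) (cnt_mono fun _ hz => ⟨h, hz⟩)
    · simp only [cnt, h, false_and, if_false, zero_mul, Finset.sum_const_zero]
  simp only [h1]
  refine (Finset.sum_mul_sq_le_sq_mul_sq _ _ _).trans ?_
  refine mul_le_mul (le_of_eq ?_) ?_ (Finset.sum_nonneg fun _ _ => sq_nonneg _) (cnt_nonneg _)
  · simp only [cnt]
    exact Finset.sum_congr rfl fun p _ => by split_ifs <;> norm_num
  · rw [cnt_prod, cnt_prod, Finset.sum_mul_sum, Fintype.sum_prod_type]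
    refine Finset.sum_le_sum fun x _ => Finset.sum_le_sum fun y _ => ?_
    rw [sq]
    exact mul_le_mul (cnt_mono fun _ h => h.1) (cnt_mono fun _ h => h.2) (cnt_nonneg _)
      (cnt_nonneg _)

/-- Triples with a sparse pair are rare. -/
theorem cnt_sparse_pair_le (Q : V → V → V → Prop) {θ : ℝ} (hθ : 0 ≤ θ) :
    cnt (fun t : (V × V) × V => Q t.1.1 t.1.2 t.2 ∧
      ¬ θ * Fintype.card V ≤ cnt (fun z => Q t.1.1 t.1.2 z)) ≤ θ * (Fintype.card V : ℝ) ^ 3 := by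
  refine (cnt_prod_le (A := fun p : V × V => ¬ θ * Fintype.card V ≤ cnt (fun z => Q p.1 p.2 z))
    (q := θ * Fintype.card V) (fun _ h => h.2) fun p hp => ?_).trans ?_
  · exact (cnt_mono fun _ h => h.1).trans (not_le.1 hp).le
  · have := cnt_le_card (fun p : V × V => ¬ θ * Fintype.card V ≤ cnt (fun z => Q p.1 p.2 z))
    rw [Fintype.card_prod, Nat.cast_mul] at this
    calc _ ≤ ((Fintype.card V : ℝ) * Fintype.card V) * (θ * Fintype.card V) := by gcongr
      _ = _ := by ring

/-- Triples with a sparse vertex are rare. -/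
theorem cnt_sparse_vertex_le (Q : V → V → V → Prop) {θ : ℝ} (hθ : 0 ≤ θ) :
    cnt (fun t : V × V × V => Q t.1 t.2.1 t.2.2 ∧
      ¬ θ * (Fintype.card V : ℝ) ^ 2 ≤ cnt (fun s : V × V => Q t.1 s.1 s.2)) ≤
        θ * (Fintype.card V : ℝ) ^ 3 := by
  refine (cnt_prod_le (A := fun x : V => ¬ θ * (Fintype.card V : ℝ) ^ 2 ≤
    cnt (fun s : V × V => Q x s.1 s.2))
    (q := θ * (Fintype.card V : ℝ) ^ 2) (fun _ h => h.2) fun p hp => ?_).trans ?_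
  · exact (cnt_mono fun _ h => h.1).trans (not_le.1 hp).le
  · calc _ ≤ (Fintype.card V : ℝ) * (θ * (Fintype.card V : ℝ) ^ 2) := by
          gcongr; exact cnt_le_card _
      _ = _ := by ring

/-- A dense symmetric relation on triples has more than half of the pairs well covered. -/
theorem cnt_pairs_ge {Q : V → V → V → Prop} (hQ : Symm₃ Q) (hV : 0 < Fintype.card V)
    (h : 2 / 5 * (Fintype.card V : ℝ) ^ 3 ≤ cnt (fun t : V × V × V => Q t.1 t.2.1 t.2.2)) :
    103 / 200 * (Fintype.card V : ℝ) ^ 2 ≤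
      cnt (fun p : V × V => 1 / 100 * Fintype.card V ≤ cnt (fun z => Q p.1 p.2 z)) := by
  classical
  set n : ℝ := (Fintype.card V : ℝ) with hn
  have hn0 : 0 < n := by rw [hn]; exact_mod_cast hV
  set G : V → V → Prop := fun x y => 1 / 100 * n ≤ cnt (fun z => Q x y z) with hG
  set T : (V × V) × V → Prop := fun t => G t.1.1 t.1.2 ∧ G t.1.1 t.2 ∧ G t.1.2 t.2 with hT
  set B : (V × V) × V → Prop := fun t => Q t.1.1 t.1.2 t.2 ∧ ¬ G t.1.1 t.1.2 with hB
  have hBc : cnt B ≤ 1 / 100 * n ^ 3 := cnt_sparse_pair_le Q (by norm_num)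
  have h1 : 2 / 5 * n ^ 3 ≤ cnt (fun t : (V × V) × V => Q t.1.1 t.1.2 t.2) := by
    rw [← cnt_equiv (Equiv.prodAssoc V V V)] at h
    exact h
  have h2 : cnt (fun t : (V × V) × V => Q t.1.1 t.1.2 t.2) ≤ cnt T + (cnt B + (cnt B + cnt B)) := by
    have b1 : cnt (fun t : (V × V) × V => B ((t.1.1, t.2), t.1.2)) ≤ cnt B :=
      cnt_le_of_injOn (fun t => ((t.1.1, t.2), t.1.2)) (fun _ h => h)
        (fun a b _ _ h => by simp only [Prod.mk.injEq] at h; ext <;> tauto)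
    have b2 : cnt (fun t : (V × V) × V => B ((t.1.2, t.2), t.1.1)) ≤ cnt B :=
      cnt_le_of_injOn (fun t => ((t.1.2, t.2), t.1.1)) (fun _ h => h)
        (fun a b _ _ h => by simp only [Prod.mk.injEq] at h; ext <;> tauto)
    refine (cnt_le_add (Q := T) (R := fun t => B t ∨ (B ((t.1.1, t.2), t.1.2) ∨
      B ((t.1.2, t.2), t.1.1))) fun t ht => ?_).trans ?_
    · have e1 := hQ.2 _ _ _ ht
      have e2 := hQ.2 _ _ _ (hQ.1 _ _ _ ht)
      simp only [hT, hB]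
      tauto
    · gcongr
      refine (cnt_le_add (Q := B) (R := fun t => B ((t.1.1, t.2), t.1.2) ∨
        B ((t.1.2, t.2), t.1.1)) fun t ht => ht).trans ?_
      gcongr
      exact (cnt_le_add fun t ht => ht).trans (add_le_add b1 b2)
  have h3 : 37 / 100 * n ^ 3 ≤ cnt T := by linarith
  have h4 := cnt_triangle_sq_le G G G
  set g := cnt (fun t : V × V => G t.1 t.2) with hg
  change 103 / 200 * n ^ 2 ≤ g
  have h5 : (37 / 100 * n ^ 3) ^ 2 ≤ g * (g * g) := le_trans (by gcongr) h4
  by_contra hc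
  push Not at hc
  have hg0 : 0 ≤ g := cnt_nonneg _
  have h6 : g ^ 3 < (103 / 200 * n ^ 2) ^ 3 := by gcongr
  have h7 : 0 < n ^ 6 := by positivity
  nlinarith

/-- A dense symmetric relation on triples has more than half of the vertices well covered. -/
theorem cnt_vertices_ge {Q : V → V → V → Prop} (hQ : Symm₃ Q) (hV : 0 < Fintype.card V)
    (h : 2 / 5 * (Fintype.card V : ℝ) ^ 3 ≤ cnt (fun t : V × V × V => Q t.1 t.2.1 t.2.2)) :
    3 / 5 * (Fintype.card V : ℝ) ≤
      cnt (fun x => 1 / 100 * (Fintype.card V : ℝ) ^ 2 ≤ cnt (fun s : V × V => Q x s.1 s.2)) := by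
  classical
  set n : ℝ := (Fintype.card V : ℝ) with hn
  have hn0 : 0 < n := by rw [hn]; exact_mod_cast hV
  set G : V → Prop := fun x => 1 / 100 * n ^ 2 ≤ cnt (fun s : V × V => Q x s.1 s.2) with hG
  set T : V × V × V → Prop := fun t => G t.1 ∧ G t.2.1 ∧ G t.2.2 with hT
  set B : V × V × V → Prop := fun t => Q t.1 t.2.1 t.2.2 ∧ ¬ G t.1 with hB
  have hBc : cnt B ≤ 1 / 100 * n ^ 3 := cnt_sparse_vertex_le Q (by norm_num)
  have h2 : cnt (fun t : V × V × V => Q t.1 t.2.1 t.2.2) ≤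
      cnt T + (cnt B + (cnt B + cnt B)) := by
    have b1 : cnt (fun t : V × V × V => B (t.2.1, t.1, t.2.2)) ≤ cnt B :=
      cnt_le_of_injOn (fun t => (t.2.1, t.1, t.2.2)) (fun _ h => h)
        (fun a b _ _ h => by simp only [Prod.mk.injEq] at h; ext <;> tauto)
    have b2 : cnt (fun t : V × V × V => B (t.2.2, t.1, t.2.1)) ≤ cnt B :=
      cnt_le_of_injOn (fun t => (t.2.2, t.1, t.2.1)) (fun _ h => h)
        (fun a b _ _ h => by simp only [Prod.mk.injEq] at h; ext <;> tauto)
    refine (cnt_le_add (Q := T) (R := fun t => B t ∨ (B (t.2.1, t.1, t.2.2) ∨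
      B (t.2.2, t.1, t.2.1))) fun t ht => ?_).trans ?_
    · have e1 := hQ.1 _ _ _ ht
      have e2 := hQ.1 _ _ _ (hQ.2 _ _ _ ht)
      simp only [hT, hB]
      tauto
    · gcongr
      refine (cnt_le_add (Q := B) (R := fun t => B (t.2.1, t.1, t.2.2) ∨
        B (t.2.2, t.1, t.2.1)) fun t ht => ht).trans ?_
      gcongr
      exact (cnt_le_add fun t ht => ht).trans (add_le_add b1 b2)
  have h3 : 37 / 100 * n ^ 3 ≤ cnt T := by linarith
  set g := cnt G with hg
  have h4 : cnt T = g ^ 3 := by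
    have : cnt T ≤ g * (g * g) := by
      refine cnt_prod_le (fun x hx => hx.1) fun a ha => ?_
      exact (cnt_mono fun b hb => hb.2).trans (cnt_prod_le (A := G) (fun x hx => hx.1)
        fun a ha => cnt_mono fun b hb => hb.2)
    refine le_antisymm (by linarith [show g ^ 3 = g * (g * g) by ring]) ?_
    have hg0 : 0 ≤ g := cnt_nonneg _
    calc g ^ 3 = g * (g * g) := by ring
      _ ≤ cnt T := mul_le_cnt_prod (A := G) (by positivity) le_rfl fun a ha =>
          (mul_le_cnt_prod (A := G) (P := fun s : V × V => G s.1 ∧ G s.2) hg0 le_rfl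
            fun b hb => cnt_mono fun c hc => ⟨hb, hc⟩).trans (cnt_mono fun s hs => ⟨ha, hs⟩)
  by_contra hc
  push Not at hc
  have hg0 : 0 ≤ g := cnt_nonneg _
  have h6 : g ^ 3 < (3 / 5 * n) ^ 3 := by gcongr
  have h7 : 0 < n ^ 3 := by positivity
  nlinarith

end Triples

section Connecting

theorem symm₃_link {V : Type} [DecidableEq V] (H : Finset (Finset V)) (a b : V) :
    Symm₃ (Ed H a b) :=
  ⟨fun _ _ _ h => h.swap₃₄, fun _ _ _ h => h.swap₄₅⟩

variable {V : Type} [Fintype V] [DecidableEq V] {H : Finset (Finset V)}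

theorem PairDeg.link {κ : ℝ} (h : PairDeg (Ed H) κ) {a b : V} (hab : a ≠ b) :
    κ * (Fintype.card V : ℝ) ^ 3 ≤ cnt (fun t : V × V × V => Ed H a b t.1 t.2.1 t.2.2) :=
  (h a b hab).trans (cnt_mono fun _ ht => ht.rotate.rotate.rotate)

/-- Any two pairs have many connectors. -/
theorem cnt_conn_ge (h : PairDeg (Ed H) (2 / 5)) {q p : V × V} (hq : q.1 ≠ q.2)
    (hp : p.1 ≠ p.2) :
    3 / 1000000 * (Fintype.card V : ℝ) ^ 4 ≤ cnt (fun t : V × V × V × V => Conn (Ed H) q p t) := by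
  classical
  have hV : 0 < Fintype.card V := Fintype.card_pos_iff.2 ⟨q.1⟩
  have h1 := cnt_pairs_ge (symm₃_link H q.1 q.2) hV (h.link hq)
  have h2 := cnt_pairs_ge (symm₃_link H p.1 p.2) hV (h.link hp)
  set n : ℝ := (Fintype.card V : ℝ) with hn
  have h3 := cnt_and_ge (fun s : V × V => 1 / 100 * n ≤ cnt (fun z => Ed H q.1 q.2 s.1 s.2 z))
    (fun s : V × V => 1 / 100 * n ≤ cnt (fun z => Ed H p.1 p.2 s.1 s.2 z))
  rw [Fintype.card_prod, Nat.cast_mul, ← hn] at h3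
  have h4 : 3 / 1000000 * n ^ 4 ≤ cnt (fun t : (V × V) × V × V =>
      Ed H q.1 q.2 t.1.1 t.1.2 t.2.1 ∧ Ed H p.1 p.2 t.1.1 t.1.2 t.2.2) := by
    calc 3 / 1000000 * n ^ 4 = (103 / 200 * n ^ 2 + 103 / 200 * n ^ 2 - n * n) *
          ((1 / 100 * n) * (1 / 100 * n)) := by ring
      _ ≤ _ := by
          refine mul_le_cnt_prod (by positivity) (le_trans (by linarith) h3) fun s hs => ?_
          exact mul_le_cnt_prod (by positivity) hs.1 fun x hx => hs.2.trans
            (cnt_mono fun w hw => ⟨hx, hw⟩)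
  refine h4.trans (cnt_le_of_injOn (fun t => (t.2.1, t.1.1, t.1.2, t.2.2)) ?_ ?_)
  · rintro ⟨⟨y, z⟩, x, w⟩ ⟨h1, h2⟩
    exact ⟨h1.swap₄₅.swap₃₄, h2.rotate.rotate⟩
  · rintro ⟨⟨y, z⟩, x, w⟩ ⟨⟨y', z'⟩, x', w'⟩ - - h
    simp only [Prod.mk.injEq] at h ⊢
    tauto

end Connecting

section Reachability

variable {V : Type} [Fintype V] [DecidableEq V] {H : Finset (Finset V)}

/-- A tuple along which `u` and `v` can be exchanged. -/
def Exch {V : Type} [DecidableEq V] (H : Finset (Finset V)) (u v : V) (f : Fin 7 → V) : Prop :=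
  Ed H (f 0) (f 1) (f 2) (f 3) (f 4) ∧ Ed H (f 3) (f 4) u (f 5) (f 6) ∧
    Ed H (f 3) (f 2) v (f 5) (f 6)

/-- Pairs that are equal or that have few exchanging tuples. -/
def Bad (H : Finset (Finset V)) (β : ℝ) (u v : V) : Prop :=
  u = v ∨ cnt (Exch H u v) < β * (Fintype.card V : ℝ) ^ 7

/-- Edges containing a bad pair are rare. -/
theorem cnt_ed_bad_lt {δ : ℝ} (hδ : 0 < δ) (hV : 0 < Fintype.card V) :
    cnt (fun t : (V × V) × V × V × V => Ed H t.1.1 t.1.2 t.2.1 t.2.2.1 t.2.2.2 ∧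
      cnt (Exch H t.2.1 t.2.2.2) < δ ^ 8 / 2 * (Fintype.card V : ℝ) ^ 7) <
        δ * (Fintype.card V : ℝ) ^ 5 := by
  classical
  set n : ℝ := (Fintype.card V : ℝ) with hn
  have hn0 : 0 < n := by rw [hn]; exact_mod_cast hV
  set Bd : V → V → Prop := fun u v => cnt (Exch H u v) < δ ^ 8 / 2 * n ^ 7 with hBd
  by_contra hc
  push Not at hc
  set P : V × V → V × V × V → Prop := fun p t => Ed H p.1 p.2 t.1 t.2.1 t.2.2 ∧ Bd t.1 t.2.2 with hP
  have h1 := sq_cnt_le_double P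
  set A := cnt (fun x : (V × V) × V × V × V => P x.1 x.2) with hA
  have hA1 : δ * n ^ 5 ≤ A := hc
  set B := cnt (fun x : (V × V) × (V × V) × V × V × V => P x.1 x.2.2 ∧ P x.2.1 x.2.2) with hB
  set P₂ : V → (V × V) × (V × V) × V × V → Prop := fun s r =>
    P r.1 (s, r.2.2) ∧ P r.2.1 (s, r.2.2) with hP₂
  have hB' : B ≤ cnt (fun x : V × (V × V) × (V × V) × V × V => P₂ x.1 x.2) := by
    refine cnt_le_of_injOn (fun x => (x.2.2.1, x.1, x.2.1, x.2.2.2)) (fun _ h => h) ?_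
    rintro ⟨a, b, c, d⟩ ⟨a', b', c', d'⟩ - - h
    simp only [Prod.mk.injEq] at h ⊢
    exact ⟨h.2.1, h.2.2.1, h.1, h.2.2.2⟩
  have h2 := sq_cnt_le_double P₂
  set C := cnt (fun x : V × V × (V × V) × (V × V) × V × V => P₂ x.1 x.2.2 ∧ P₂ x.2.1 x.2.2) with hC
  set P₃ : V → V × V × (V × V) × (V × V) × V → Prop := fun y r =>
    P₂ r.1 (r.2.2.1, r.2.2.2.1, r.2.2.2.2, y) ∧ P₂ r.2.1 (r.2.2.1, r.2.2.2.1, r.2.2.2.2, y) with hP₃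
  have hC' : C ≤ cnt (fun x : V × V × V × (V × V) × (V × V) × V => P₃ x.1 x.2) := by
    refine cnt_le_of_injOn (fun x => (x.2.2.2.2.2, x.1, x.2.1, x.2.2.1, x.2.2.2.1, x.2.2.2.2.1))
      (fun _ h => h) ?_
    rintro ⟨a, b, c, d, e, f⟩ ⟨a', b', c', d', e', f'⟩ - - h
    simp only [Prod.mk.injEq] at h ⊢
    tauto
  have h3 := sq_cnt_le_double P₃
  set D := cnt (fun x : V × V × V × V × (V × V) × (V × V) × V => P₃ x.1 x.2.2 ∧ P₃ x.2.1 x.2.2)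
    with hD
  have hD' : D ≤
      cnt (fun x : (V × V) × (Fin 7 → V) => Bd x.1.1 x.1.2 ∧ Exch H x.1.1 x.1.2 x.2) := by
    refine cnt_le_of_injOn (fun x => ((x.2.2.1, x.1), ![x.2.2.2.2.1.1, x.2.2.2.2.1.2, x.2.2.2.1,
      x.2.2.2.2.2.2, x.2.1, x.2.2.2.2.2.1.1, x.2.2.2.2.2.1.2])) ?_ ?_
    · rintro ⟨y, y', s, s', ⟨a, b⟩, ⟨a', b'⟩, x⟩ ⟨⟨⟨h1, h2⟩, ⟨h3, h4⟩⟩, ⟨⟨h5, h6⟩, ⟨h7, h8⟩⟩⟩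
      exact ⟨h1.2, h7.1, h6.1.rotate.rotate.swap₁₂.swap₂₃, h4.1.rotate.rotate.swap₁₂⟩
    · rintro ⟨y, y', s, s', ⟨a, b⟩, ⟨a', b'⟩, x⟩ ⟨y₁, y₁', s₁, s₁', ⟨a₁, b₁⟩, ⟨a₁', b₁'⟩, x₁⟩ - - h
      simp only [Prod.mk.injEq] at h ⊢
      obtain ⟨⟨e1, e2⟩, hf⟩ := h
      have f0 := congrFun hf 0
      have f1 := congrFun hf 1
      have f2 := congrFun hf 2
      have f3 := congrFun hf 3
      have f4 := congrFun hf 4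
      have f5 := congrFun hf 5
      have f6 := congrFun hf 6
      exact ⟨e2, f4, e1, f2, ⟨f0, f1⟩, ⟨f5, f6⟩, f3⟩
  have h4 : cnt (fun x : (V × V) × (Fin 7 → V) => Bd x.1.1 x.1.2 ∧ Exch H x.1.1 x.1.2 x.2) ≤
      (n * n) * (δ ^ 8 / 2 * n ^ 7) := by
    refine (cnt_prod_le (A := fun p : V × V => Bd p.1 p.2) (q := δ ^ 8 / 2 * n ^ 7)
      (fun _ h => h.1) fun p hp => (cnt_mono fun _ h => h.2).trans hp.le).trans ?_
    have := cnt_le_card (fun p : V × V => Bd p.1 p.2)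
    rw [Fintype.card_prod, Nat.cast_mul, ← hn] at this
    gcongr
  simp only [Fintype.card_prod, Nat.cast_mul] at h1 h2 h3
  rw [← hn] at h1 h2 h3
  have hA0 : 0 ≤ A := cnt_nonneg _
  have hB0 : 0 ≤ B := cnt_nonneg _
  have hC0 : 0 ≤ C := cnt_nonneg _
  have b1 : δ ^ 2 * n ^ 7 ≤ B := by
    have : (δ * n ^ 5) ^ 2 ≤ n ^ 3 * B := by
      calc _ ≤ A ^ 2 := by gcongr
        _ ≤ _ := by linarith [h1]
    have h' : n ^ 3 * (δ ^ 2 * n ^ 7) ≤ n ^ 3 * B := by linarith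
    exact le_of_mul_le_mul_left h' (by positivity)
  have b2 : δ ^ 4 * n ^ 8 ≤ C := by
    have : (δ ^ 2 * n ^ 7) ^ 2 ≤ n ^ 6 * C := by
      calc _ ≤ B ^ 2 := by gcongr
        _ ≤ (cnt (fun x : V × (V × V) × (V × V) × V × V => P₂ x.1 x.2)) ^ 2 := by gcongr
        _ ≤ _ := by linarith [h2]
    have h' : n ^ 6 * (δ ^ 4 * n ^ 8) ≤ n ^ 6 * C := by linarith
    exact le_of_mul_le_mul_left h' (by positivity)
  have b3 : δ ^ 8 * n ^ 9 ≤ D := by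
    have : (δ ^ 4 * n ^ 8) ^ 2 ≤ n ^ 7 * D := by
      calc _ ≤ C ^ 2 := by gcongr
        _ ≤ (cnt (fun x : V × V × V × (V × V) × (V × V) × V => P₃ x.1 x.2)) ^ 2 := by gcongr
        _ ≤ _ := by linarith [h3]
    have h' : n ^ 7 * (δ ^ 8 * n ^ 9) ≤ n ^ 7 * D := by linarith
    exact le_of_mul_le_mul_left h' (by positivity)
  have : 0 < δ ^ 8 * n ^ 9 := by positivity
  nlinarith

/-- Bad pairs are rare. -/
theorem cnt_bad_le {δ : ℝ} (hδ : 0 < δ) (hdeg : PairDeg (Ed H) (2 / 5))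
    (hV : 2 ≤ δ * Fintype.card V) :
    cnt (fun p : V × V => Bad H (δ ^ 8 / 2) p.1 p.2) ≤ 3 * δ * (Fintype.card V : ℝ) ^ 2 := by
  classical
  have hV0 : 0 < Fintype.card V := by
    rcases Nat.eq_zero_or_pos (Fintype.card V) with h | h
    · rw [h] at hV; norm_num at hV
    · exact h
  have h1 := cnt_ed_bad_lt (H := H) hδ hV0
  set n : ℝ := (Fintype.card V : ℝ) with hn
  have hn0 : 0 < n := by rw [hn]; exact_mod_cast hV0
  have h2 : cnt (fun p : V × V => Bad H (δ ^ 8 / 2) p.1 p.2) ≤ cnt (fun p : V × V => p.1 = p.2) +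
      cnt (fun p : V × V => p.1 ≠ p.2 ∧ cnt (Exch H p.1 p.2) < δ ^ 8 / 2 * n ^ 7) :=
    cnt_le_add fun p hp => by
      by_cases h : p.1 = p.2
      · exact Or.inl h
      · exact Or.inr ⟨h, hp.resolve_left h⟩
  have h3 : cnt (fun p : V × V => p.1 = p.2) ≤ n := by
    refine (cnt_le_of_injOn (Q := fun _ : V => True) Prod.fst (fun _ _ => trivial) ?_).trans
      (le_of_eq cnt_true)
    rintro ⟨a, b⟩ ⟨a', b'⟩ h h' e
    simp only at h h' e
    subst h; subst h'; rw [e]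
  set g := cnt (fun p : V × V => p.1 ≠ p.2 ∧ cnt (Exch H p.1 p.2) < δ ^ 8 / 2 * n ^ 7) with hg
  have h4 : g * (2 / 5 * n ^ 3) ≤ δ * n ^ 5 := by
    refine le_trans ?_ h1.le
    refine (mul_le_cnt_prod (P := fun x : (V × V) × V × V × V =>
        Ed H x.2.1 x.2.2.1 x.2.2.2 x.1.1 x.1.2
      ∧ cnt (Exch H x.1.1 x.1.2) < δ ^ 8 / 2 * n ^ 7) (by positivity) le_rfl fun p hp =>
      (hdeg p.1 p.2 hp.1).trans (cnt_mono fun t ht => ⟨ht, hp.2⟩)).trans ?_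
    refine cnt_le_of_injOn (fun x => ((x.2.1, x.2.2.1), x.1.1, x.2.2.2, x.1.2))
      (fun x hx => ⟨hx.1.swap₃₄, hx.2⟩) ?_
    rintro ⟨⟨a, b⟩, c, d, e⟩ ⟨⟨a', b'⟩, c', d', e'⟩ - - h
    simp only [Prod.mk.injEq] at h ⊢
    tauto
  have h5 : g ≤ 5 / 2 * δ * n ^ 2 := by
    have h' : (2 / 5 * n ^ 3) * g ≤ (2 / 5 * n ^ 3) * (5 / 2 * δ * n ^ 2) := by linarith
    exact le_of_mul_le_mul_left h' (by positivity)
  have h6 : 2 * n ≤ δ * n * n := by gcongr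
  nlinarith

end Reachability

section Functions

variable {K V : Type} [Fintype K] [DecidableEq K] [Fintype V]

theorem cnt_pair_rel_le {i j : K} (hij : i ≠ j) (R : V → V → Prop) :
    cnt (fun f : K → V => R (f i) (f j)) * (Fintype.card V : ℝ) ^ 2 ≤
      cnt (fun p : V × V => R p.1 p.2) * (Fintype.card V : ℝ) ^ Fintype.card K := by
  classical
  have h : cnt (fun x : (K → V) × V × V => R (x.1 i) (x.1 j)) ≤
      cnt (fun x : (V × V) × (K → V) => R x.1.1 x.1.2) := by
    refine cnt_le_of_injOn (fun x => ((x.1 i, x.1 j),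
      Function.update (Function.update x.1 i x.2.1) j x.2.2)) (fun _ h => h) ?_
    rintro ⟨f, p, q⟩ ⟨f', p', q'⟩ - - h
    simp only [Prod.mk.injEq] at h ⊢
    obtain ⟨⟨e1, e2⟩, h⟩ := h
    have hj := congrFun h j
    have hi := congrFun h i
    rw [Function.update_of_ne hij, Function.update_of_ne hij] at hi
    simp only [Function.update_self] at hi hj
    refine ⟨funext fun k => ?_, hi, hj⟩
    by_cases hkj : k = j
    · rw [hkj]; exact e2
    by_cases hki : k = i
    · rw [hki]; exact e1
    have hk := congrFun h k
    simpa only [Function.update_of_ne hkj, Function.update_of_ne hki] using hk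
  rw [cnt_fst (fun f : K → V => R (f i) (f j)), cnt_fst (fun p : V × V => R p.1 p.2)] at h
  simp only [Fintype.card_prod, Fintype.card_fun, Nat.cast_mul, Nat.cast_pow] at h
  rw [sq]
  exact h

theorem cnt_forall {ι W : Type} [Fintype ι] [DecidableEq ι] [Fintype W] (P : ι → W → Prop) :
    cnt (fun f : ι → W => ∀ i, P i (f i)) = ∏ i, cnt (P i) := by
  classical
  simp only [cnt_eq_card]
  rw [← Nat.cast_prod, ← Fintype.card_piFinset]
  congr 2
  ext f
  simp [Fintype.mem_piFinset]

end Functions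

/-- Iterated version of `mul_le_cnt_prod`. -/
theorem mul_le_cnt_prod_iterated {α₁ α₂ α₃ α₄ α₅ : Type} [Fintype α₁] [Fintype α₂] [Fintype α₃]
    [Fintype α₄] [Fintype α₅] {P : α₁ × α₂ × α₃ × α₄ × α₅ → Prop} {A₁ : α₁ → Prop}
    {A₂ : α₁ → α₂ → Prop} {A₃ : α₁ → α₂ → α₃ → Prop} {A₄ : α₁ → α₂ → α₃ → α₄ → Prop}
    {p₁ p₂ p₃ p₄ p₅ : ℝ} (h₂ : 0 ≤ p₂) (h₃ : 0 ≤ p₃) (h₄ : 0 ≤ p₄) (h₅ : 0 ≤ p₅)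
    (hA₁ : p₁ ≤ cnt A₁) (hA₂ : ∀ a, A₁ a → p₂ ≤ cnt (A₂ a))
    (hA₃ : ∀ a b, A₁ a → A₂ a b → p₃ ≤ cnt (A₃ a b))
    (hA₄ : ∀ a b c, A₁ a → A₂ a b → A₃ a b c → p₄ ≤ cnt (A₄ a b c))
    (hP : ∀ a b c d, A₁ a → A₂ a b → A₃ a b c → A₄ a b c d → p₅ ≤ cnt fun e => P (a, b, c, d, e)) :
    p₁ * (p₂ * (p₃ * (p₄ * p₅))) ≤ cnt P :=
  mul_le_cnt_prod (by positivity) hA₁ fun a ha => mul_le_cnt_prod (by positivity) (hA₂ a ha)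
    fun b hb => mul_le_cnt_prod (by positivity) (hA₃ a b ha hb) fun c hc =>
      mul_le_cnt_prod h₅ (hA₄ a b c ha hb hc) fun d hd => hP a b c d ha hb hc hd

section Absorbers

variable {V : Type} [Fintype V] [DecidableEq V] {H : Finset (Finset V)}

/-- A walk from `(f 0, f 1)` to `(f 2, f 3)` through `u₁, u₂, u₃` and `f 4, …, f 7`, and a connector
`f 8, …, f 11` between the same pairs. -/
def Base {V : Type} [DecidableEq V] (H : Finset (Finset V)) (u : V × V × V)
    (f : Fin 12 → V) : Prop :=
  (Ed H (f 0) (f 1) u.1 u.2.1 (f 4) ∧ Ed H u.2.1 (f 4) u.2.2 (f 5) (f 6) ∧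
    Ed H (f 5) (f 6) (f 7) (f 2) (f 3)) ∧
    Ed H (f 0) (f 1) (f 8) (f 9) (f 10) ∧ Ed H (f 9) (f 10) (f 11) (f 2) (f 3)

theorem cnt_base_ge (hH : ∀ e ∈ H, e.card = 5) (h : PairDeg (Ed H) (2 / 5)) {u : V × V × V}
    (h₁ : u.1 ≠ u.2.1) (h₂ : u.2.1 ≠ u.2.2) :
    24 / 10 ^ 12 * (Fintype.card V : ℝ) ^ 12 ≤ cnt (Base H u) := by
  classical
  obtain ⟨u₁, u₂, u₃⟩ := u
  simp only at h₁ h₂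
  have hD := distinct_ed hH
  have hV0 : 0 < Fintype.card V := Fintype.card_pos_iff.2 ⟨u₁⟩
  have hx₁ := cnt_vertices_ge (symm₃_link H u₁ u₂) hV0 (h.link h₁)
  have hx₂ := cnt_vertices_ge (symm₃_link H u₂ u₃) hV0 (h.link h₂)
  have hx := cnt_and_ge (fun x => 1 / 100 * (Fintype.card V : ℝ) ^ 2 ≤
      cnt (fun s : V × V => Ed H u₁ u₂ x s.1 s.2)) (fun x => 1 / 100 * (Fintype.card V : ℝ) ^ 2 ≤
      cnt (fun s : V × V => Ed H u₂ u₃ x s.1 s.2))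
  have hlink : ∀ a b : V, a ≠ b → _ := fun a b hab => h.link hab
  have hconn : ∀ q p : V × V, q.1 ≠ q.2 → p.1 ≠ p.2 → _ := fun q p hq hp => cnt_conn_ge h hq hp
  have hn0 : (0 : ℝ) ≤ (Fintype.card V : ℝ) := by positivity
  generalize (Fintype.card V : ℝ) = n at *
  have hx' : 1 / 5 * n ≤ cnt (fun x => 1 / 100 * n ^ 2 ≤
      cnt (fun s : V × V => Ed H u₁ u₂ x s.1 s.2) ∧ 1 / 100 * n ^ 2 ≤
      cnt (fun s : V × V => Ed H u₂ u₃ x s.1 s.2)) := by linarith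
  have key : 1 / 5 * n * (1 / 100 * n ^ 2 * (2 / 5 * n ^ 3 * (1 / 100 * n ^ 2 *
      (3 / 1000000 * n ^ 4)))) ≤ cnt (fun t : V × (V × V) × (V × V × V) × (V × V) × V × V × V × V =>
      Ed H u₂ u₃ t.1 t.2.1.1 t.2.1.2 ∧
      Ed H t.2.1.1 t.2.1.2 t.2.2.1.1 t.2.2.1.2.1 t.2.2.1.2.2 ∧
      Ed H u₁ u₂ t.1 t.2.2.2.1.1 t.2.2.2.1.2 ∧
      Conn (Ed H) (t.2.2.2.1.1, t.2.2.2.1.2) (t.2.2.1.2.1, t.2.2.1.2.2) t.2.2.2.2) := by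
    let A₂ : V → V × V → Prop := fun x s => Ed H u₂ u₃ x s.1 s.2
    let A₃ : V → V × V → V × V × V → Prop := fun _ yz s => Ed H yz.1 yz.2 s.1 s.2.1 s.2.2
    let A₄ : V → V × V → V × V × V → V × V → Prop := fun x _ _ r => Ed H u₁ u₂ x r.1 r.2
    refine mul_le_cnt_prod_iterated (A₂ := A₂) (A₃ := A₃) (A₄ := A₄) ?_ ?_ ?_ ?_ hx' ?_ ?_ ?_ ?_
    · positivity
    · positivity
    · positivity
    · positivity
    · intro x hx
      exact hx.2
    · intro x yz _ hyz
      refine hlink yz.1 yz.2 ?_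
      have := hD _ _ _ _ _ hyz
      simp at this; tauto
    · intro x _ _ hx _ _
      exact hx.1
    · intro x yz s r hx hyz hs hr
      refine (hconn (r.1, r.2) (s.2.1, s.2.2) ?_ ?_).trans
        (cnt_mono fun t ht => ⟨hyz, hs, hr, ht⟩)
      · have := hD _ _ _ _ _ hr
        simp at this; tauto
      · have := hD _ _ _ _ _ hs
        simp at this; tauto
  refine le_trans (le_of_eq (by ring)) (key.trans ?_)
  refine cnt_le_of_injOn (fun t => ![t.2.2.2.1.1, t.2.2.2.1.2, t.2.2.1.2.1, t.2.2.1.2.2, t.1,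
    t.2.1.1, t.2.1.2, t.2.2.1.1, t.2.2.2.2.1, t.2.2.2.2.2.1, t.2.2.2.2.2.2.1,
    t.2.2.2.2.2.2.2]) ?_ ?_
  · rintro ⟨x, ⟨y, z⟩, ⟨w, c, d⟩, ⟨a, b⟩, g₁, g₂, g₃, g₄⟩ ⟨h1, h2, h3, h4, h5⟩
    exact ⟨⟨h3.congr (by ext; simp; tauto), h1.congr (by ext; simp; tauto), h2⟩, h4, h5⟩
  · rintro ⟨x, ⟨y, z⟩, ⟨w, c, d⟩, ⟨a, b⟩, g₁, g₂, g₃, g₄⟩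
      ⟨x', ⟨y', z'⟩, ⟨w', c', d'⟩, ⟨a', b'⟩, g₁', g₂', g₃', g₄'⟩ - - hf
    have e : ∀ i, _ := fun i => congrFun hf i
    have e0 : a = a' := e 0
    have e1 : b = b' := e 1
    have e2 : c = c' := e 2
    have e3 : d = d' := e 3
    have e4 : x = x' := e 4
    have e5 : y = y' := e 5
    have e6 : z = z' := e 6
    have e7 : w = w' := e 7
    have e8 : g₁ = g₁' := e 8
    have e9 : g₂ = g₂' := e 9
    have e10 : g₃ = g₃' := e 10
    have e11 : g₄ = g₄' := e 11
    rw [e0, e1, e2, e3, e4, e5, e6, e7, e8, e9, e10, e11]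

/-- The index set of the vertices of an absorber. -/
abbrev AbsIdx : Type := Fin 12 ⊕ (Fin 4 × Fin 7)

/-- The vertices that are replaced when an absorber absorbs. -/
def outIdx : Fin 4 → Fin 12 := ![4, 5, 6, 7]

/-- The vertices replacing those at `outIdx`. -/
def inIdx : Fin 4 → Fin 12 := ![8, 9, 10, 11]

theorem outIdx_ne_inIdx (i : Fin 4) : outIdx i ≠ inIdx i := by
  fin_cases i <;> decide

/-- An absorber of the triple `u`. -/
def Abs {V : Type} [DecidableEq V] (H : Finset (Finset V)) (u : V × V × V)
    (F : AbsIdx → V) : Prop :=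
  Base H u (fun i => F (Sum.inl i)) ∧
    ∀ i, Exch H (F (Sum.inl (outIdx i))) (F (Sum.inl (inIdx i))) (fun j => F (Sum.inr (i, j)))

/-- Every triple has many bases with good pairs. -/
theorem cnt_base_good_ge (hH : ∀ e ∈ H, e.card = 5) (h : PairDeg (Ed H) (2 / 5))
    (hV : 2 * 10 ^ 12 ≤ (Fintype.card V : ℝ)) {u : V × V × V}
    (h₁ : u.1 ≠ u.2.1) (h₂ : u.2.1 ≠ u.2.2) :
    12 / 10 ^ 12 * (Fintype.card V : ℝ) ^ 12 ≤ cnt (fun f => Base H u f ∧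
      ¬ ∃ i, Bad H ((1 / 10 ^ 12) ^ 8 / 2) (f (outIdx i)) (f (inIdx i))) := by
  classical
  have hb := cnt_base_ge hH h h₁ h₂
  have hbad := cnt_bad_le (H := H) (δ := 1 / 10 ^ 12) (by positivity) h (by linarith)
  have hpos : 0 < (Fintype.card V : ℝ) := lt_of_lt_of_le (by norm_num) hV
  have h1 : ∀ i : Fin 4, cnt (fun f : Fin 12 → V =>
      Bad H ((1 / 10 ^ 12) ^ 8 / 2) (f (outIdx i)) (f (inIdx i))) ≤
      3 / 10 ^ 12 * (Fintype.card V : ℝ) ^ 12 := fun i => by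
    have := cnt_pair_rel_le (K := Fin 12) (outIdx_ne_inIdx i)
      (fun x y : V => Bad H ((1 / 10 ^ 12) ^ 8 / 2) x y)
    rw [Fintype.card_fin] at this
    have h2 : (Fintype.card V : ℝ) ^ 2 * cnt (fun f : Fin 12 → V =>
      Bad H ((1 / 10 ^ 12) ^ 8 / 2) (f (outIdx i)) (f (inIdx i))) ≤
        (Fintype.card V : ℝ) ^ 2 * (3 / 10 ^ 12 * (Fintype.card V : ℝ) ^ 12) := by
      calc _ = _ := mul_comm _ _
        _ ≤ _ := this
        _ ≤ (3 * (1 / 10 ^ 12) * (Fintype.card V : ℝ) ^ 2) * (Fintype.card V : ℝ) ^ 12 := by gcongr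
        _ = _ := by ring
    exact le_of_mul_le_mul_left h2 (by positivity)
  have h2 : cnt (fun f : Fin 12 → V => ∃ i,
      Bad H ((1 / 10 ^ 12) ^ 8 / 2) (f (outIdx i)) (f (inIdx i))) ≤
      12 / 10 ^ 12 * (Fintype.card V : ℝ) ^ 12 := by
    refine (cnt_exists_le _).trans ((Finset.sum_le_sum fun i _ => h1 i).trans (le_of_eq ?_))
    simp
    ring
  have := cnt_and_not_ge hb h2
  linarith

/-- Every triple has many absorbers. -/
theorem cnt_abs_ge (hH : ∀ e ∈ H, e.card = 5) (h : PairDeg (Ed H) (2 / 5))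
    (hV : 2 * 10 ^ 12 ≤ (Fintype.card V : ℝ)) {u : V × V × V}
    (h₁ : u.1 ≠ u.2.1) (h₂ : u.2.1 ≠ u.2.2) :
    12 / 10 ^ 12 * ((1 / 10 ^ 12) ^ 8 / 2) ^ 4 * (Fintype.card V : ℝ) ^ Fintype.card AbsIdx ≤
      cnt (Abs H u) := by
  classical
  have hb := cnt_base_good_ge hH h hV h₁ h₂
  set β : ℝ := (1 / 10 ^ 12) ^ 8 / 2 with hβ
  have hβ0 : 0 < β := by positivity
  set n : ℝ := (Fintype.card V : ℝ) with hn
  have hn0 : 0 ≤ n := by positivity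
  have key : (12 / 10 ^ 12 * n ^ 12) * (β * n ^ 7) ^ 4 ≤
      cnt (fun x : (Fin 12 → V) × (Fin 4 → Fin 7 → V) => Base H u x.1 ∧
        ∀ i, Exch H (x.1 (outIdx i)) (x.1 (inIdx i)) (x.2 i)) := by
    refine mul_le_cnt_prod (by positivity) hb fun f hf => ?_
    have hf' : ∀ i, β * n ^ 7 ≤ cnt (Exch H (f (outIdx i)) (f (inIdx i))) := fun i => by
      by_contra hc
      exact hf.2 ⟨i, Or.inr (not_le.1 hc)⟩
    calc (β * n ^ 7) ^ 4 = ∏ _i : Fin 4, β * n ^ 7 := by simp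
      _ ≤ ∏ i : Fin 4, cnt (Exch H (f (outIdx i)) (f (inIdx i))) :=
          Finset.prod_le_prod (fun _ _ => by positivity) fun i _ => hf' i
      _ = _ := (cnt_forall _).symm
      _ ≤ _ := cnt_mono fun g hg => ⟨hf.1, hg⟩
  have hcard : Fintype.card AbsIdx = 40 := by simp [AbsIdx]
  rw [hcard]
  refine le_trans (le_of_eq (by ring)) (key.trans ?_)
  refine cnt_le_of_injOn (fun x => Sum.elim x.1 fun p => x.2 p.1 p.2) (fun x hx => hx) ?_
  rintro ⟨f, g⟩ ⟨f', g'⟩ - - e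
  have e1 : f = f' := funext fun i => congrFun e (Sum.inl i)
  have e2 : g = g' := funext fun i => funext fun j => congrFun e (Sum.inr (i, j))
  rw [e1, e2]

end Absorbers

/-- Most tuples are injective and avoid a bounded set. -/
theorem cnt_clean_ge {K : Type} [Fintype K] [DecidableEq K] (s : ℕ) {c : ℝ} (hc : 0 < c) :
    ∃ n₀ : ℕ, ∀ (V : Type) [Fintype V] [DecidableEq V], n₀ ≤ Fintype.card V →
      ∀ (P : (K → V) → Prop) (X : Finset V), X.card ≤ s →
        c * (Fintype.card V : ℝ) ^ Fintype.card K ≤ cnt P →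
        c / 2 * (Fintype.card V : ℝ) ^ Fintype.card K ≤
          cnt (fun f => P f ∧ ¬ (¬ Function.Injective f ∨ ∃ i, f i ∈ X)) := by
  classical
  set k : ℝ := (Fintype.card K : ℝ) with hk
  have hk0 : 0 ≤ k := by positivity
  refine ⟨max 1 ⌈(k ^ 2 + k * s) * 2 / c⌉₊, fun V _ _ hV P X hX hP => ?_⟩
  have hpos : 0 < (Fintype.card V : ℝ) := by
    have : 1 ≤ Fintype.card V := (le_max_left _ _).trans hV
    exact_mod_cast this
  have hbig : (k ^ 2 + k * s) * 2 / c ≤ (Fintype.card V : ℝ) :=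
    (Nat.le_ceil _).trans (by exact_mod_cast (le_max_right _ _).trans hV)
  rw [div_le_iff₀ hc] at hbig
  have h1 := cnt_not_injective_le (K := K) (V := V)
  have h2 := cnt_exists_mem_le (K := K) X
  set n : ℝ := (Fintype.card V : ℝ) with hn
  set N : ℝ := n ^ Fintype.card K with hN
  have hN0 : 0 < N := by positivity
  have h3 := cnt_le_add (P := fun f : K → V => ¬ Function.Injective f ∨ ∃ i, f i ∈ X)
    (Q := fun f => ¬ Function.Injective f) (R := fun f => ∃ i, f i ∈ X) fun _ h => h
  have hX' : (X.card : ℝ) ≤ s := by exact_mod_cast hX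
  have h4 : cnt (fun f : K → V => ¬ Function.Injective f ∨ ∃ i, f i ∈ X) ≤ c / 2 * N := by
    have h5 : n * cnt (fun f : K → V => ¬ Function.Injective f ∨ ∃ i, f i ∈ X) ≤
        n * (c / 2 * N) := by
      calc _ ≤ n * (cnt (fun f : K → V => ¬ Function.Injective f) +
            cnt (fun f : K → V => ∃ i, f i ∈ X)) := by gcongr
        _ ≤ k ^ 2 * N + (k * X.card) * N := by linarith
        _ ≤ k ^ 2 * N + (k * s) * N := by gcongr
        _ = (k ^ 2 + k * s) * N := by ring
        _ ≤ (n * c / 2) * N := by gcongr; linarith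
        _ = _ := by ring
    exact le_of_mul_le_mul_left h5 hpos
  have := cnt_and_not_ge hP h4
  linarith

section Selection

variable {K V I : Type} [Fintype K] [DecidableEq K] [Fintype V] [DecidableEq V] [Fintype I]

open Classical in
/-- One step of the selection: a tuple avoiding `X` that decreases a weight by a constant factor. -/
theorem exists_decrease {c : ℝ} (hc : 0 < c) (hV : 0 < Fintype.card V) {G : I → (K → V) → Prop}
    (hG : ∀ i, c * (Fintype.card V : ℝ) ^ Fintype.card K ≤ cnt (G i)) (w : I → ℝ)
    (hw : ∀ i, 0 < w i) [Nonempty I] (X : Finset V)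
    (hX : Fintype.card K * X.card ≤ c / 2 * Fintype.card V) :
    ∃ f : K → V, (∀ k, f k ∉ X) ∧ (∃ i, G i f) ∧
      ∑ i, (if G i f then 1 / 2 else 1) * w i ≤ (1 - c / 4) * ∑ i, w i := by
  classical
  have hn0 : 0 < (Fintype.card V : ℝ) := by exact_mod_cast hV
  have hbad := cnt_exists_mem_le (K := K) X
  have hcl : ∀ i, c / 2 * (Fintype.card V : ℝ) ^ Fintype.card K ≤
      cnt (fun f => G i f ∧ ¬ ∃ k, f k ∈ X) := fun i => by
    have h1 : cnt (fun f : K → V => ∃ k, f k ∈ X) ≤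
        c / 2 * (Fintype.card V : ℝ) ^ Fintype.card K := by
      have h2 : (Fintype.card V : ℝ) * cnt (fun f : K → V => ∃ k, f k ∈ X) ≤
          (Fintype.card V : ℝ) * (c / 2 * (Fintype.card V : ℝ) ^ Fintype.card K) := by
        calc _ = _ := mul_comm _ _
          _ ≤ _ := hbad
          _ ≤ (c / 2 * Fintype.card V) * (Fintype.card V : ℝ) ^ Fintype.card K := by gcongr
          _ = _ := by ring
      exact le_of_mul_le_mul_left h2 hn0
    have := cnt_and_not_ge (hG i) h1
    linarith
  set N : ℝ := (Fintype.card V : ℝ) ^ Fintype.card K with hN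
  have hN0 : 0 < N := by positivity
  have hW : 0 < ∑ i, w i := Finset.sum_pos (fun i _ => hw i) univ_nonempty
  have hcard : (Fintype.card (K → V) : ℝ) = N := by
    rw [Fintype.card_fun, Nat.cast_pow]
  have havg : ∑ f : K → V, ∑ i, (if G i f ∧ ¬ ∃ k, f k ∈ X then 1 / 2 else 1) * w i ≤
      ∑ _f : K → V, (1 - c / 4) * ∑ i, w i := by
    rw [Finset.sum_comm, Finset.sum_const, card_univ, nsmul_eq_mul, hcard]
    have h1 : ∀ i, ∑ f : K → V, (if G i f ∧ ¬ ∃ k, f k ∈ X then 1 / 2 else 1) * w i ≤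
        N * (1 - c / 4) * w i := fun i => by
      rw [← Finset.sum_mul]
      have h2 : ∑ f : K → V, (if G i f ∧ ¬ ∃ k, f k ∈ X then (1 / 2 : ℝ) else 1) =
          N - 1 / 2 * cnt (fun f => G i f ∧ ¬ ∃ k, f k ∈ X) := by
        rw [← hcard, cnt, Finset.mul_sum, ← Finset.card_univ, ← nsmul_one, ← Finset.sum_const,
          ← Finset.sum_sub_distrib]
        refine Finset.sum_congr rfl fun f _ => ?_
        split_ifs <;> norm_num
      rw [h2]
      have := hcl i
      have := hw i
      gcongr
      linarith
    calc _ ≤ ∑ i, N * (1 - c / 4) * w i := Finset.sum_le_sum fun i _ => h1 i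
      _ = _ := by rw [← Finset.mul_sum, mul_assoc]
  have hne : (univ : Finset (K → V)).Nonempty := by
    rw [← Finset.card_pos, Finset.card_univ]
    exact_mod_cast hcard ▸ hN0
  obtain ⟨f, -, hf⟩ := Finset.exists_le_of_sum_le hne havg
  by_cases hfx : ∃ i, G i f ∧ ¬ ∃ k, f k ∈ X
  · obtain ⟨i, hi, hfX⟩ := hfx
    refine ⟨f, fun k hk => hfX ⟨k, hk⟩, ⟨i, hi⟩, ?_⟩
    refine le_trans (Finset.sum_le_sum fun j _ => le_of_eq ?_) hf
    congr 1
    simp only [hfX, not_false_eq_true, and_true]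
  · push Not at hfx
    exfalso
    have : ∑ i, (if G i f ∧ ¬ ∃ k, f k ∈ X then (1 / 2 : ℝ) else 1) * w i = ∑ i, w i := by
      refine Finset.sum_congr rfl fun i _ => ?_
      rw [if_neg, one_mul]
      rintro ⟨h1, h2⟩
      exact h2 (hfx i h1)
    rw [this] at hf
    nlinarith

open Classical in
/-- Iterated selection. -/
theorem exists_selection_aux [Nonempty I] {c : ℝ} (hc : 0 < c) (hV : 0 < Fintype.card V)
    {G : I → (K → V) → Prop} (hinj : ∀ i f, G i f → Function.Injective f)
    (hG : ∀ i, c * (Fintype.card V : ℝ) ^ Fintype.card K ≤ cnt (G i)) (hc4 : c ≤ 4) (t : ℕ)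
    (ht : (Fintype.card K : ℝ) ^ 2 * t ≤ c / 2 * Fintype.card V) :
    ∃ F : Fin t → K → V, Function.Injective (fun p : Fin t × K => F p.1 p.2) ∧
      (∀ a, ∃ i, G i (F a)) ∧
      ∑ i, ∏ a, (if G i (F a) then (1 / 2 : ℝ) else 1) ≤ (1 - c / 4) ^ t * Fintype.card I := by
  classical
  induction t with
  | zero =>
    refine ⟨fun a => a.elim0, fun p => p.1.elim0, fun a => a.elim0, ?_⟩
    simp
  | succ t ih =>
    obtain ⟨F, hF, hF', hw⟩ := ih (le_trans (by gcongr; simp) ht)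
    set X : Finset V := univ.image (fun p : Fin t × K => F p.1 p.2) with hX
    have hXc : X.card ≤ t * Fintype.card K := by
      refine card_image_le.trans ?_
      simp
    obtain ⟨f, hf, hfi, hfw⟩ := exists_decrease hc hV hG
      (fun i => ∏ a, (if G i (F a) then (1 / 2 : ℝ) else 1))
      (fun i => Finset.prod_pos fun a _ => by split_ifs <;> norm_num) X (by
        have h1 : (X.card : ℝ) ≤ t * Fintype.card K := by exact_mod_cast hXc
        calc (Fintype.card K : ℝ) * X.card ≤ Fintype.card K * (t * Fintype.card K) := by gcongr
          _ = (Fintype.card K : ℝ) ^ 2 * t := by ring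
          _ ≤ (Fintype.card K : ℝ) ^ 2 * (t + 1 : ℕ) := by gcongr; simp
          _ ≤ _ := ht)
    have hnot : ∀ a k l, F a k ≠ f l := fun a k l e => hf l (by
      rw [hX, ← e]
      exact mem_image_of_mem (fun p : Fin t × K => F p.1 p.2) (mem_univ (a, k)))
    refine ⟨Fin.cons f F, ?_, ?_, ?_⟩
    · rintro ⟨a, k⟩ ⟨b, l⟩ h
      simp only at h
      induction a using Fin.cases with
      | zero =>
        induction b using Fin.cases with
        | zero =>
          obtain ⟨i, hi⟩ := hfi
          simp only [Fin.cons_zero] at h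
          rw [hinj i f hi h]
        | succ b =>
          simp only [Fin.cons_zero, Fin.cons_succ] at h
          exact absurd h.symm (hnot _ _ _)
      | succ a =>
        induction b using Fin.cases with
        | zero =>
          simp only [Fin.cons_zero, Fin.cons_succ] at h
          exact absurd h (hnot _ _ _)
        | succ b =>
          simp only [Fin.cons_succ] at h
          have := hF (a₁ := (a, k)) (a₂ := (b, l)) h
          simp only [Prod.mk.injEq] at this
          rw [this.1, this.2]
    · intro a
      induction a using Fin.cases with
      | zero => exact hfi
      | succ a => exact hF' a
    · simp only [Fin.prod_univ_succ, Fin.cons_zero, Fin.cons_succ]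
      refine hfw.trans ?_
      rw [pow_succ]
      calc _ ≤ (1 - c / 4) * ((1 - c / 4) ^ t * Fintype.card I) := by
            gcongr
            linarith
        _ = _ := by ring

end Selection

/-- A small family of disjoint tuples meeting each of polynomially many dense families often. -/
theorem exists_selection {K : Type} [Fintype K] [DecidableEq K] [Nonempty K] {c : ℝ} (hc : 0 < c)
    (hc4 : c ≤ 4) (q : ℕ) {τ : ℝ} (hτ : 0 < τ) :
    ∃ τ' > 0, ∃ n₀ : ℕ, ∀ (V : Type) [Fintype V] [DecidableEq V], n₀ ≤ Fintype.card V →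
      ∀ (I : Type) [Fintype I] (G : I → (K → V) → Prop), Fintype.card I ≤ Fintype.card V ^ q →
        (∀ i f, G i f → Function.Injective f) →
        (∀ i, c * (Fintype.card V : ℝ) ^ Fintype.card K ≤ cnt (G i)) →
        ∃ (t : ℕ) (F : Fin t → K → V), Function.Injective (fun p : Fin t × K => F p.1 p.2) ∧
          (t : ℝ) ≤ τ * Fintype.card V ∧ (∀ a, ∃ i, G i (F a)) ∧
          ∀ i, τ' * Fintype.card V ≤ cnt (fun a => G i (F a)) := by
  classical
  set k : ℝ := (Fintype.card K : ℝ) with hk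
  have hk0 : 0 < k := by rw [hk]; exact_mod_cast Fintype.card_pos
  set σ : ℝ := min τ (c / (2 * k ^ 2)) with hσ
  have hσ0 : 0 < σ := lt_min hτ (by positivity)
  set b : ℝ := c * σ / 8 with hb
  have hb0 : 0 < b := by positivity
  have hlim := tendsto_pow_const_mul_const_pow_of_abs_lt_one q (r := Real.exp (-b)) (by
    rw [abs_of_pos (Real.exp_pos _)]
    exact (Real.exp_lt_exp.2 (by linarith : -b < 0)).trans_eq Real.exp_zero)
  have hev := (hlim.eventually (gt_mem_nhds (Real.exp_pos (-(c / 4))))).and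
    (Filter.eventually_ge_atTop 1)
  obtain ⟨n₀, hn₀⟩ := Filter.eventually_atTop.1 hev
  refine ⟨b, hb0, n₀, fun V _ _ hV I _ G hI hinj hG => ?_⟩
  obtain ⟨h1, h2⟩ := hn₀ _ hV
  rcases isEmpty_or_nonempty I with hI0 | hI0
  · exact ⟨0, fun a => a.elim0, fun p => p.1.elim0, by simp; positivity, fun a => a.elim0,
      fun i => isEmptyElim i⟩
  have hn1 : (1 : ℝ) ≤ (Fintype.card V : ℝ) := by exact_mod_cast h2
  have hIr : (Fintype.card I : ℝ) ≤ (Fintype.card V : ℝ) ^ q := by exact_mod_cast hI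
  set N : ℕ := Fintype.card V with hN
  set t : ℕ := ⌊σ * N⌋₊ with ht
  have ht1 : (t : ℝ) ≤ σ * N := Nat.floor_le (by positivity)
  have ht2 : σ * N < t + 1 := Nat.lt_floor_add_one _
  obtain ⟨F, hF, hF', hw⟩ := exists_selection_aux (K := K) hc (by omega) hinj hG hc4 t (by
    calc k ^ 2 * (t : ℝ) ≤ k ^ 2 * ((c / (2 * k ^ 2)) * N) := by
          gcongr
          exact ht1.trans (by gcongr; exact min_le_right _ _)
      _ = c / 2 * N := by field_simp)
  refine ⟨t, F, hF, ht1.trans (by gcongr; exact min_le_left _ _), hF', fun i => ?_⟩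
  by_contra hcon
  push Not at hcon
  have e1 : ∏ a, (if G i (F a) then (1 / 2 : ℝ) else 1) ≤ (1 - c / 4) ^ t * Fintype.card I := by
    refine le_trans ?_ hw
    exact Finset.single_le_sum (f := fun i => ∏ a, (if G i (F a) then (1 / 2 : ℝ) else 1))
      (fun j _ => Finset.prod_nonneg fun a _ => by split_ifs <;> norm_num) (mem_univ i)
  have e2 : Real.exp (-(b * N)) < ∏ a, (if G i (F a) then (1 / 2 : ℝ) else 1) := by
    have e3 : Real.exp (-cnt (fun a => G i (F a))) ≤
        ∏ a, (if G i (F a) then (1 / 2 : ℝ) else 1) := by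
      rw [cnt, ← Finset.sum_neg_distrib, Real.exp_sum]
      refine Finset.prod_le_prod (fun _ _ => (Real.exp_pos _).le) fun a _ => ?_
      split_ifs
      · rw [Real.exp_neg, one_div]
        gcongr
        have := Real.add_one_le_exp 1
        linarith
      · simp
    exact lt_of_lt_of_le (Real.exp_lt_exp.2 (by linarith)) e3
  have e4 : (1 - c / 4) ^ t ≤ Real.exp (-(c / 4) * t) := by
    rw [mul_comm, Real.exp_nat_mul]
    gcongr
    · linarith
    · have := Real.add_one_le_exp (-(c / 4))
      linarith
  have e5 : Real.exp (-(c / 4) * t) ≤ Real.exp (c / 4) * Real.exp (-(2 * b * N)) := by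
    rw [← Real.exp_add]
    gcongr
    have : c / 4 * (σ * N) ≤ c / 4 * (t + 1) := by gcongr
    rw [hb]
    linarith
  have e6 : Real.exp (-(2 * b * N)) = Real.exp (-(b * N)) * Real.exp (-b) ^ N := by
    rw [← Real.exp_nat_mul, ← Real.exp_add]
    congr 1
    ring
  have e7 : Real.exp (-(b * N)) < Real.exp (-(b * N)) * 1 := by
    calc _ < _ := e2
      _ ≤ _ := e1
      _ ≤ (Real.exp (c / 4) * (Real.exp (-(b * N)) * Real.exp (-b) ^ N)) * (N : ℝ) ^ q := by
          rw [← e6]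
          gcongr
          exact e4.trans e5
      _ = Real.exp (-(b * N)) * (Real.exp (c / 4) * ((N : ℝ) ^ q * Real.exp (-b) ^ N)) := by ring
      _ ≤ Real.exp (-(b * N)) * (Real.exp (c / 4) * Real.exp (-(c / 4))) := by gcongr
      _ = _ := by rw [← Real.exp_add]; simp
  simp at e7

section AbsorberWalks

variable {V : Type}

/-- Starting pairs of the segments of an absorber. -/
def absSt (F : AbsIdx → V) : Option (Fin 4) → V × V
  | none => (F (Sum.inl 0), F (Sum.inl 1))
  | some i => (F (Sum.inr (i, 0)), F (Sum.inr (i, 1)))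

/-- Final pairs of the segments of an absorber. -/
def absEn (F : AbsIdx → V) : Option (Fin 4) → V × V
  | none => (F (Sum.inl 2), F (Sum.inl 3))
  | some i => (F (Sum.inr (i, 5)), F (Sum.inr (i, 6)))

/-- The segments of an absorber that does not absorb. -/
def segOff (F : AbsIdx → V) : Option (Fin 4) → List (V × V × V)
  | none => [(F (Sum.inl 8), F (Sum.inl 9), F (Sum.inl 10)),
      (F (Sum.inl 11), F (Sum.inl 2), F (Sum.inl 3))]
  | some i => [(F (Sum.inr (i, 2)), F (Sum.inr (i, 3)), F (Sum.inr (i, 4))),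
      (F (Sum.inl (outIdx i)), F (Sum.inr (i, 5)), F (Sum.inr (i, 6)))]

/-- The segments of an absorber that absorbs `u`. -/
def segOn (F : AbsIdx → V) (u : V × V × V) : Option (Fin 4) → List (V × V × V)
  | none => [(u.1, u.2.1, F (Sum.inl 4)), (u.2.2, F (Sum.inl 5), F (Sum.inl 6)),
      (F (Sum.inl 7), F (Sum.inl 2), F (Sum.inl 3))]
  | some i => [(F (Sum.inr (i, 4)), F (Sum.inr (i, 3)), F (Sum.inr (i, 2))),
      (F (Sum.inl (inIdx i)), F (Sum.inr (i, 5)), F (Sum.inr (i, 6)))]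

/-- The vertices of a triple. -/
def trip (u : V × V × V) : Multiset V := {u.1, u.2.1, u.2.2}

theorem sum_absIdx (F : AbsIdx → V) : ∑ k, ({F k} : Multiset V) =
    (({F (Sum.inl 0)} + {F (Sum.inl 1)} + {F (Sum.inl 2)} + {F (Sum.inl 3)}) +
      ∑ i, ({F (Sum.inl (outIdx i))} + {F (Sum.inl (inIdx i))})) +
    ∑ i, ∑ j, {F (Sum.inr (i, j))} := by
  rw [Fintype.sum_sum_type, Fintype.sum_prod_type]
  congr 1
  rw [show (univ : Finset (Fin 12)) = {0, 1, 2, 3, 4, 5, 6, 7, 8, 9, 10, 11} by decide,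
    Fin.sum_univ_four]
  simp only [outIdx, inIdx]
  simp [-Multiset.singleton_add]
  try simp only [← Multiset.singleton_add]
  abel

theorem sum_segOff (F : AbsIdx → V) :
    ∑ o, (pv (absSt F o) + verts (segOff F o)) = ∑ k, {F k} := by
  rw [Fintype.sum_option, sum_absIdx]
  have h : ∀ i, pv (absSt F (some i)) + verts (segOff F (some i)) =
      {F (Sum.inl (outIdx i))} + ∑ j, {F (Sum.inr (i, j))} := fun i => by
    simp only [absSt, segOff, pv, verts, Fin.sum_univ_seven, Multiset.insert_eq_cons,
      ← Multiset.singleton_add]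
    abel
  have h' : pv (absSt F none) + verts (segOff F none) =
      ({F (Sum.inl 0)} + {F (Sum.inl 1)} + {F (Sum.inl 2)} + {F (Sum.inl 3)}) +
        ∑ i, {F (Sum.inl (inIdx i))} := by
    simp only [absSt, segOff, pv, verts, Fin.sum_univ_four, inIdx, Multiset.insert_eq_cons,
      ← Multiset.singleton_add]
    simp [-Multiset.singleton_add]
    try simp only [← Multiset.singleton_add]
    abel
  simp only [h, h', Finset.sum_add_distrib]
  abel

theorem sum_segOn (F : AbsIdx → V) (u : V × V × V) :
    ∑ o, (pv (absSt F o) + verts (segOn F u o)) = ∑ k, {F k} + trip u := by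
  rw [Fintype.sum_option, sum_absIdx]
  have h : ∀ i, pv (absSt F (some i)) + verts (segOn F u (some i)) =
      {F (Sum.inl (inIdx i))} + ∑ j, {F (Sum.inr (i, j))} := fun i => by
    simp only [absSt, segOn, pv, verts, Fin.sum_univ_seven, Multiset.insert_eq_cons,
      ← Multiset.singleton_add]
    abel
  have h' : pv (absSt F none) + verts (segOn F u none) =
      ({F (Sum.inl 0)} + {F (Sum.inl 1)} + {F (Sum.inl 2)} + {F (Sum.inl 3)}) +
        ∑ i, {F (Sum.inl (outIdx i))} + trip u := by
    simp only [absSt, segOn, pv, verts, trip, Fin.sum_univ_four, outIdx, Multiset.insert_eq_cons,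
      ← Multiset.singleton_add]
    simp [-Multiset.singleton_add]
    try simp only [← Multiset.singleton_add]
    abel
  simp only [h, h', Finset.sum_add_distrib]
  abel

variable [DecidableEq V] {H : Finset (Finset V)}

theorem wk_segOff {F : AbsIdx → V} {u : V × V × V} (h : Abs H u F) (o : Option (Fin 4)) :
    Wk (Ed H) (absSt F o) (segOff F o) ∧ fin (absSt F o) (segOff F o) = absEn F o := by
  cases o with
  | none => exact ⟨⟨h.1.2.1, h.1.2.2, trivial⟩, rfl⟩
  | some i => exact ⟨⟨(h.2 i).1, (h.2 i).2.1, trivial⟩, rfl⟩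

theorem wk_segOn {F : AbsIdx → V} {u : V × V × V} (h : Abs H u F) (o : Option (Fin 4)) :
    Wk (Ed H) (absSt F o) (segOn F u o) ∧ fin (absSt F o) (segOn F u o) = absEn F o := by
  cases o with
  | none => exact ⟨⟨h.1.1.1, h.1.1.2.1, h.1.1.2.2, trivial⟩, rfl⟩
  | some i => exact ⟨⟨(h.2 i).1.congr (by ext; simp; tauto), (h.2 i).2.2, trivial⟩, rfl⟩

/-- Choosing distinct absorbers for the triples of a set. -/
theorem exists_assignment {t : ℕ} (F : Fin t → AbsIdx → V) (s : ℕ)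
    (hF : ∀ u : V × V × V, u.1 ≠ u.2.1 → u.2.1 ≠ u.2.2 → (s : ℝ) ≤ cnt (fun a => Abs H u (F a)))
    (r : ℕ) (hr : r ≤ s) (W : Finset V) (hW : W.card = 3 * r) :
    ∃ σ : Fin t → Option (V × V × V), (∀ a u, σ a = some u → Abs H u (F a)) ∧
      (univ.filter fun a => σ a ≠ none).card ≤ r ∧ ∑ a, (σ a).elim 0 trip = W.val := by
  classical
  induction r generalizing W with
  | zero =>
    refine ⟨fun _ => none, by simp, by simp, ?_⟩
    have : W = ∅ := Finset.card_eq_zero.1 (by simpa using hW)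
    simp [this]
  | succ r ih =>
    obtain ⟨T, hTW, hT⟩ := Finset.exists_subset_card_eq (s := W) (n := 3) (by omega)
    obtain ⟨x, y, z, hxy, hxz, hyz, rfl⟩ := Finset.card_eq_three.1 hT
    obtain ⟨σ, h1, h2, h3⟩ := ih (by omega) (W \ {x, y, z}) (by
      rw [card_sdiff_of_subset hTW, hT, hW]; omega)
    have h4 := hF (x, y, z) hxy hyz
    rw [cnt_eq_card] at h4
    have h5 : s ≤ (univ.filter fun a => Abs H (x, y, z) (F a)).card := by exact_mod_cast h4
    obtain ⟨a, ha, ha'⟩ : ∃ a ∈ univ.filter (fun a => Abs H (x, y, z) (F a)),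
        a ∉ univ.filter (fun a => σ a ≠ none) :=
      Finset.exists_mem_notMem_of_card_lt_card (by omega)
    simp only [mem_filter, mem_univ, true_and, not_not] at ha ha'
    refine ⟨Function.update σ a (some (x, y, z)), ?_, ?_, ?_⟩
    · intro b u hb
      by_cases hba : b = a
      · subst hba
        rw [Function.update_self] at hb
        rw [← Option.some.inj hb]
        exact ha
      · rw [Function.update_of_ne hba] at hb
        exact h1 b u hb
    · refine le_trans (card_le_card (t := insert a (univ.filter fun a => σ a ≠ none)) ?_)
        ((card_insert_le _ _).trans (by omega))
      intro b hb
      simp only [mem_filter, mem_univ, true_and, mem_insert] at hb ⊢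
      by_cases hba : b = a
      · exact Or.inl hba
      · rw [Function.update_of_ne hba] at hb
        exact Or.inr hb
    · have : ∀ b, (Function.update σ a (some (x, y, z)) b).elim 0 trip =
          (σ b).elim 0 trip + if b = a then trip (x, y, z) else 0 := fun b => by
        by_cases hba : b = a
        · subst hba
          simp [ha']
        · simp [hba]
      simp only [this]
      rw [Finset.sum_add_distrib, h3, Finset.sum_ite_eq' univ a]
      simp only [mem_univ, if_true]
      have hd : (W \ {x, y, z}).val + ({x, y, z} : Finset V).val = W.val := by
        rw [← Finset.sdiff_union_of_subset hTW, ← Finset.disjUnion_eq_union _ _ sdiff_disjoint]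
        simp [Finset.disjUnion]
      rw [← hd]
      congr 1
      simp [trip, hxy, hxz, hyz]

end AbsorberWalks

section Connecting

variable {V : Type} [Fintype V] [DecidableEq V] {H : Finset (Finset V)}

/-- Pairs have many connectors avoiding a small set. -/
theorem cnt_conn_avoiding_ge (h : PairDeg (Ed H) (2 / 5)) (hV : 10 ^ 8 ≤ (Fintype.card V : ℝ))
    {q p : V × V} (hq : q.1 ≠ q.2) (hp : p.1 ≠ p.2) {Z : Finset V}
    (hZ : (Z.card : ℝ) ≤ 5 / 10 ^ 7 * Fintype.card V) :
    1 / (2 * 10 ^ 6) * (Fintype.card V : ℝ) ^ 4 ≤ cnt (fun f : Fin 4 → V =>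
      Conn (Ed H) q p (f 0, f 1, f 2, f 3) ∧ ¬ (¬ Function.Injective f ∨ ∃ i, f i ∈ Z)) := by
  classical
  have h1 := cnt_conn_ge h hq hp
  have h2 := cnt_not_injective_le (K := Fin 4) (V := V)
  have h3 := cnt_exists_mem_le (K := Fin 4) Z
  simp only [Fintype.card_fin] at h2 h3
  set n : ℝ := (Fintype.card V : ℝ) with hn
  have hn0 : 0 < n := by linarith
  set P : (Fin 4 → V) → Prop := fun f => Conn (Ed H) q p (f 0, f 1, f 2, f 3) with hP
  have h4 : 3 / 1000000 * n ^ 4 ≤ cnt P := by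
    refine h1.trans (cnt_le_of_injOn (fun t => ![t.1, t.2.1, t.2.2.1, t.2.2.2]) (fun _ ht => ht) ?_)
    rintro ⟨a, b, c, d⟩ ⟨a', b', c', d'⟩ - - e
    have e0 : a = a' := congrFun e 0
    have e1 : b = b' := congrFun e 1
    have e2 : c = c' := congrFun e 2
    have e3 : d = d' := congrFun e 3
    rw [e0, e1, e2, e3]
  have h5 : cnt (fun f : Fin 4 → V => ¬ Function.Injective f ∨ ∃ i, f i ∈ Z) ≤
      (2.5 / 10 ^ 6) * n ^ 4 := by
    have h6 := cnt_le_add (P := fun f : Fin 4 → V => ¬ Function.Injective f ∨ ∃ i, f i ∈ Z)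
      (Q := fun f => ¬ Function.Injective f) (R := fun f => ∃ i, f i ∈ Z) fun _ h => h
    have h7 : n * cnt (fun f : Fin 4 → V => ¬ Function.Injective f ∨ ∃ i, f i ∈ Z) ≤
        n * ((2.5 / 10 ^ 6) * n ^ 4) := by
      calc _ ≤ n * (cnt (fun f : Fin 4 → V => ¬ Function.Injective f) +
            cnt (fun f : Fin 4 → V => ∃ i, f i ∈ Z)) := by gcongr
        _ ≤ (16 + 4 * Z.card) * n ^ 4 := by push_cast at h2 h3; linarith
        _ ≤ (n * (2.5 / 10 ^ 6)) * n ^ 4 := by gcongr; linarith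
        _ = _ := by ring
    exact le_of_mul_le_mul_left h7 hn0
  exact le_trans (le_of_eq (by ring)) (cnt_and_not_ge h4 h5)

/-- Pairs can be connected avoiding a small set. -/
theorem exists_conn_avoiding (h : PairDeg (Ed H) (2 / 5)) (hV : 10 ^ 8 ≤ (Fintype.card V : ℝ))
    {q p : V × V} (hq : q.1 ≠ q.2) (hp : p.1 ≠ p.2) {Z : Finset V}
    (hZ : (Z.card : ℝ) ≤ 5 / 10 ^ 7 * Fintype.card V) :
    ∃ x y z w, Conn (Ed H) q p (x, y, z, w) ∧ [x, y, z, w].Nodup ∧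
      ∀ v ∈ ({x, y, z, w} : Finset V), v ∉ Z := by
  obtain ⟨f, hf, hf'⟩ := exists_of_cnt_pos (lt_of_lt_of_le (by
    have : 0 < (Fintype.card V : ℝ) := by linarith
    positivity) (cnt_conn_avoiding_ge h hV hq hp hZ))
  push Not at hf'
  refine ⟨f 0, f 1, f 2, f 3, hf, ?_, ?_⟩
  · simp [hf'.1.eq_iff]
  · intro v hv
    simp only [mem_insert, mem_singleton] at hv
    rcases hv with rfl | rfl | rfl | rfl <;> exact hf'.2 _

end Connecting

theorem exists_notMem_of_card_lt {V : Type} [Fintype V] (Z : Finset V)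
    (hZ : Z.card < Fintype.card V) :
    ∃ v, v ∉ Z := by
  obtain ⟨v, -, hv⟩ := Finset.exists_mem_notMem_of_card_lt_card (s := Z) (t := univ)
    (by rwa [card_univ])
  exact ⟨v, hv⟩

/-- Linking all segments of a family of disjoint absorbers gives an absorbing walk. -/
theorem exists_walk_of_absorbers {V : Type} [Fintype V] [DecidableEq V] {H : Finset (Finset V)}
    (h : PairDeg (Ed H) (2 / 5)) (hV : 2 * 10 ^ 12 ≤ (Fintype.card V : ℝ)) {t s : ℕ}
    (F : Fin t → AbsIdx → V) (hF : Function.Injective (fun p : Fin t × AbsIdx => F p.1 p.2))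
    (hFA : ∀ a, ∃ u, Abs H u (F a)) (ht : (t : ℝ) ≤ 1 / 10 ^ 9 * Fintype.card V)
    (hs : ∀ u : V × V × V, u.1 ≠ u.2.1 → u.2.1 ≠ u.2.2 → (s : ℝ) ≤ cnt (fun a => Abs H u (F a))) :
    ∃ (q p : V × V) (l : List (V × V × V)), q.1 ≠ q.2 ∧ p.1 ≠ p.2 ∧ Wk (Ed H) q l ∧ fin q l = p ∧
      (pv q + verts l).Nodup ∧ (pv q + verts l).card = 60 * t + 8 ∧
      ∀ (W : Finset V) (r : ℕ), W.card = 3 * r → r ≤ s →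
        ∃ l', Wk (Ed H) q l' ∧ fin q l' = p ∧ verts l' = verts l + W.val := by
  classical
  have hFinj : ∀ a, Function.Injective (F a) := fun a k k' e => by
    have := hF (a₁ := (a, k)) (a₂ := (a, k')) e
    simpa using this
  set S : Finset V := univ.image (fun p : Fin t × AbsIdx => F p.1 p.2) with hS
  have hSc : S.card = t * 40 := by
    rw [hS, card_image_of_injective _ hF]
    simp [AbsIdx]
  have hSv : S.val = ∑ a, ∑ k, {F a k} := by
    rw [hS, Finset.image_val_of_injOn hF.injOn, ← Fintype.sum_prod_type'
      (f := fun a k => ({F a k} : Multiset V)), Finset.sum_eq_multiset_sum]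
    have := Multiset.sum_map_singleton ((univ : Finset (Fin t × AbsIdx)).val.map fun p => F p.1 p.2)
    rw [Multiset.map_map] at this
    exact this.symm
  have hbig : S.card + 4 < Fintype.card V := by
    have : ((S.card + 4 : ℕ) : ℝ) < (Fintype.card V : ℝ) := by
      rw [hSc]; push_cast; linarith
    exact_mod_cast this
  obtain ⟨a, ha⟩ := exists_notMem_of_card_lt S (by omega)
  obtain ⟨b, hb⟩ := exists_notMem_of_card_lt (insert a S) (by
    have := card_insert_le a S; omega)
  obtain ⟨c, hc⟩ := exists_notMem_of_card_lt (insert b (insert a S)) (by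
    have := card_insert_le a S
    have := card_insert_le b (insert a S)
    omega)
  obtain ⟨d, hd⟩ := exists_notMem_of_card_lt (insert c (insert b (insert a S))) (by
    have := card_insert_le a S
    have := card_insert_le b (insert a S)
    have := card_insert_le c (insert b (insert a S))
    omega)
  simp only [mem_insert, not_or] at hb hc hd
  set T : Finset V := {a, b, c, d} with hT
  have hTc : T.card ≤ 4 := card_le_four
  have hTv : T.val = pv (a, b) + pv (c, d) := by
    have h1 : a ∉ ({b, c, d} : Finset V) := by
      simp; exact ⟨fun e => hb.1 e.symm, fun e => hc.2.1 e.symm, fun e => hd.2.2.1 e.symm⟩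
    have h2 : b ∉ ({c, d} : Finset V) := by
      simp; exact ⟨fun e => hc.1 e.symm, fun e => hd.2.1 e.symm⟩
    have h3 : c ∉ ({d} : Finset V) := by
      simp; exact fun e => hd.1 e.symm
    rw [hT, insert_val_of_notMem h1, insert_val_of_notMem h2, insert_val_of_notMem h3]
    simp only [pv, Multiset.insert_eq_cons, ← Multiset.singleton_add, Finset.singleton_val]
    abel
  have hTS : Disjoint T S := by
    rw [Finset.disjoint_left]
    intro v hv
    simp only [hT, mem_insert, mem_singleton] at hv
    rcases hv with rfl | rfl | rfl | rfl
    · exact ha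
    · exact hb.2
    · exact hc.2.2
    · exact hd.2.2.2
  set ι := Fin t × Option (Fin 4) with hι
  obtain ⟨Y, hYR, hYc, hY⟩ := exists_link (E := Ed H) (ι := ι) (R := univ \ (S ∪ T)) (cap := 20 * t)
    (p := (c, d)) (fun e => hd.1 e.symm) (st := fun i => absSt (F i.1) i.2)
    (en := fun i => absEn (F i.1) i.2)
    (by rintro ⟨x, _ | i⟩ e <;> simpa using hFinj x e)
    (by rintro ⟨x, _ | i⟩ e <;> simpa using hFinj x e)
    (by
      intro q p X hq hp hX
      obtain ⟨x, y, z, w, h1, h2, h3⟩ := exists_conn_avoiding h (by linarith) hq hp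
        (Z := X ∪ (S ∪ T)) (by
          have h5 : (X ∪ (S ∪ T)).card ≤ 60 * t + 4 := by
            have := card_union_le X (S ∪ T)
            have := card_union_le S T
            omega
          have h6 : ((X ∪ (S ∪ T)).card : ℝ) ≤ 60 * t + 4 := by exact_mod_cast h5
          linarith)
      refine ⟨x, y, z, w, h1, h2, fun v hv => ?_⟩
      have := h3 v hv
      rw [mem_union, not_or] at this
      exact ⟨mem_sdiff.2 ⟨mem_univ _, this.2⟩, this.1⟩)
    (univ : Finset ι).toList (q := (a, b)) (fun e => hb.1 e.symm) (X := ∅) (by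
      simp [hι]; omega)
  have hlen : (univ : Finset ι).toList.length = t * 5 := by simp [hι]
  rw [hlen] at hYc
  have hsum : ∀ alt : ι → List (V × V × V),
      ((univ : Finset ι).toList.map fun i => pv (absSt (F i.1) i.2) + verts (alt i)).sum =
        ∑ x, ∑ o, (pv (absSt (F x) o) + verts (alt (x, o))) := fun alt => by
    rw [Finset.sum_map_toList, Fintype.sum_prod_type]
  obtain ⟨l, hl, hlf, hlv⟩ := hY (fun i => segOff (F i.1) i.2) fun i _ => by
    obtain ⟨u, hu⟩ := hFA i.1
    exact wk_segOff hu i.2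
  rw [hsum] at hlv
  simp only [sum_segOff] at hlv
  rw [← hSv] at hlv
  have htot : pv (a, b) + verts l = T.val + S.val + Y.val := by
    rw [hlv, hTv]; abel
  refine ⟨(a, b), (c, d), l, fun e => hb.1 e.symm, fun e => hd.1 e.symm, hl, hlf, ?_, ?_, ?_⟩
  · rw [htot, Multiset.nodup_add, Multiset.nodup_add]
    refine ⟨⟨T.nodup, S.nodup, Finset.disjoint_val.2 hTS⟩, Y.nodup, ?_⟩
    rw [Multiset.disjoint_left]
    intro v hv hvY
    have := (hYR v hvY).1
    rw [mem_sdiff, mem_union, not_or] at this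
    rw [Multiset.mem_add] at hv
    exact hv.elim this.2.2 this.2.1
  · rw [hlv]
    simp only [Multiset.card_add, Finset.card_val, hYc, hSc, pv]
    simp
    ring
  · intro W r hW hr
    obtain ⟨σ, hσ, -, hσW⟩ := exists_assignment F s hs r hr W hW
    obtain ⟨l', hl', hlf', hlv'⟩ := hY
      (fun i => (σ i.1).elim (segOff (F i.1) i.2) fun u => segOn (F i.1) u i.2) fun i _ => by
        cases hi : σ i.1 with
        | none =>
          obtain ⟨u, hu⟩ := hFA i.1
          exact wk_segOff hu i.2
        | some u => exact wk_segOn (hσ _ _ hi) i.2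
    refine ⟨l', hl', hlf', ?_⟩
    rw [hlv', hsum, hlv, ← hσW, hSv, add_assoc _ (∑ a, ∑ k, {F a k}), ← Finset.sum_add_distrib]
    congr 1
    refine Finset.sum_congr rfl fun x _ => ?_
    cases hx : σ x with
    | none => simp only [hx, Option.elim_none, sum_segOff, add_zero]
    | some u => simp only [hx, Option.elim_some, sum_segOn]

/-- There is a short walk absorbing every small set of vertices. -/
theorem exists_absorbing_walk {ε : ℝ} (hε : 0 < ε) :
    ∃ τ > 0, ∃ n₀ : ℕ, ∀ (V : Type) [Fintype V] [DecidableEq V] (H : Finset (Finset V)),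
      n₀ ≤ Fintype.card V → (∀ e ∈ H, e.card = 5) → PairDeg (Ed H) (2 / 5) →
      ∃ (q p : V × V) (l : List (V × V × V)), q.1 ≠ q.2 ∧ p.1 ≠ p.2 ∧ Wk (Ed H) q l ∧ fin q l = p ∧
        (pv q + verts l).Nodup ∧ ((pv q + verts l).card : ℝ) ≤ ε * Fintype.card V ∧
        ∀ (W : Finset V) (r : ℕ), W.card = 3 * r → (r : ℝ) ≤ τ * Fintype.card V →
          ∃ l', Wk (Ed H) q l' ∧ fin q l' = p ∧ verts l' = verts l + W.val := by
  classical
  set c : ℝ := 12 / 10 ^ 12 * ((1 / 10 ^ 12) ^ 8 / 2) ^ 4 with hc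
  have hc0 : 0 < c := by positivity
  have hc4 : c / 2 ≤ 4 := by rw [hc]; norm_num
  obtain ⟨n₁, h₁⟩ := cnt_clean_ge (K := AbsIdx) 0 hc0
  have : Nonempty AbsIdx := ⟨Sum.inl 0⟩
  obtain ⟨τ, hτ, n₂, h₂⟩ := exists_selection (K := AbsIdx) (c := c / 2) (by positivity) hc4 3
    (τ := min (ε / 120) (1 / 10 ^ 9)) (by positivity)
  refine ⟨τ, hτ, max (max n₁ n₂) (max (2 * 10 ^ 12) ⌈16 / ε⌉₊), fun V _ _ H hV hH hdeg => ?_⟩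
  have hV1 : n₁ ≤ Fintype.card V := (le_max_left _ _).trans ((le_max_left _ _).trans hV)
  have hV2 : n₂ ≤ Fintype.card V := (le_max_right _ _).trans ((le_max_left _ _).trans hV)
  have hV3 : 2 * 10 ^ 12 ≤ (Fintype.card V : ℝ) := by
    exact_mod_cast (le_max_left _ _).trans ((le_max_right _ _).trans hV)
  have hV4 : 16 / ε ≤ (Fintype.card V : ℝ) := (Nat.le_ceil _).trans (by
    exact_mod_cast (le_max_right _ _).trans ((le_max_right _ _).trans hV))
  rw [div_le_iff₀ hε] at hV4
  obtain ⟨t, F, hF, htn, hFA, hFs⟩ := h₂ V hV2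
    {u : V × V × V // u.1 ≠ u.2.1 ∧ u.2.1 ≠ u.2.2}
    (fun u f => Abs H u.1 f ∧ ¬ (¬ Function.Injective f ∨ ∃ i, f i ∈ (∅ : Finset V)))
    ((Fintype.card_subtype_le _).trans (by simp only [Fintype.card_prod]; apply le_of_eq; ring))
    (fun u f hf => by have := hf.2; push Not at this; exact this.1)
    (fun u => h₁ V hV1 _ ∅ (by simp) (cnt_abs_ge hH hdeg hV3 u.2.1 u.2.2))
  have hn0 : 0 < (Fintype.card V : ℝ) := by linarith
  obtain ⟨q, p, l, h1, h2, h3, h4, h5, h6, h7⟩ := exists_walk_of_absorbers hdeg hV3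
    (s := ⌊τ * Fintype.card V⌋₊) F hF
    (fun a => by obtain ⟨u, hu⟩ := hFA a; exact ⟨u.1, hu.1⟩)
    (htn.trans (by gcongr; exact min_le_right _ _))
    (fun u hu hu' => (Nat.floor_le (by positivity)).trans
      ((hFs ⟨u, hu, hu'⟩).trans (cnt_mono fun a ha => ha.1)))
  refine ⟨q, p, l, h1, h2, h3, h4, h5, ?_, fun W r hW hr => h7 W r hW (Nat.le_floor hr)⟩
  rw [h6]
  push_cast
  have : (t : ℝ) ≤ ε / 120 * Fintype.card V := htn.trans (by gcongr; exact min_le_left _ _)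
  linarith

/-- Few members of a disjoint family meet a given set. -/
theorem cnt_meet_le {K V : Type} [Fintype V] {t : ℕ} {F : Fin t → K → V}
    (hF : Function.Injective (fun p : Fin t × K => F p.1 p.2)) (X : Finset V) :
    cnt (fun a => ∃ k, F a k ∈ X) ≤ X.card := by
  classical
  rcases isEmpty_or_nonempty K with hK | hK
  · refine (cnt_mono (Q := fun _ => False) fun a ⟨k, _⟩ => hK.elim k).trans ?_
    simp [cnt]
  have h : ∀ a, ∃ k, (∃ k, F a k ∈ X) → F a k ∈ X := fun a => by
    by_cases ha : ∃ k, F a k ∈ X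
    · obtain ⟨k, hk⟩ := ha
      exact ⟨k, fun _ => hk⟩
    · exact ⟨Classical.arbitrary K, fun h => absurd h ha⟩
  choose g hg using h
  refine (cnt_le_of_injOn (Q := fun v : V => v ∈ X) (fun a => F a (g a)) hg ?_).trans ?_
  · intro a b _ _ e
    have := hF (a₁ := (a, g a)) (a₂ := (b, g b)) e
    exact (Prod.mk.inj this).1
  · rw [cnt_eq_card]
    simp

/-- A small reservoir through which all pairs can be connected robustly. -/
theorem exists_reservoir {σ : ℝ} (hσ : 0 < σ) :
    ∃ τ > 0, ∃ n₀ : ℕ, ∀ (V : Type) [Fintype V] [DecidableEq V] (H : Finset (Finset V)),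
      n₀ ≤ Fintype.card V → PairDeg (Ed H) (2 / 5) → ∀ Z : Finset V,
      (Z.card : ℝ) ≤ 5 / 10 ^ 7 * Fintype.card V →
      ∃ R : Finset V, (R.card : ℝ) ≤ σ * Fintype.card V ∧ Disjoint R Z ∧
        ∀ (q p : V × V) (X : Finset V), q.1 ≠ q.2 → p.1 ≠ p.2 →
          (X.card : ℝ) < τ * Fintype.card V →
          ∃ x y z w, Conn (Ed H) q p (x, y, z, w) ∧ [x, y, z, w].Nodup ∧
            ∀ v ∈ ({x, y, z, w} : Finset V), v ∈ R ∧ v ∉ X := by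
  classical
  obtain ⟨τ, hτ, n₀, h₀⟩ := exists_selection (K := Fin 4) (c := 1 / (2 * 10 ^ 6)) (by positivity)
    (by norm_num) 4 (τ := σ / 4) (by positivity)
  refine ⟨τ, hτ, max n₀ (10 ^ 8), fun V _ _ H hV hdeg Z hZ => ?_⟩
  have hV2 : 10 ^ 8 ≤ (Fintype.card V : ℝ) := by exact_mod_cast (le_max_right _ _).trans hV
  obtain ⟨t, F, hF, htn, hFA, hFs⟩ := h₀ V ((le_max_left _ _).trans hV)
    {u : (V × V) × V × V // u.1.1 ≠ u.1.2 ∧ u.2.1 ≠ u.2.2}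
    (fun u f => Conn (Ed H) u.1.1 u.1.2 (f 0, f 1, f 2, f 3) ∧
      ¬ (¬ Function.Injective f ∨ ∃ i, f i ∈ Z))
    ((Fintype.card_subtype_le _).trans (by simp only [Fintype.card_prod]; apply le_of_eq; ring))
    (fun u f hf => by have := hf.2; push Not at this; exact this.1)
    (fun u => by
      rw [Fintype.card_fin]
      exact cnt_conn_avoiding_ge hdeg hV2 u.2.1 u.2.2 hZ)
  refine ⟨univ.image (fun p : Fin t × Fin 4 => F p.1 p.2), ?_, ?_, ?_⟩
  · have h1 : (univ.image (fun p : Fin t × Fin 4 => F p.1 p.2)).card ≤ t * 4 :=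
      card_image_le.trans (by simp)
    have h2 : ((univ.image (fun p : Fin t × Fin 4 => F p.1 p.2)).card : ℝ) ≤ t * 4 := by
      exact_mod_cast h1
    linarith
  · rw [Finset.disjoint_left]
    intro v hv
    obtain ⟨⟨a, k⟩, -, rfl⟩ := mem_image.1 hv
    obtain ⟨u, hu⟩ := hFA a
    have := hu.2
    push Not at this
    exact this.2 k
  · intro q p X hq hp hX
    have h1 := cnt_and_not_ge (hFs ⟨(q, p), hq, hp⟩) (cnt_meet_le hF X)
    obtain ⟨a, ⟨h2, h3⟩, h4⟩ := exists_of_cnt_pos (lt_of_lt_of_le (by linarith) h1)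
    push Not at h3 h4
    refine ⟨F a 0, F a 1, F a 2, F a 3, h2, ?_, ?_⟩
    · simp [h3.1.eq_iff]
    · intro v hv
      simp only [mem_insert, mem_singleton] at hv
      rcases hv with rfl | rfl | rfl | rfl <;>
        exact ⟨mem_image_of_mem (fun p : Fin t × Fin 4 => F p.1 p.2) (mem_univ (a, _)), h4 _⟩

theorem PairDeg.mono {V : Type} [Fintype V] {E : V → V → V → V → V → Prop} {κ κ' : ℝ}
    (h : PairDeg E κ) (hκ : κ' ≤ κ) : PairDeg E κ' := fun u v huv =>
  (mul_le_mul_of_nonneg_right hκ (by positivity)).trans (h u v huv)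

/-- Almost perfect tilings of the complement of a small set. -/
theorem exists_tiling_off {η ε : ℝ} (hη : 0 < η) (hη1 : η ≤ 1) (hε : 0 < ε) (hε1 : ε ≤ 1) {m : ℕ}
    (hm : 0 < m) :
    ∃ n₀ : ℕ, ∀ (V : Type) [Fintype V] (E : V → V → V → V → V → Prop), n₀ ≤ Fintype.card V →
      Distinct E → PairDeg E (91 / 216 + η) → ∀ X : Finset V,
      (X.card : ℝ) ≤ η / 6 * Fintype.card V →
      ∃ (κ : Type) (_ : Fintype κ) (g : κ → Fin 6 → Fin m → V), (∀ x, IsTile E (g x)) ∧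
        Function.Injective (fun p : κ × Fin 6 × Fin m => g p.1 p.2.1 p.2.2) ∧
        (∀ x s a, g x s a ∉ X) ∧
        Fintype.card V - X.card - ε * Fintype.card V ≤ Fintype.card κ * (6 * m : ℝ) := by
  classical
  obtain ⟨n₀, h₀⟩ := tilingBound (η := η / 2) (by positivity) (by linarith) hε hε1 m hm
  refine ⟨2 * n₀, fun V _ E hV hE hdeg X hX => ?_⟩
  have hcard : (Fintype.card {v // v ∉ X} : ℝ) = Fintype.card V - X.card := by
    rw [Fintype.card_subtype_compl, Fintype.card_coe, Nat.cast_sub (card_le_univ X)]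
  have hn : (0 : ℝ) ≤ Fintype.card V := by positivity
  have hle : (Fintype.card {v // v ∉ X} : ℝ) ≤ Fintype.card V := by
    rw [hcard]; linarith [(Nat.cast_nonneg X.card : (0 : ℝ) ≤ _)]
  obtain ⟨κ, hκ, g, hg, hinj, hcov⟩ := h₀ {v // v ∉ X} (fun a b c d e => E a b c d e)
    (by
      have h1 : (2 * n₀ : ℝ) ≤ Fintype.card V := by exact_mod_cast hV
      have h2 : (n₀ : ℝ) ≤ Fintype.card {v // v ∉ X} := by rw [hcard]; nlinarith
      exact_mod_cast h2)
    (fun a b c d e h => by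
      have := hE _ _ _ _ _ h
      simp only [List.nodup_cons, List.mem_cons, List.not_mem_nil, or_false, not_or,
        not_false_eq_true, List.nodup_nil, and_true, Subtype.ext_iff] at this ⊢
      exact this)
    (fun u v huv => by
      have h1 := hdeg u v (fun h => huv (Subtype.ext h))
      have h2 := cnt_triples_le_comp (c := fun w : {v // v ∉ X} => (w : V)) Subtype.val_injective
        (fun t => E t.1 t.2.1 t.2.2 u v)
      rw [hcard, sub_sub_cancel] at h2
      have h3 : (Fintype.card {v // v ∉ X} : ℝ) ^ 3 ≤ (Fintype.card V : ℝ) ^ 3 :=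
        pow_le_pow_left₀ (by positivity) hle 3
      have h4 := mul_le_mul_of_nonneg_right hX (sq_nonneg (Fintype.card V : ℝ))
      nlinarith)
  refine ⟨κ, hκ, fun x s a => g x s a, fun x => hg x, fun p q h => hinj (Subtype.ext h),
    fun x s a => (g x s a).2, ?_⟩
  rw [hcard] at hcov
  nlinarith [(Nat.cast_nonneg X.card : (0 : ℝ) ≤ _)]

/-- The total vertex multiset of a disjoint family of tiles. -/
theorem sum_tiles {V κ : Type} [Fintype κ] [DecidableEq V] {m : ℕ} {g : κ → Fin 6 → Fin m → V}
    (hg : Function.Injective (fun p : κ × Fin 6 × Fin m => g p.1 p.2.1 p.2.2)) :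
    ∑ x, ∑ a, ∑ s, ({g x s a} : Multiset V) =
      (univ.image fun p : κ × Fin 6 × Fin m => g p.1 p.2.1 p.2.2).val := by
  rw [Finset.image_val_of_injOn hg.injOn]
  have h : ∀ x, ∑ a, ∑ s, ({g x s a} : Multiset V) = ∑ s, ∑ a, ({g x s a} : Multiset V) := fun x =>
    Finset.sum_comm
  simp only [h]
  rw [← Multiset.sum_map_singleton (Multiset.map _ _), Multiset.map_map]
  change _ = ∑ p : κ × Fin 6 × Fin m, ({g p.1 p.2.1 p.2.2} : Multiset V)
  simp only [Fintype.sum_prod_type]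

theorem ed_symm {V : Type} [DecidableEq V] (H : Finset (Finset V)) :
    (∀ a b c d e, Ed H a b c d e → Ed H a b e c d) ∧
      ∀ a b c d e, Ed H a b c d e → Ed H c d e a b :=
  ⟨fun _ _ _ _ _ h => h.congr (by ext; simp; tauto),
    fun _ _ _ _ _ h => h.congr (by ext; simp; tauto)⟩

/-- Linking the tiles into one walk through the reservoir. -/
theorem exists_walk_of_tiling {V κ : Type} [Fintype κ] [DecidableEq V] {H : Finset (Finset V)}
    {m : ℕ} {g : κ → Fin 6 → Fin (m + 1) → V} (hg : ∀ x, IsTile (Ed H) (g x))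
    (hinj : Function.Injective (fun p : κ × Fin 6 × Fin (m + 1) => g p.1 p.2.1 p.2.2))
    {R : Finset V} {q p : V × V} (hq : q.1 ≠ q.2) (hp : p.1 ≠ p.2)
    (avail : ∀ (q p : V × V) (X : Finset V), q.1 ≠ q.2 → p.1 ≠ p.2 → X.card ≤ 4 * Fintype.card κ →
      ∃ x y z w, Conn (Ed H) q p (x, y, z, w) ∧ [x, y, z, w].Nodup ∧
        ∀ v ∈ ({x, y, z, w} : Finset V), v ∈ R ∧ v ∉ X) :
    ∃ (l : List (V × V × V)) (Y : Finset V) (S Z : Multiset V), Wk (Ed H) q l ∧ fin q l = p ∧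
      Y ⊆ R ∧ verts l = Y.val + pv p + S ∧ Z.card = 4 * Fintype.card κ ∧
      S + Z = (univ.image fun p : κ × Fin 6 × Fin (m + 1) => g p.1 p.2.1 p.2.2).val := by
  have h1 := fun x => exists_walk_of_tile (ed_symm H).1 (ed_symm H).2 m (g x) (hg x)
  choose alt Z a b hw hf hZ hsum using h1
  have hne : ∀ x a b, g x 0 a ≠ g x 1 b := fun x a b h => by
    have := hinj (a₁ := (x, 0, a)) (a₂ := (x, 1, b)) h
    simp at this
  obtain ⟨Y, hY, -, h2⟩ := exists_link (R := R) (cap := 4 * Fintype.card κ) (p := p) hp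
    (st := fun x => (g x 0 0, g x 1 0)) (en := fun x => (g x 0 (a x), g x 1 (b x)))
    (fun x => hne x _ _) (fun x => hne x _ _) avail (univ : Finset κ).toList hq (X := ∅) (by simp)
  obtain ⟨l, hl, hfl, hv⟩ := h2 alt fun x _ => ⟨hw x, hf x⟩
  refine ⟨l, Y, _, ∑ x, Z x, hl, hfl, fun v hv => (hY v hv).1, hv, ?_, ?_⟩
  · rw [Multiset.card_sum]
    simp [hZ, mul_comm]
  · rw [Finset.sum_map_toList, ← Finset.sum_add_distrib, ← sum_tiles hinj]
    exact Finset.sum_congr rfl fun x _ => hsum x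

/-- Closing up: an absorbing walk, a reservoir and a tiling give a spanning closed walk. -/
theorem exists_spanning_walk {V κ : Type} [Fintype V] [DecidableEq V] [Fintype κ]
    {H : Finset (Finset V)} (h3 : 3 ∣ Fintype.card V) {q p : V × V} {l : List (V × V × V)}
    (hq : q.1 ≠ q.2) (hp : p.1 ≠ p.2)
    (hnd : (pv q + verts l).Nodup) {R : Finset V} (hRZ : Disjoint R (pv q + verts l).toFinset)
    {m : ℕ} {g : κ → Fin 6 → Fin (m + 1) → V} (hg : ∀ x, IsTile (Ed H) (g x))
    (hinj : Function.Injective (fun p : κ × Fin 6 × Fin (m + 1) => g p.1 p.2.1 p.2.2))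
    (hgX : ∀ x s a, g x s a ∉ (pv q + verts l).toFinset ∪ R)
    (avail : ∀ (q p : V × V) (X : Finset V), q.1 ≠ q.2 → p.1 ≠ p.2 → X.card ≤ 4 * Fintype.card κ →
      ∃ x y z w, Conn (Ed H) q p (x, y, z, w) ∧ [x, y, z, w].Nodup ∧
        ∀ v ∈ ({x, y, z, w} : Finset V), v ∈ R ∧ v ∉ X) {c : ℝ}
    (hc : (Fintype.card V : ℝ) + 4 * Fintype.card κ ≤
      (pv q + verts l).card + Fintype.card κ * (6 * (m + 1)) + 3 * c)
    (habs : ∀ (W : Finset V) (r : ℕ), W.card = 3 * r → (r : ℝ) ≤ c →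
      ∃ l', Wk (Ed H) q l' ∧ fin q l' = p ∧ verts l' = verts l + W.val) :
    ∃ (p : V × V) (l : List (V × V × V)), Wk (Ed H) p l ∧ fin p l = p ∧
      verts l = (univ : Finset V).val := by
  obtain ⟨l₂, Y, S, Z, hl₂, hfl₂, hY, hv, hZ, hSZ⟩ := exists_walk_of_tiling hg hinj hp hq avail
  set U := univ.image fun p : κ × Fin 6 × Fin (m + 1) => g p.1 p.2.1 p.2.2 with hU
  have hUc : U.card = Fintype.card κ * (6 * (m + 1)) := by
    rw [hU, card_image_of_injective _ hinj]; simp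
  have hT : verts l + verts l₂ = (pv q + verts l) + (Y.val + S) := by rw [hv]; abel
  have hUX : ∀ v ∈ U, v ∉ (pv q + verts l).toFinset ∪ R := by
    intro v hv
    obtain ⟨⟨x, s, a⟩, -, rfl⟩ := mem_image.1 hv
    exact hgX x s a
  have hTn : (verts l + verts l₂).Nodup := by
    rw [hT]
    refine Multiset.nodup_of_le (t := (pv q + verts l) + (Y.val + U.val)) ?_ ?_
    · rw [← hSZ]
      gcongr
      exact Multiset.le_add_right _ _
    · refine Multiset.nodup_add.2 ⟨hnd, Multiset.nodup_add.2 ⟨Y.nodup, U.nodup, ?_⟩, ?_⟩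
      · rw [Finset.disjoint_val, Finset.disjoint_left]
        exact fun v hv hvU => hUX v hvU (mem_union_right _ (hY hv))
      · rw [Multiset.disjoint_left]
        intro v hv hv'
        rcases Multiset.mem_add.1 hv' with h | h
        · exact Finset.disjoint_left.1 hRZ (hY h) (Multiset.mem_toFinset.2 hv)
        · exact hUX v h (mem_union_left _ (Multiset.mem_toFinset.2 hv))
  set T : Finset V := ⟨_, hTn⟩ with hTdef
  have hTc : T.card = 3 * (l.length + l₂.length) := by
    change (verts l + verts l₂).card = _
    rw [Multiset.card_add, card_verts, card_verts]; ring
  have hTc' : T.card + 4 * Fintype.card κ = (pv q + verts l).card + Y.card + U.card := by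
    change (verts l + verts l₂).card + _ = _
    have h1 : S.card + Z.card = U.card := by rw [← Multiset.card_add, hSZ]; rfl
    rw [hT, Multiset.card_add, Multiset.card_add (Y.val)]
    change _ + (Y.card + _) + _ = _
    omega
  obtain ⟨k, hk⟩ := h3
  have hWc : (univ \ T).card = 3 * (k - (l.length + l₂.length)) := by
    rw [card_sdiff_of_subset (subset_univ _), card_univ, hk, hTc]; omega
  have hTle : T.card ≤ 3 * k := by rw [← hk]; exact card_le_univ T
  obtain ⟨l', hl', hfl', hv'⟩ := habs (univ \ T) _ hWc (by
    rw [Nat.cast_sub (by omega)]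
    have h1 : (T.card : ℝ) + 4 * Fintype.card κ = (pv q + verts l).card + Y.card + U.card := by
      exact_mod_cast hTc'
    have h2 : (T.card : ℝ) = 3 * (l.length + l₂.length : ℕ) := by exact_mod_cast hTc
    have h4 : (U.card : ℝ) = Fintype.card κ * (6 * (m + 1)) := by exact_mod_cast hUc
    have h5 : (Fintype.card V : ℝ) = 3 * k := by exact_mod_cast hk
    have h6 : (0 : ℝ) ≤ Y.card := by positivity
    linarith)
  refine ⟨q, l' ++ l₂, wk_append hl' (by rw [hfl']; exact hl₂), by rw [fin_append, hfl', hfl₂], ?_⟩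
  rw [verts_append, hv', add_right_comm]
  change T.val + (univ \ T).val = _
  have h1 : (T.disjUnion (univ \ T) disjoint_sdiff).val = T.val + (univ \ T).val := rfl
  rw [← h1, disjUnion_eq_union, union_sdiff_of_subset (subset_univ _)]

theorem exists_spanning_walk_of_pairDeg {η : ℝ} (hη : 0 < η) (hη1 : η ≤ 1) :
    ∃ n₀ : ℕ, ∀ (V : Type) [Fintype V] [DecidableEq V] (H : Finset (Finset V)),
      n₀ ≤ Fintype.card V → 3 ∣ Fintype.card V → (∀ e ∈ H, e.card = 5) →
      PairDeg (Ed H) (91 / 216 + η) →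
      ∃ (p : V × V) (l : List (V × V × V)), Wk (Ed H) p l ∧ fin p l = p ∧
        verts l = (univ : Finset V).val := by
  obtain ⟨τ₁, hτ₁, n₁, h₁⟩ := exists_absorbing_walk (ε := min (5 / 10 ^ 7) (η / 12)) (by positivity)
  obtain ⟨τ₂, hτ₂, n₂, h₂⟩ := exists_reservoir (σ := min τ₁ (η / 12)) (by positivity)
  obtain ⟨m, hm⟩ := exists_nat_one_div_lt (show 0 < min τ₁ τ₂ by positivity)
  obtain ⟨n₃, h₃⟩ := exists_tiling_off hη hη1 (ε := min τ₁ 1) (by positivity) (min_le_right _ _)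
    m.succ_pos
  refine ⟨max (max n₁ n₂) (max n₃ 1), fun V _ _ H hV h3 hH hdeg => ?_⟩
  simp only [max_le_iff] at hV
  have hdeg' : PairDeg (Ed H) (2 / 5) := hdeg.mono (by linarith)
  have hn : (0 : ℝ) < Fintype.card V := by exact_mod_cast hV.2.2
  obtain ⟨q, p, l, hq, hp, -, -, hnd, hc, habs⟩ := h₁ V H hV.1.1 hH hdeg'
  have hZc : (pv q + verts l).toFinset.card = (pv q + verts l).card :=
    Multiset.toFinset_card_of_nodup hnd
  obtain ⟨R, hRc, hRZ, hav⟩ := h₂ V H hV.1.2 hdeg' (pv q + verts l).toFinset (by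
    rw [hZc]
    exact hc.trans (mul_le_mul_of_nonneg_right (min_le_left _ _) hn.le))
  have hXc : (((pv q + verts l).toFinset ∪ R).card : ℝ) ≤ (pv q + verts l).card + R.card := by
    have := card_union_le (pv q + verts l).toFinset R
    rw [hZc] at this
    exact_mod_cast this
  have hc2 := hc.trans (mul_le_mul_of_nonneg_right (min_le_right _ _) hn.le)
  have hR2 := hRc.trans (mul_le_mul_of_nonneg_right (min_le_right _ _) hn.le)
  have hR1 := hRc.trans (mul_le_mul_of_nonneg_right (min_le_left _ _) hn.le)
  obtain ⟨κ, _, g, hg, hinj, hgX, hcov⟩ := h₃ V (Ed H) hV.2.1 (distinct_ed hH) hdeg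
    ((pv q + verts l).toFinset ∪ R) (by linarith)
  have hκ : (Fintype.card κ * (6 * (m + 1)) : ℝ) ≤ Fintype.card V := by
    have := Fintype.card_le_of_injective _ hinj
    simp only [Fintype.card_prod, Fintype.card_fin] at this
    exact_mod_cast this
  have hmin : (4 * Fintype.card κ : ℝ) < min τ₁ τ₂ * Fintype.card V := by
    refine lt_of_le_of_lt ?_ (mul_lt_mul_of_pos_right hm hn)
    rw [div_mul_eq_mul_div, one_mul, le_div_iff₀ (by positivity)]
    nlinarith [(by positivity : (0 : ℝ) ≤ Fintype.card κ * (m + 1))]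
  have hmin1 := hmin.trans_le (mul_le_mul_of_nonneg_right (min_le_left _ _) hn.le)
  have hmin2 := hmin.trans_le (mul_le_mul_of_nonneg_right (min_le_right _ _) hn.le)
  have hε := mul_le_mul_of_nonneg_right (min_le_left τ₁ 1) hn.le
  push_cast at hcov
  refine exists_spanning_walk (c := τ₁ * Fintype.card V) h3 hq hp hnd hRZ hg hinj hgX
    (fun q p X hq hp hX => hav q p X hq hp (lt_of_le_of_lt ?_ hmin2)) ?_ habs
  · exact_mod_cast hX
  · linarith

/-- The number of ordered triples completing a pair to an edge. -/
theorem six_mul_hDeg_le {n : ℕ} {H : Finset (Finset (Fin n))} {u v : Fin n} (huv : u ≠ v) :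
    (6 * hDeg n 5 H {u, v} : ℝ) ≤
      cnt (fun t : Fin n × Fin n × Fin n => Ed H t.1 t.2.1 t.2.2 u v) := by
  classical
  have hc : ({u, v} : Finset (Fin n)).card = 2 := card_pair huv
  set A := {T : Finset (Fin n) // T.card = 5 - ({u, v} : Finset (Fin n)).card ∧
    Disjoint {u, v} T ∧ {u, v} ∪ T ∈ H}
  have hA : ∀ T : A, T.1.card = 3 := fun T => by rw [T.2.1, hc]
  let e : ∀ T : A, Fin 3 → Fin n := fun T i => ((T.1.equivFinOfCardEq (hA T)).symm i).1
  have he : ∀ T, Function.Injective (e T) := fun T =>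
    Subtype.val_injective.comp (Equiv.injective _)
  have hr : ∀ (T : A) (x : Fin n), x ∈ T.1 ↔ ∃ i, e T i = x := fun T x =>
    ⟨fun hx => ⟨T.1.equivFinOfCardEq (hA T) ⟨x, hx⟩, by simp [e]⟩,
      fun ⟨i, hi⟩ => hi ▸ ((T.1.equivFinOfCardEq (hA T)).symm i).2⟩
  let f : A × Equiv.Perm (Fin 3) → {t : Fin n × Fin n × Fin n // Ed H t.1 t.2.1 t.2.2 u v} :=
    fun p => ⟨(e p.1 (p.2 0), e p.1 (p.2 1), e p.1 (p.2 2)), by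
      have h1 : ({e p.1 (p.2 0), e p.1 (p.2 1), e p.1 (p.2 2), u, v} : Finset (Fin n)) =
          {u, v} ∪ p.1.1 := by
        ext x
        have h2 : (∃ i, e p.1 i = x) ↔ ∃ i, e p.1 (p.2 i) = x :=
          (p.2.surjective.exists (p := fun i => e p.1 i = x))
        rw [mem_union, hr, h2, Fin.exists_fin_succ, Fin.exists_fin_two]
        simp only [mem_insert, mem_singleton, eq_comm (a := x)]
        change _ ↔ _ ∨ (e p.1 (p.2 0) = x ∨ e p.1 (p.2 1) = x ∨ e p.1 (p.2 2) = x)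
        tauto
      change ({e p.1 (p.2 0), e p.1 (p.2 1), e p.1 (p.2 2), u, v} : Finset (Fin n)) ∈ H
      rw [h1]
      exact p.1.2.2.2⟩
  have hf : Function.Injective f := by
    rintro ⟨T, π⟩ ⟨T', π'⟩ h
    have h1 : ∀ i, e T (π i) = e T' (π' i) := by
      have h0 := congrArg Subtype.val h
      simp only [f, Prod.mk.injEq] at h0
      intro i
      fin_cases i
      exacts [h0.1, h0.2.1, h0.2.2]
    have h2 : T = T' := by
      refine Subtype.ext (Finset.ext fun x => ?_)
      rw [hr, hr, π.surjective.exists (p := fun i => e T i = x),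
        π'.surjective.exists (p := fun i => e T' i = x)]
      simp only [h1]
    subst h2
    exact Prod.ext rfl (Equiv.ext fun i => he T (h1 i))
  have h3 := Fintype.card_le_of_injective f hf
  rw [Fintype.card_prod, Fintype.card_perm, Fintype.card_fin] at h3
  have h4 : hDeg n 5 H {u, v} = Fintype.card A := Nat.card_eq_fintype_card
  rw [cnt_eq_card, h4, ← Fintype.card_subtype]
  have h5 : Nat.factorial 3 = 6 := rfl
  rw [h5, mul_comm] at h3
  exact_mod_cast h3

theorem six_mul_choose_three_ge {n : ℕ} (hn : 2 ≤ n) :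
    (n : ℝ) ^ 3 - 3 * n ^ 2 ≤ 6 * n.choose 3 := by
  have h := Nat.descFactorial_eq_factorial_mul_choose n 3
  simp only [Nat.descFactorial, Nat.sub_zero, mul_one] at h
  have h1 : (((n - 2) * ((n - 1) * n) : ℕ) : ℝ) = 6 * n.choose 3 := by
    rw [h]; push_cast; norm_num [Nat.factorial]
  rw [← h1]
  push_cast [Nat.cast_sub hn, Nat.cast_sub (one_le_two.trans hn)]
  nlinarith [(Nat.cast_nonneg n : (0 : ℝ) ≤ n)]

theorem pairDeg_of_minDeg {n : ℕ} {H : Finset (Finset (Fin n))} {η : ℝ} (hη : 0 < η) (hη1 : η ≤ 1)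
    (hn : 2 ≤ n) (hηn : 10 ≤ η * n)
    (h : (91 / 216 + η) * (n.choose 3 : ℝ) ≤ (minDeg n 5 2 H : ℝ)) :
    PairDeg (Ed H) (91 / 216 + η / 2) := by
  intro u v huv
  have h1 : minDeg n 5 2 H ≤ hDeg n 5 H {u, v} := Nat.sInf_le ⟨_, card_pair huv, rfl⟩
  have h2 : (minDeg n 5 2 H : ℝ) ≤ hDeg n 5 H {u, v} := by exact_mod_cast h1
  have h3 := six_mul_choose_three_ge hn
  have h4 := six_mul_hDeg_le (H := H) huv
  have h5 := mul_le_mul_of_nonneg_left h3 (by linarith : (0 : ℝ) ≤ 91 / 216 + η)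
  have h6 := mul_le_mul_of_nonneg_right hηn (sq_nonneg (n : ℝ))
  have h7 := mul_le_mul_of_nonneg_right hη1 (sq_nonneg (n : ℝ))
  rw [Fintype.card_fin]
  nlinarith

end TwoCycle

/-- For every `η > 0` there is `n₀` such that for all `n ≥ n₀` with
`3 ∣ n`, every 5-graph on `n` vertices with `δ₂(H) ≥ (91/216 + η) C(n,3)` contains a
Hamilton 2-cycle. -/
theorem dirac_threshold_5_2_2 :
    ∀ η : ℝ, 0 < η → ∃ n₀ : ℕ, ∀ n : ℕ, n₀ ≤ n → 3 ∣ n →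
      ∀ H : Finset (Finset (Fin n)), IsKGraph n 5 H →
        ((91 / 216 : ℝ) + η) * (n.choose 3 : ℝ) ≤ (minDeg n 5 2 H : ℝ) →
        HasHamiltonCycle n 5 2 H := by
  intro η hη
  have hη' : 0 < min η 1 := by positivity
  obtain ⟨n₀, h₀⟩ := TwoCycle.exists_spanning_walk_of_pairDeg (half_pos hη')
    (by linarith [min_le_right η 1])
  refine ⟨max n₀ (max 2 ⌈10 / min η 1⌉₊), fun n hn h3 H hH hdeg => ?_⟩
  simp only [max_le_iff] at hn
  have hnη : 10 ≤ min η 1 * n := by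
    have := (Nat.le_ceil (10 / min η 1)).trans (Nat.cast_le.2 hn.2.2)
    rwa [div_le_iff₀ hη', mul_comm] at this
  obtain ⟨p, l, hl, hfl, hv⟩ := h₀ (Fin n) H (by simpa using hn.1) (by simpa using h3) hH
    (TwoCycle.pairDeg_of_minDeg hη' (min_le_right _ _) hn.2.1 hnη
      (le_trans (mul_le_mul_of_nonneg_right (by linarith [min_le_left η 1]) (by positivity)) hdeg))
  exact TwoCycle.hasHamiltonCycle_of_wk (by omega) hl hfl hv
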